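/- Let k be an algebraically closed field of characteristic zero. A smooth quasi-projective connected curve X over k is groupless over k if and only if X is not isomorphic to ℙ¹_k, 𝔸¹_k, 𝔸¹_k ∖ {0}, nor a smooth proper connected curve of genus one over k. -/

import Mathlib

/-!
Formalization of a statement from "The Lang–Vojta conjectures on projective
pseudo-hyperbolic varieties" (Javanpeykar).

Notions not available in Mathlib (analytifications, genus, ample degrees, Hom-schemes, ...)
are encoded by explicit definitions or structures below; see the docstrings for the
conventions used.
-/

open CategoryTheory AlgebraicGeometry Limits

noncomputable section

/-- `Spec R` as a scheme, for a commutative ring `R`. -/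
abbrev SR (R : Type) [CommRing R] : Scheme := Spec (CommRingCat.of R)

/-- The category of schemes over `Spec R`. -/
abbrev OverR (R : Type) [CommRing R] := Over (SR R)

/-- A morphism of schemes over `Spec R` is constant if it factors through the base `Spec R`. -/
def IsConstant {R : Type} [CommRing R] {X Y : OverR R} (f : X ⟶ Y) : Prop :=
  ∃ y : SR R ⟶ Y.left, f.left = X.hom ≫ y

/-- A morphism `g : V ⟶ W` of schemes, where `V` has structure morphism `sV` to `Spec R`,
is constant if it factors through `Spec R`. -/
def IsConstantHom {R : Type} [CommRing R] {V W : Scheme} (sV : V ⟶ SR R) (g : V ⟶ W) : Prop :=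
  ∃ y : SR R ⟶ W, g = sV ≫ y

/-- A variety over `R`: a finite type, separated scheme over `Spec R`. -/
def IsVarietyOver {R : Type} [CommRing R] (X : OverR R) : Prop :=
  LocallyOfFiniteType X.hom ∧ QuasiCompact X.hom ∧ IsSeparated X.hom

/-- The multiplicative group scheme `𝔾ₘ` over `R`, i.e. the spectrum of the Laurent
polynomial ring over `R` (only its underlying scheme over `Spec R` is needed). -/
def GmO (R : Type) [CommRing R] : OverR R :=
  Over.mk (Spec.map (CommRingCat.ofHom (algebraMap R (LaurentPolynomial R))))

/-- The affine line over `R`. -/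
def A1O (R : Type) [CommRing R] : OverR R :=
  Over.mk (Spec.map (CommRingCat.ofHom (algebraMap R (Polynomial R))))

/-- `Spec R` as the terminal object of the category of schemes over `Spec R`. -/
def ptO (R : Type) [CommRing R] : OverR R := Over.mk (𝟙 (SR R))

/-- A group scheme over `R`, presented via a group structure on its functor of points:
by the Yoneda lemma this is the same as a group object in the category of schemes
over `Spec R`. -/
structure GroupScheme (R : Type) [CommRing R] where
  G : OverR R
  mul : ∀ {T : OverR R}, (T ⟶ G) → (T ⟶ G) → (T ⟶ G)
  one : ∀ (T : OverR R), T ⟶ G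
  inv : ∀ {T : OverR R}, (T ⟶ G) → (T ⟶ G)
  mul_assoc : ∀ {T : OverR R} (a b c : T ⟶ G), mul (mul a b) c = mul a (mul b c)
  one_mul : ∀ {T : OverR R} (a : T ⟶ G), mul (one T) a = a
  inv_mul : ∀ {T : OverR R} (a : T ⟶ G), mul (inv a) a = one T
  mul_natural : ∀ {T T' : OverR R} (f : T ⟶ T') (a b : T' ⟶ G),
    f ≫ mul a b = mul (f ≫ a) (f ≫ b)
  one_natural : ∀ {T T' : OverR R} (f : T ⟶ T'), f ≫ one T' = one T

/-- A finite type, connected group scheme over `R`. -/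
def GroupScheme.IsFiniteTypeConnected {R : Type} [CommRing R] (Γ : GroupScheme R) : Prop :=
  LocallyOfFiniteType Γ.G.hom ∧ QuasiCompact Γ.G.hom ∧ ConnectedSpace Γ.G.left

/-- An abelian variety over `R`: a connected finite type proper group scheme. (Over an
algebraically closed field of characteristic zero this agrees with the usual definition,
since group schemes are then automatically smooth by Cartier's theorem.) -/
def GroupScheme.IsAbelianVariety {R : Type} [CommRing R] (Γ : GroupScheme R) : Prop :=
  Γ.IsFiniteTypeConnected ∧ IsProper Γ.G.hom

/-- A scheme over `R` is groupless if every morphism to it from `𝔾ₘ` and from any abelian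
variety over `R` is constant. -/
def IsGroupless (R : Type) [CommRing R] (X : OverR R) : Prop :=
  (∀ f : GmO R ⟶ X, IsConstant f) ∧
  (∀ Γ : GroupScheme R, Γ.IsAbelianVariety → ∀ f : Γ.G ⟶ X, IsConstant f)

/-- A subset `Z` of a topological space has codimension at least two: every point of
`Z` admits a chain of two strict generizations (this computes the codimension of the
closure of each point of `Z` via the specialization order). -/
def CodimAtLeastTwo {T : Type} [TopologicalSpace T] (Z : Set T) : Prop :=
  ∀ z ∈ Z, ∃ x y : T, x ⤳ y ∧ y ⤳ z ∧ ¬(y ⤳ x) ∧ ¬(z ⤳ y)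

/-- `X` is groupless modulo the closed subset `Δ` if for every finite type connected group
scheme `G` over `R` and every dense open `U ⊆ G` whose complement has codimension at least
two, every non-constant morphism `U ⟶ X` over `R` factors over `Δ`. -/
def GrouplessModulo (R : Type) [CommRing R] (X : OverR R) (Δ : Set X.left) : Prop :=
  ∀ (Γ : GroupScheme R), Γ.IsFiniteTypeConnected →
    ∀ (U : Γ.G.left.Opens), Dense (U : Set Γ.G.left) →
      CodimAtLeastTwo ((U : Set Γ.G.left)ᶜ) →
      ∀ g : U.toScheme ⟶ X.left, g ≫ X.hom = U.ι ≫ Γ.G.hom →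
        ¬ IsConstantHom (U.ι ≫ Γ.G.hom) g → Set.range g.base ⊆ Δ

/-- `X` is pseudo-groupless if it is groupless modulo some proper closed subset. -/
def PseudoGroupless (R : Type) [CommRing R] (X : OverR R) : Prop :=
  ∃ Δ : Set X.left, IsClosed Δ ∧ Δ ≠ Set.univ ∧ GrouplessModulo R X Δ

attribute [local instance] MvPolynomial.gradedAlgebra

/-- The projective line over `k`, as a scheme over `Spec k`. -/
def P1 (k : Type) [CommRing k] : OverR k :=
  Over.mk (AlgebraicGeometry.Proj.toSpecZero (MvPolynomial.homogeneousSubmodule (Fin 2) k) ≫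
    Spec.map (CommRingCat.ofHom
      (algebraMap k ↥(MvPolynomial.homogeneousSubmodule (Fin 2) k 0))))

/-- A smooth projective connected curve over `F`, together with its genus. Since the
cohomological definition of the genus is not available, the genus is carried as data,
pinned down by the classification facts (valid over an algebraically closed field `F`)
that the genus is `0` iff the curve is isomorphic to `ℙ¹` and is `1` iff the curve
underlies an abelian variety. -/
structure SmoothProjectiveCurve (F : Type) [Field F] where
  C : OverR F
  smooth : IsSmooth C.hom
  proper : IsProper C.hom
  connected : ConnectedSpace C.left
  dim_one : topologicalKrullDim C.left = 1
  genus : ℕ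
  genus_zero_iff : genus = 0 ↔ Nonempty (C ≅ P1 F)
  genus_one_iff : genus = 1 ↔ ∃ Γ : GroupScheme F, Γ.IsAbelianVariety ∧ Nonempty (C ≅ Γ.G)


namespace St6

open IsLocalRing

/-- A set of derivations realizing every tangent vector at the closed point. -/
def TangentFamily (k R : Type*) [Field k] [CommRing R] [Algebra k R] [IsLocalRing R]
    (S : Set (Derivation k R R)) : Prop :=
  ∀ φ : R →ₐ[k] DualNumber k, ∃ D ∈ S, ∀ r, D r - algebraMap k R (φ r).snd ∈ maximalIdeal R

section LemmaE

variable {k R : Type*} [Field k] [CommRing R] [Algebra k R] [IsLocalRing R]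

/-- residue map as an algebra hom -/
def resHom (hk : Function.Bijective (algebraMap k (ResidueField R))) : R →ₐ[k] k :=
  ((AlgEquiv.ofBijective (Algebra.ofId k (ResidueField R)) hk).symm : ResidueField R →ₐ[k] k).comp
    (IsScalarTower.toAlgHom k R (ResidueField R))

lemma algebraMap_resHom (hk : Function.Bijective (algebraMap k (ResidueField R))) (r : R) :
    algebraMap k (ResidueField R) (resHom hk r) = residue R r := by
  have := (AlgEquiv.ofBijective (Algebra.ofId k (ResidueField R)) hk).apply_symm_apply
    (algebraMap R (ResidueField R) r)
  exact this

lemma resHom_eq_zero_iff (hk : Function.Bijective (algebraMap k (ResidueField R))) (r : R) :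
    resHom hk r = 0 ↔ r ∈ maximalIdeal R := by
  rw [← residue_eq_zero_iff, ← algebraMap_resHom hk]
  simp

lemma sub_resHom_mem (hk : Function.Bijective (algebraMap k (ResidueField R))) (r : R) :
    r - algebraMap k R (resHom hk r) ∈ maximalIdeal R := by
  rw [← resHom_eq_zero_iff hk]
  simp

/-- the algebra map to dual numbers given by a functional on the cotangent space -/
def dualOfFunctional (hk : Function.Bijective (algebraMap k (ResidueField R)))
    (l : maximalIdeal R →ₗ[k] k) (hl : ∀ x : maximalIdeal R, (x : R) ∈ maximalIdeal R ^ 2 → l x = 0) :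
    R →ₐ[k] DualNumber k :=
  AlgHom.ofLinearMap
    { toFun := fun r => TrivSqZeroExt.inl (resHom hk r) +
        TrivSqZeroExt.inr (l ⟨r - algebraMap k R (resHom hk r), sub_resHom_mem hk r⟩)
      map_add' := by
        intro a b
        have : (⟨a + b - algebraMap k R (resHom hk (a + b)), sub_resHom_mem hk (a + b)⟩ : maximalIdeal R)
          = ⟨a - algebraMap k R (resHom hk a), sub_resHom_mem hk a⟩ +
            ⟨b - algebraMap k R (resHom hk b), sub_resHom_mem hk b⟩ := by
          ext; simp; ring
        rw [this, LinearMap.map_add l]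
        ext <;> simp
      map_smul' := by
        intro c a
        have : (⟨c • a - algebraMap k R (resHom hk (c • a)), sub_resHom_mem hk (c • a)⟩ : maximalIdeal R)
          = c • ⟨a - algebraMap k R (resHom hk a), sub_resHom_mem hk a⟩ := by
          ext; simp [Algebra.smul_def]; ring
        rw [this, LinearMap.map_smul l]
        ext <;> simp }
    (by
      have : (⟨1 - algebraMap k R (resHom hk 1), sub_resHom_mem hk 1⟩ : maximalIdeal R) = 0 := by
        ext; simp
      simp only [LinearMap.coe_mk, AddHom.coe_mk, this]
      simp)
    (by
      intro a b
      have h : (⟨a * b - algebraMap k R (resHom hk (a * b)), sub_resHom_mem hk (a * b)⟩ : maximalIdeal R)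
          = resHom hk a • ⟨b - algebraMap k R (resHom hk b), sub_resHom_mem hk b⟩ +
            resHom hk b • ⟨a - algebraMap k R (resHom hk a), sub_resHom_mem hk a⟩ +
            ⟨(a - algebraMap k R (resHom hk a)) * (b - algebraMap k R (resHom hk b)),
              Ideal.mul_mem_right _ _ (sub_resHom_mem hk a)⟩ := by
        ext; simp [Algebra.smul_def]; ring
      have h0 : l ⟨(a - algebraMap k R (resHom hk a)) * (b - algebraMap k R (resHom hk b)),
              Ideal.mul_mem_right _ _ (sub_resHom_mem hk a)⟩ = 0 := by
        apply hl
        rw [pow_two]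
        exact Ideal.mul_mem_mul (sub_resHom_mem hk a) (sub_resHom_mem hk b)
      simp only [LinearMap.coe_mk, AddHom.coe_mk]
      rw [h, map_add, map_add, h0, map_smul, map_smul]
      ext <;> simp <;> ring)

lemma dualOfFunctional_snd (hk : Function.Bijective (algebraMap k (ResidueField R)))
    (l : maximalIdeal R →ₗ[k] k) (hl : ∀ x : maximalIdeal R, (x : R) ∈ maximalIdeal R ^ 2 → l x = 0)
    (x : maximalIdeal R) : (dualOfFunctional hk l hl x).snd = l x := by
  have h0 : resHom hk (x : R) = 0 := (resHom_eq_zero_iff hk _).2 x.2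
  have : (⟨(x : R) - algebraMap k R (resHom hk x), sub_resHom_mem hk x⟩ : maximalIdeal R) = x := by
    ext; simp [h0]
  simp [dualOfFunctional, this]

variable [IsNoetherianRing R]

/-- existence of Euler-type derivation data -/
lemma exists_euler (hk : Function.Bijective (algebraMap k (ResidueField R)))
    {S : Set (Derivation k R R)} (hS : TangentFamily k R S) :
    ∃ (ι : Type) (_ : Fintype ι) (x : ι → R) (D : ι → Derivation k R R),
      (∀ i, x i ∈ maximalIdeal R) ∧ (∀ i, D i ∈ S) ∧
      ∀ w ∈ maximalIdeal R, ∑ i, x i * D i w - w ∈ maximalIdeal R ^ 2 := by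
  classical
  let b := Module.finBasis (ResidueField R) (CotangentSpace R)
  set n := Module.finrank (ResidueField R) (CotangentSpace R)
  choose x hx using fun i => Ideal.toCotangent_surjective (maximalIdeal R) (b i)
  let e := AlgEquiv.ofBijective (Algebra.ofId k (ResidueField R)) hk
  let l : Fin n → (maximalIdeal R →ₗ[k] k) := fun i =>
    { toFun := fun y => e.symm (b.repr ((maximalIdeal R).toCotangent y) i)
      map_add' := by intro a c; simp
      map_smul' := by
        intro c a
        have h1 : (maximalIdeal R).toCotangent (c • a) =
          algebraMap k (ResidueField R) c • (maximalIdeal R).toCotangent a := by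
          have : c • a = algebraMap k R c • a := by
            ext; simp [Algebra.smul_def]
          rw [this, map_smul, IsScalarTower.algebraMap_apply k R (ResidueField R) c]
          exact (IsScalarTower.algebraMap_smul (ResidueField R) (algebraMap k R c) _).symm
        have h2 : e.symm (algebraMap k (ResidueField R) c) = c := by
          rw [AlgEquiv.commutes]; rfl
        rw [h1]
        simp }
  have hl : ∀ i, ∀ y : maximalIdeal R, (y : R) ∈ maximalIdeal R ^ 2 → l i y = 0 := by
    intro i y hy
    have := ((maximalIdeal R).toCotangent_eq_zero y).2 hy
    simp [l, this]
  choose D hDS hD using fun i => hS (dualOfFunctional hk (l i) (hl i))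
  refine ⟨Fin n, inferInstance, fun i => x i, D, fun i => (x i).2, hDS, ?_⟩
  intro w hw
  have h1 : ∀ i, (x i : R) * D i w - x i * algebraMap k R (l i ⟨w, hw⟩) ∈ maximalIdeal R ^ 2 := by
    intro i
    rw [← mul_sub, pow_two]
    refine Ideal.mul_mem_mul (x i).2 ?_
    have := hD i w
    have h2 := dualOfFunctional_snd hk (l i) (hl i) ⟨w, hw⟩
    simp only at h2
    rw [h2] at this
    exact this
  have h2 : ∑ i, (x i : R) * algebraMap k R (l i ⟨w, hw⟩) - w ∈ maximalIdeal R ^ 2 := by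
    have : (maximalIdeal R).toCotangent (∑ i, algebraMap k R (l i ⟨w, hw⟩) • x i)
       = (maximalIdeal R).toCotangent ⟨w, hw⟩ := by
      rw [map_sum]
      conv_rhs => rw [← b.sum_repr ((maximalIdeal R).toCotangent ⟨w, hw⟩)]
      refine Finset.sum_congr rfl fun i _ => ?_
      rw [map_smul, hx]
      have : b.repr ((maximalIdeal R).toCotangent ⟨w, hw⟩) i =
        algebraMap R (ResidueField R) (algebraMap k R (l i ⟨w, hw⟩)) := by
        rw [← IsScalarTower.algebraMap_apply]
        exact (e.apply_symm_apply _).symm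
      rw [this]
      exact (IsScalarTower.algebraMap_smul (ResidueField R) (algebraMap k R (l i ⟨w, hw⟩)) _).symm
    rw [Ideal.toCotangent_eq] at this
    simpa [mul_comm, Algebra.smul_def] using this
  have h3 := Ideal.add_mem _ (Ideal.sum_mem _ fun i (_ : i ∈ Finset.univ) => h1 i) h2
  rw [Finset.sum_sub_distrib] at h3
  simpa using h3

lemma euler_pow {k R : Type*} [Field k] [CommRing R] [Algebra k R] [IsLocalRing R]
    {ι : Type*} [Fintype ι] (x : ι → R) (D : ι → Derivation k R R)
    (hx : ∀ i, x i ∈ maximalIdeal R)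
    (h : ∀ w ∈ maximalIdeal R, ∑ i, x i * D i w - w ∈ maximalIdeal R ^ 2) (n : ℕ) :
    ∀ w ∈ maximalIdeal R ^ n, ∑ i, x i * D i w - n * w ∈ maximalIdeal R ^ (n + 1) := by
  induction n with
  | zero =>
    intro w _
    simp only [Nat.cast_zero, zero_mul, sub_zero, zero_add, pow_one]
    exact Ideal.sum_mem _ fun i _ => Ideal.mul_mem_right _ _ (hx i)
  | succ n ih =>
    intro w hw
    rw [pow_succ'] at hw
    refine Submodule.mul_induction_on hw ?_ ?_
    · intro a ha b hb
      have e : ∑ i, x i * D i (a * b) - ((n + 1 : ℕ) : R) * (a * b) =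
        a * (∑ i, x i * D i b - n * b) + (∑ i, x i * D i a - a) * b := by
        simp only [Derivation.leibniz, smul_eq_mul, mul_add, Finset.sum_add_distrib, mul_sub,
          sub_mul, Finset.mul_sum, Finset.sum_mul]
        push_cast
        have e1 : ∀ i, x i * (a * D i b) = a * (x i * D i b) := fun i => by ring
        have e2 : ∀ i, x i * (b * D i a) = x i * D i a * b := fun i => by ring
        simp only [e1, e2]
        ring
      rw [e]
      refine Ideal.add_mem _ ?_ ?_
      · rw [pow_succ' _ (n+1)]
        exact Ideal.mul_mem_mul ha (ih b hb)
      · have : maximalIdeal R ^ (n + 1 + 1) = maximalIdeal R ^ 2 * maximalIdeal R ^ n := by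
          rw [← pow_add]; congr 1; ring
        rw [this]
        exact Ideal.mul_mem_mul (h a ha) hb
    · intro a b ha hb
      have e : ∑ i, x i * D i (a + b) - ((n + 1 : ℕ) : R) * (a + b) =
        (∑ i, x i * D i a - ((n + 1 : ℕ) : R) * a) + (∑ i, x i * D i b - ((n + 1 : ℕ) : R) * b) := by
        simp only [map_add, mul_add, Finset.sum_add_distrib]
        ring
      rw [e]
      exact Ideal.add_mem _ ha hb

/-- **Lemma E**: a proper ideal stable under a tangent family is zero. -/
theorem stable_eq_bot [CharZero k] (hk : Function.Bijective (algebraMap k (ResidueField R)))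
    {S : Set (Derivation k R R)} (hS : TangentFamily k R S) (N : Ideal R) (hN : N ≠ ⊤)
    (hst : ∀ D ∈ S, ∀ w ∈ N, D w ∈ N) : N = ⊥ := by
  obtain ⟨ι, _, x, D, hx, hD, h⟩ := exists_euler hk hS
  have key : ∀ n : ℕ, N ≤ maximalIdeal R ^ (n + 1) := by
    intro n
    induction n with
    | zero => rw [zero_add, pow_one]; exact le_maximalIdeal hN
    | succ n ih =>
      intro w hw
      have h1 := euler_pow x D hx h (n + 1) w (ih hw)
      have h2 : ∑ i, x i * D i w ∈ maximalIdeal R ^ (n + 1 + 1) := by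
        rw [pow_succ']
        exact Ideal.sum_mem _ fun i _ => Ideal.mul_mem_mul (hx i) (ih (hst _ (hD i) _ hw))
      have h3 : ((n + 1 : ℕ) : R) * w ∈ maximalIdeal R ^ (n + 1 + 1) := by
        have := Ideal.sub_mem _ h2 h1
        simpa using this
      have hu : algebraMap k R ((n + 1 : ℕ) : k)⁻¹ * ((n + 1 : ℕ) : R) = 1 := by
        rw [← map_natCast (algebraMap k R), ← map_mul, inv_mul_cancel₀, map_one]
        exact_mod_cast Nat.succ_ne_zero n
      have := Ideal.mul_mem_left _ (algebraMap k R ((n + 1 : ℕ) : k)⁻¹) h3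
      rwa [← mul_assoc, hu, one_mul] at this
  have hK := Ideal.iInf_pow_eq_bot_of_isLocalRing (maximalIdeal R) Ideal.IsPrime.ne_top'
  rw [eq_bot_iff, ← hK]
  refine le_iInf fun n => (key n).trans (Ideal.pow_le_pow_right (Nat.le_succ n))

lemma minimalPrime_stable {k R : Type*} [Field k] [CommRing R] [Algebra k R] [CharZero k] (D : Derivation k R R) (P : Ideal R) (hP : P ∈ minimalPrimes R)
    (x : R) (hx : x ∈ P) : D x ∈ P := by
  have hp : P.IsPrime := hP.1.1
  have key : ∀ (n r : ℕ) (a : R), a ∉ P → a * x ^ n * D x ^ r = 0 → D x ∈ P := by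
    intro n
    induction n with
    | zero =>
      intro r a ha h
      have : D x ^ r ∈ P := by
        refine (hp.mem_or_mem (x := a) (y := D x ^ r) ?_).resolve_left ha
        rw [pow_zero, mul_one] at h
        rw [h]; exact P.zero_mem
      exact hp.mem_of_pow_mem r this
    | succ n ih =>
      intro r a ha h
      refine ih (r + 2) (a * a) (fun h => (hp.mem_or_mem h).elim ha ha) ?_
      have h1 : D (a * x ^ (n + 1) * D x ^ r) = 0 := by rw [h, map_zero]
      simp only [Derivation.leibniz, Derivation.leibniz_pow, smul_eq_mul, nsmul_eq_mul,
        Nat.add_sub_cancel] at h1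
      have h2 : a * x ^ (n + 1) * ((r : R) * (D x ^ (r - 1) * D (D x))) * (a * D x) = 0 := by
        rcases r with _ | r
        · simp
        · have : D x ^ (r + 1) = D x ^ r * D x := pow_succ _ _
          rw [this] at h
          simp only [Nat.add_sub_cancel]
          linear_combination ((((r + 1 : ℕ) : R)) * D (D x) * a) * h
      have h3 : ((n + 1 : ℕ) : R) * (a * a * x ^ n * D x ^ (r + 2)) = 0 := by
        have h4 := congrArg (fun z => z * (a * D x)) h1
        simp only [zero_mul, add_mul] at h4
        rw [h2] at h4
        push_cast at h4 ⊢
        linear_combination h4 - (D a * D x) * h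
      have hu : algebraMap k R ((n + 1 : ℕ) : k)⁻¹ * ((n + 1 : ℕ) : R) = 1 := by
        rw [← map_natCast (algebraMap k R), ← map_mul, inv_mul_cancel₀, map_one]
        exact_mod_cast Nat.succ_ne_zero n
      calc a * a * x ^ n * D x ^ (r + 2)
          = algebraMap k R ((n + 1 : ℕ) : k)⁻¹ * (((n + 1 : ℕ) : R) * (a * a * x ^ n * D x ^ (r + 2))) := by
            rw [← mul_assoc, hu, one_mul]
        _ = 0 := by rw [h3, mul_zero]
  by_contra hDx
  have hdis : Disjoint ((⊥ : Ideal R) : Set R) (P.primeCompl ⊔ Submonoid.powers x : Submonoid R) := by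
    rw [Set.disjoint_left]
    intro z hz hz'
    have hz0 : z = 0 := by simpa using hz
    obtain ⟨a, ha, b, ⟨n, rfl⟩, h⟩ := Submonoid.mem_sup.1 hz'
    exact hDx (key n 0 a ha (by rw [pow_zero, mul_one, ← hz0, ← h]))
  obtain ⟨Q, hQ, -, hd⟩ := Ideal.exists_le_prime_disjoint _ _ hdis
  have hQP : Q ≤ P := by
    intro z hz
    by_contra hzP
    exact Set.disjoint_left.1 hd hz (Submonoid.mem_sup_left hzP)
  have := hP.2 ⟨hQ, bot_le⟩ hQP hx
  exact Set.disjoint_left.1 hd this (Submonoid.mem_sup_right (Submonoid.mem_powers x))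

theorem isDomain_of_tangentFamily [CharZero k]
    (hk : Function.Bijective (algebraMap k (ResidueField R)))
    {S : Set (Derivation k R R)} (hS : TangentFamily k R S) : IsDomain R := by
  obtain ⟨P, hP⟩ := Ideal.nonempty_minimalPrimes (I := (⊥ : Ideal R)) bot_ne_top
  have hp : P.IsPrime := hP.1.1
  have : P = ⊥ := stable_eq_bot hk hS P hp.ne_top fun D _ w hw => minimalPrime_stable D P hP w hw
  rw [this] at hp
  exact IsDomain.of_bot_isPrime R

end LemmaE

end St6

namespace St6
open Polynomial

/-- `π` generates the field `F` over `k` as a field. -/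
def FieldGen (k : Type*) {F : Type*} [Field k] [Field F] [Algebra k F] (π : F) : Prop :=
  ∀ f : F, ∃ p q : k[X], aeval π q ≠ 0 ∧ f = aeval π p / aeval π q

section places
variable {k F : Type*} [Field k] [Field F] [Algebra k F]

lemma fieldGen_sub {x : F} (h : FieldGen k x) (c : k) : FieldGen k (x - algebraMap k F c) := by
  intro f
  obtain ⟨p, q, hq, rfl⟩ := h f
  refine ⟨p.comp (X + C c), q.comp (X + C c), ?_, ?_⟩ <;> simp [aeval_comp, hq]

lemma fieldGen_inv {x : F} (h : FieldGen k x) : FieldGen k x⁻¹ := by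
  by_cases hx : x = 0
  · simpa [hx] using h
  intro f
  obtain ⟨p, q, hq, rfl⟩ := h f
  have key : ∀ r : k[X], aeval x⁻¹ r.reverse = aeval x r * x⁻¹ ^ r.natDegree := by
    intro r
    let _ : Invertible x := invertibleOfNonzero hx
    have := eval₂_reverse_mul_pow (algebraMap k F) x r
    rw [invOf_eq_inv] at this
    rw [aeval_def, aeval_def, ← this, mul_assoc, ← mul_pow, mul_inv_cancel₀ hx, one_pow, mul_one]
  refine ⟨p.reverse * X ^ q.natDegree, q.reverse * X ^ p.natDegree, ?_, ?_⟩
  · simp [key, hq, hx]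
  · simp only [map_mul, key, map_pow, aeval_X]
    field_simp

variable (O : ValuationSubring F) (hk : ∀ c : k, algebraMap k F c ∈ O) {π : F}
  (hπ : π ∈ O.nonunits) (hg : FieldGen k π)

include hk
lemma aeval_mem {x : F} (hx : x ∈ O) (p : k[X]) : aeval x p ∈ O := by
  rw [aeval_eq_sum_range]
  refine sum_mem fun i _ => ?_
  rw [Algebra.smul_def]
  exact mul_mem (hk _) (pow_mem hx i)

include hπ
lemma aeval_sub_mem (p : k[X]) : aeval π p - algebraMap k F (p.coeff 0) ∈ O.nonunits := by
  have hπO : π ∈ O := O.nonunits_subset hπ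
  have : aeval π p - algebraMap k F (p.coeff 0) = π * aeval π p.divX := by
    have h := congrArg (aeval π) (X_mul_divX_add p)
    rw [map_add, map_mul, aeval_X, aeval_C] at h
    rw [← h, add_sub_cancel_right]
  rw [this, ValuationSubring.mem_nonunits_iff, map_mul]
  rw [ValuationSubring.mem_nonunits_iff] at hπ
  exact mul_lt_one_of_lt_of_le hπ ((O.valuation_le_one_iff _).2 (aeval_mem O hk hπO _))

lemma valuation_aeval_eq_one (p : k[X]) (hp : p.coeff 0 ≠ 0) : O.valuation (aeval π p) = 1 := by
  have h1 := aeval_sub_mem O hk hπ p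
  rw [ValuationSubring.mem_nonunits_iff] at h1
  have h2 : O.valuation (algebraMap k F (p.coeff 0)) = 1 := by
    apply le_antisymm ((O.valuation_le_one_iff _).2 (hk _))
    have h3 := (O.valuation_le_one_iff _).2 (hk (p.coeff 0)⁻¹)
    rw [map_inv₀, map_inv₀] at h3
    have h4 : 0 < O.valuation (algebraMap k F (p.coeff 0)) := by
      rw [Valuation.pos_iff]; simpa using hp
    exact (inv_le_one₀ h4).1 h3
  rw [← h2] at h1 ⊢
  exact Valuation.map_eq_of_sub_lt _ h1

include hg
lemma exists_zpow (hπ0 : π ≠ 0) (f : F) (hf : f ≠ 0) :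
    ∃ (n : ℤ) (p q : k[X]), p.coeff 0 ≠ 0 ∧ q.coeff 0 ≠ 0 ∧ f = π ^ n * (aeval π p / aeval π q) := by
  obtain ⟨p, q, hq, rfl⟩ := hg f
  have hq0 : q ≠ 0 := by rintro rfl; simp at hq
  have hp0 : p ≠ 0 := by rintro rfl; simp at hf
  obtain ⟨p', hp', hp1⟩ := exists_eq_pow_rootMultiplicity_mul_and_not_dvd p hp0 0
  obtain ⟨q', hq', hq1⟩ := exists_eq_pow_rootMultiplicity_mul_and_not_dvd q hq0 0
  simp only [map_zero, sub_zero, X_dvd_iff] at hp' hq' hp1 hq1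
  refine ⟨(p.rootMultiplicity 0 : ℤ) - q.rootMultiplicity 0, p', q', hp1, hq1, ?_⟩
  have h1 := valuation_aeval_eq_one O hk hπ q' hq1
  have h2 : aeval π q' ≠ 0 := by
    intro h; rw [h, map_zero] at h1; exact zero_ne_one h1
  conv_lhs => rw [hp', hq']
  rw [zpow_sub₀ hπ0]
  simp only [map_mul, map_pow, aeval_X, zpow_natCast]
  field_simp

lemma mem_iff_exists (hπ0 : π ≠ 0) (f : F) :
    f ∈ O ↔ ∃ p q : k[X], q.coeff 0 ≠ 0 ∧ f = aeval π p / aeval π q := by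
  have hπO : π ∈ O := O.nonunits_subset hπ
  constructor
  · intro hf
    by_cases hf0 : f = 0
    · exact ⟨0, 1, by simp, by simp [hf0]⟩
    obtain ⟨n, p, q, hp, hq, rfl⟩ := exists_zpow O hk hπ hg hπ0 f hf0
    have hn : 0 ≤ n := by
      by_contra hn
      push Not at hn
      rw [← O.valuation_le_one_iff, map_mul, map_div₀, valuation_aeval_eq_one O hk hπ p hp,
        valuation_aeval_eq_one O hk hπ q hq, div_one, mul_one, map_zpow₀] at hf
      rw [ValuationSubring.mem_nonunits_iff] at hπ
      have h0 : 0 < O.valuation π := by rw [Valuation.pos_iff]; exact hπ0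
      have := one_lt_zpow_of_neg₀ h0 hπ hn
      exact absurd hf (not_le.2 this)
    obtain ⟨n, rfl⟩ := Int.eq_ofNat_of_zero_le hn
    refine ⟨X ^ n * p, q, hq, ?_⟩
    simp [mul_div_assoc]
  · rintro ⟨p, q, hq, rfl⟩
    rw [← O.valuation_le_one_iff, map_div₀, valuation_aeval_eq_one O hk hπ q hq, div_one,
      O.valuation_le_one_iff]
    exact aeval_mem O hk hπO p

lemma exists_res (hπ0 : π ≠ 0) (f : F) (hf : f ∈ O) :
    ∃ c : k, f - algebraMap k F c ∈ O.nonunits := by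
  obtain ⟨p, q, hq, rfl⟩ := (mem_iff_exists O hk hπ hg hπ0 f).1 hf
  refine ⟨p.coeff 0 / q.coeff 0, ?_⟩
  have h1 := valuation_aeval_eq_one O hk hπ q hq
  have h2 : aeval π q ≠ 0 := by
    intro h; rw [h, map_zero] at h1; exact zero_ne_one h1
  have : aeval π p / aeval π q - algebraMap k F (p.coeff 0 / q.coeff 0) =
    (aeval π (p - C (p.coeff 0 / q.coeff 0) * q)
      - algebraMap k F ((p - C (p.coeff 0 / q.coeff 0) * q).coeff 0)) / aeval π q := by
    have : (p - C (p.coeff 0 / q.coeff 0) * q).coeff 0 = 0 := by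
      simp [hq]
    rw [this]
    simp only [map_sub, map_mul, aeval_C, map_zero, sub_zero]
    field_simp
  rw [this, ValuationSubring.mem_nonunits_iff, map_div₀, h1, div_one]
  exact aeval_sub_mem O hk hπ _

lemma nonunits_eq (hπ0 : π ≠ 0) (f : F) (hf : f ∈ O.nonunits) : f / π ∈ O := by
  by_cases hf0 : f = 0
  · simp [hf0, O.zero_mem]
  have hπO : π ∈ O := O.nonunits_subset hπ
  obtain ⟨n, p, q, hp, hq, rfl⟩ := exists_zpow O hk hπ hg hπ0 f hf0
  have hv : O.valuation (π ^ n * (aeval π p / aeval π q)) = O.valuation π ^ n := by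
    rw [map_mul, map_div₀, valuation_aeval_eq_one O hk hπ p hp,
        valuation_aeval_eq_one O hk hπ q hq, div_one, mul_one, map_zpow₀]
  rw [ValuationSubring.mem_nonunits_iff, hv] at hf
  have h0 : 0 < O.valuation π := by rw [Valuation.pos_iff]; exact hπ0
  rw [ValuationSubring.mem_nonunits_iff] at hπ
  have hn : 1 ≤ n := by
    by_contra hn
    have : n ≤ 0 := by omega
    exact absurd hf (not_lt.2 (one_le_zpow_of_nonpos₀ h0 hπ.le this))
  rw [← O.valuation_le_one_iff, map_div₀, hv, div_eq_mul_inv, ← zpow_sub_one₀ h0.ne']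
  exact zpow_le_one₀ h0 hπ.le (by omega)

end places

/-- classification of places of a rational function field -/
lemma exists_place {k F : Type*} [Field k] [IsAlgClosed k] [Field F] [Algebra k F] {x : F}
    (hx : FieldGen k x)
    (O : ValuationSubring F) (hk : ∀ c : k, algebraMap k F c ∈ O) (hO : O ≠ ⊤) (hxO : x ∈ O) :
    ∃ c : k, x - algebraMap k F c ∈ O.nonunits := by
  by_contra! hc
  apply hO
  have key : ∀ q : k[X], q ≠ 0 → O.valuation (aeval x q) = 1 := by
    intro q hq
    rw [(IsAlgClosed.splits q).eq_prod_roots]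
    have h2 : O.valuation (algebraMap k F q.leadingCoeff) = 1 := by
      apply le_antisymm ((O.valuation_le_one_iff _).2 (hk _))
      have h3 := (O.valuation_le_one_iff _).2 (hk (q.leadingCoeff)⁻¹)
      rw [map_inv₀, map_inv₀] at h3
      have h4 : 0 < O.valuation (algebraMap k F q.leadingCoeff) := by
        rw [Valuation.pos_iff]; simpa using hq
      exact (inv_le_one₀ h4).1 h3
    rw [map_mul, aeval_C, map_mul, h2, one_mul, map_multiset_prod, map_multiset_prod]
    apply Multiset.prod_eq_one
    intro y hy
    simp only [Multiset.map_map, Multiset.mem_map, Function.comp] at hy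
    obtain ⟨a, -, rfl⟩ := hy
    simp only [map_sub, aeval_X, aeval_C]
    have h5 := hc a
    rw [ValuationSubring.mem_nonunits_iff, not_lt] at h5
    exact le_antisymm ((O.valuation_le_one_iff _).2 (sub_mem hxO (hk a))) h5
  rw [eq_top_iff]
  intro f _
  obtain ⟨p, q, hq, rfl⟩ := hx f
  have hq0 : q ≠ 0 := by rintro rfl; simp at hq
  rw [← O.valuation_le_one_iff, map_div₀, key q hq0, div_one, O.valuation_le_one_iff]
  exact aeval_mem O hk hxO p

end St6

namespace St6
open Polynomial

section lattice
variable {k F : Type*} [Field k] [Field F] [Algebra k F]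
variable (O : ValuationSubring F) (hk : ∀ c : k, algebraMap k F c ∈ O) {π : F}
  (hπ : π ∈ O.nonunits) (hg : FieldGen k π) (hπ0 : π ≠ 0)
variable {ι : Type*} [Fintype ι] [DecidableEq ι]

include hk hπ hg hπ0

lemma valuation_eq_zpow (f : F) (hf : f ≠ 0) : ∃ n : ℤ, O.valuation f = O.valuation π ^ n := by
  obtain ⟨n, p, q, hp, hq, rfl⟩ := exists_zpow O hk hπ hg hπ0 f hf
  refine ⟨n, ?_⟩
  rw [map_mul, map_div₀, valuation_aeval_eq_one O hk hπ p hp,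
        valuation_aeval_eq_one O hk hπ q hq, div_one, mul_one, map_zpow₀]

/-- kernel vector of a matrix over `O` with nonunit determinant, with entries in `k` -/
lemma exists_kernel (P : Matrix ι ι F) (hP : ∀ i j, P i j ∈ O) (hd : P.det ∈ O.nonunits) :
    ∃ α : ι → k, α ≠ 0 ∧ ∀ i, ∑ j, P i j * algebraMap k F (α j) ∈ O.nonunits := by
  let P' : Matrix ι ι O := fun i j => ⟨P i j, hP i j⟩
  have hPP : P = P'.map O.subtype := by ext i j; rfl
  have hdet : O.subtype P'.det = P.det := by rw [hPP, RingHom.map_det]; rfl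
  let r := IsLocalRing.residue O
  have h0 : (P'.map r).det = 0 := by
    have : (P'.map r).det = r P'.det := by rw [RingHom.map_det]; rfl
    rw [this, IsLocalRing.residue_eq_zero_iff, ValuationSubring.valuation_lt_one_iff]
    rw [ValuationSubring.mem_nonunits_iff, ← hdet] at hd
    exact hd
  obtain ⟨v, hv, hv0⟩ := Matrix.exists_mulVec_eq_zero_iff.2 h0
  have hres : ∀ z : IsLocalRing.ResidueField O, ∃ c : k, r ⟨algebraMap k F c, hk c⟩ = z := by
    intro z
    obtain ⟨⟨f, hf⟩, rfl⟩ := IsLocalRing.residue_surjective z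
    obtain ⟨c, hc⟩ := exists_res O hk hπ hg hπ0 f hf
    refine ⟨c, ?_⟩
    symm
    rw [← sub_eq_zero, ← map_sub, IsLocalRing.residue_eq_zero_iff,
      ValuationSubring.valuation_lt_one_iff]
    rw [ValuationSubring.mem_nonunits_iff] at hc
    exact hc
  choose α hα using fun j => hres (v j)
  refine ⟨α, ?_, ?_⟩
  · rintro rfl
    apply hv
    ext j
    rw [← hα j]
    have : (⟨algebraMap k F ((0 : ι → k) j), hk _⟩ : O) = 0 := by ext; simp
    rw [this, map_zero]; rfl
  · intro i
    have h1 : r (∑ j, P' i j * ⟨algebraMap k F (α j), hk (α j)⟩) = 0 := by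
      rw [map_sum]
      simp only [map_mul, hα]
      exact congrFun hv0 i
    rw [IsLocalRing.residue_eq_zero_iff, ValuationSubring.valuation_lt_one_iff] at h1
    rw [ValuationSubring.mem_nonunits_iff]
    convert h1
    simp [P']

/-- Birkhoff-Grothendieck style lattice reduction. -/
theorem lattice_aux (N : ℕ) : ∀ (M : Matrix ι ι F) (m : ι → ℤ) (d : ℤ),
    O.valuation M.det = O.valuation π ^ d →
    (∀ i j, M i j * π ^ (m j) ∈ O) → d + ∑ j, m j ≤ N →
    ∃ (U : Matrix ι ι k[X]) (m' : ι → ℤ), IsUnit U.det ∧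
      (∀ i j, (M * U.map (aeval π⁻¹)) i j * π ^ (m' j) ∈ O) ∧
      O.valuation ((Matrix.of fun i j => (M * U.map (aeval π⁻¹)) i j * π ^ (m' j)).det) = 1 := by
  classical
  have hv0 : 0 < O.valuation π := by rw [Valuation.pos_iff]; exact hπ0
  have hv1 : O.valuation π < 1 := (ValuationSubring.mem_nonunits_iff O).1 hπ
  have hdet : ∀ (M : Matrix ι ι F) (m : ι → ℤ),
      (Matrix.of fun i j => M i j * π ^ (m j)).det = M.det * π ^ (∑ j, m j) := by
    intro M m
    have : (Matrix.of fun i j => M i j * π ^ (m j)) = M * Matrix.diagonal (fun j => π ^ m j) := by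
      ext i j; simp
    rw [this, Matrix.det_mul, Matrix.det_diagonal]
    congr 1
    induction (Finset.univ : Finset ι) using Finset.induction_on with
    | empty => simp
    | insert a s ha ih => rw [Finset.prod_insert ha, Finset.sum_insert ha, zpow_add₀ hπ0, ih]
  induction N with
  | zero =>
    intro M m d hd hm hN
    refine ⟨1, m, by simp, ?_, ?_⟩
    · simpa using hm
    · have h1 : (1 : Matrix ι ι k[X]).map (aeval π⁻¹) = (1 : Matrix ι ι F) :=
        Matrix.map_one _ (map_zero _) (map_one _)
      rw [h1, mul_one]
      have h2 : O.valuation ((Matrix.of fun i j => M i j * π ^ (m j)).det) ≤ 1 := by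
        rw [O.valuation_le_one_iff, Matrix.det_apply]
        refine sum_mem fun σ _ => ?_
        rw [Units.smul_def, zsmul_eq_mul]
        exact mul_mem (intCast_mem _ _) (prod_mem fun i _ => hm _ _)
      refine le_antisymm h2 ?_
      rw [hdet, map_mul, hd, map_zpow₀, ← zpow_add₀ hv0.ne']
      exact one_le_zpow_of_nonpos₀ hv0 hv1.le (by simpa using hN)
  | succ N ih =>
    intro M m d hd hm hN
    by_cases hlt : O.valuation ((Matrix.of fun i j => M i j * π ^ (m j)).det) < 1
    swap
    · refine ih M m d hd hm ?_
      rw [hdet, map_mul, hd, map_zpow₀, ← zpow_add₀ hv0.ne'] at hlt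
      by_contra hcon
      apply hlt
      apply zpow_lt_one₀ hv0 hv1
      have : (0 : ℤ) ≤ N := by positivity
      omega
    obtain ⟨α, hα, hker⟩ := exists_kernel O hk hπ hg hπ0 _ hm ((ValuationSubring.mem_nonunits_iff O).2 hlt)
    have hne : (Finset.univ.filter fun j => α j ≠ 0).Nonempty := by
      by_contra h
      rw [Finset.not_nonempty_iff_eq_empty, Finset.filter_eq_empty_iff] at h
      apply hα; ext j
      simpa using h (Finset.mem_univ j)
    obtain ⟨j0, hj0, hmax⟩ := Finset.exists_max_image _ m hne
    simp only [Finset.mem_filter, Finset.mem_univ, true_and] at hj0 hmax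
    let w : ι → k[X] := fun j => C (α j) * X ^ (m j0 - m j).toNat
    let U : Matrix ι ι k[X] := (1 : Matrix ι ι k[X]).updateCol j0 w
    have hUdet : U.det = C (α j0) := by
      have : U.det = Matrix.cramer (1 : Matrix ι ι k[X]) w j0 := by rw [Matrix.cramer_apply]
      rw [this, Matrix.cramer_one]
      simp [w]
    have hw : ∀ j, aeval π⁻¹ (w j) = algebraMap k F (α j) * π ^ (m j - m j0) := by
      intro j
      by_cases hj : α j = 0
      · simp [w, hj]
      · have := hmax j hj
        have h2 : m j - m j0 = -(((m j0 - m j).toNat : ℕ) : ℤ) := by omega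
        rw [h2, zpow_neg, zpow_natCast]
        simp [w]
    have hU1 : ∀ i j, j ≠ j0 → (M * U.map (aeval π⁻¹)) i j = M i j := by
      intro i j hj
      rw [Matrix.mul_apply]
      have : ∀ l, (U.map (aeval π⁻¹)) l j = (1 : Matrix ι ι F) l j := by
        intro l
        simp only [U, Matrix.map_apply, Matrix.updateCol_ne hj]
        by_cases hlj : l = j <;> simp [Matrix.one_apply, hlj]
      simp only [this]
      simp [Matrix.one_apply]
    have hU2 : ∀ i, (M * U.map (aeval π⁻¹)) i j0 = (∑ j, M i j * π ^ (m j) * algebraMap k F (α j)) * π ^ (-m j0) := by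
      intro i
      rw [Matrix.mul_apply, Finset.sum_mul]
      refine Finset.sum_congr rfl fun j _ => ?_
      simp only [U, Matrix.map_apply, Matrix.updateCol_self, hw]
      rw [sub_eq_add_neg, zpow_add₀ hπ0]
      ring
    let m1 : ι → ℤ := Function.update m j0 (m j0 - 1)
    have hsum : ∑ j, m1 j = ∑ j, m j - 1 := by
      rw [Finset.sum_update_of_mem (Finset.mem_univ j0)]
      rw [← Finset.add_sum_erase _ m (Finset.mem_univ j0), Finset.sdiff_singleton_eq_erase]
      ring
    have hA : O.valuation (M * U.map (aeval π⁻¹)).det = O.valuation π ^ d := by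
      have : (U.map (aeval π⁻¹)).det = algebraMap k F (α j0) := by
        have h := RingHom.map_det (aeval (π⁻¹ : F) : k[X] →ₐ[k] F).toRingHom U
        rw [hUdet] at h
        have h' : (aeval (π⁻¹ : F) : k[X] →ₐ[k] F).toRingHom (C (α j0)) = algebraMap k F (α j0) := by
          simp
        rw [h'] at h
        exact h.symm
      rw [Matrix.det_mul, map_mul, this, hd]
      have : O.valuation (algebraMap k F (α j0)) = 1 := by
        have := valuation_aeval_eq_one O hk hπ (C (α j0)) (by simpa using hj0)
        simpa using this
      rw [this, mul_one]
    have hB : ∀ i j, (M * U.map (aeval π⁻¹)) i j * π ^ (m1 j) ∈ O := by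
      intro i j
      by_cases hj : j = j0
      · subst hj
        rw [hU2]
        simp only [m1, Function.update_self]
        have := nonunits_eq O hk hπ hg hπ0 _ (hker i)
        convert this using 1
        rw [mul_assoc, ← zpow_add₀ hπ0, div_eq_mul_inv, ← zpow_neg_one]
        congr 2
        ring
      · rw [hU1 i j hj]
        simp only [m1, Function.update_of_ne hj]
        exact hm i j
    have hC : d + ∑ j, m1 j ≤ N := by
      rw [hsum]; push_cast at hN; omega
    obtain ⟨U', m', hU', h1, h2⟩ := ih (M * U.map (aeval π⁻¹)) m1 d hA hB hC
    · refine ⟨U * U', m', ?_, ?_, ?_⟩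
      · rw [Matrix.det_mul, hUdet]
        exact (isUnit_C.2 (isUnit_iff_ne_zero.2 hj0)).mul hU'
      · intro i j
        have := h1 i j
        rw [Matrix.mul_assoc] at this
        rw [show (U * U').map (aeval π⁻¹) = U.map (aeval π⁻¹) * U'.map (aeval (π⁻¹ : F)) from
          Matrix.map_mul (f := (aeval (π⁻¹ : F) : k[X] →ₐ[k] F).toRingHom)]
        exact this
      · rw [Matrix.mul_assoc] at h2
        rw [show (U * U').map (aeval π⁻¹) = U.map (aeval π⁻¹) * U'.map (aeval (π⁻¹ : F)) from
          Matrix.map_mul (f := (aeval (π⁻¹ : F) : k[X] →ₐ[k] F).toRingHom)]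
        exact h2

theorem lattice_thm (M : Matrix ι ι F) (hM : M.det ≠ 0) :
    ∃ (U : Matrix ι ι k[X]) (m' : ι → ℤ), IsUnit U.det ∧
      (∀ i j, (M * U.map (aeval π⁻¹)) i j * π ^ (m' j) ∈ O) ∧
      O.valuation ((Matrix.of fun i j => (M * U.map (aeval π⁻¹)) i j * π ^ (m' j)).det) = 1 := by
  have hv0 : 0 < O.valuation π := by rw [Valuation.pos_iff]; exact hπ0
  have hv1 : O.valuation π < 1 := (ValuationSubring.mem_nonunits_iff O).1 hπ
  obtain ⟨d, hd⟩ := valuation_eq_zpow O hk hπ hg hπ0 M.det hM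
  have : ∀ i j, ∃ n : ℤ, ∀ n' ≥ n, M i j * π ^ n' ∈ O := by
    intro i j
    by_cases h0 : M i j = 0
    · exact ⟨0, fun n' _ => by simp [h0, O.zero_mem]⟩
    obtain ⟨e, he⟩ := valuation_eq_zpow O hk hπ hg hπ0 _ h0
    refine ⟨-e, fun n' hn' => ?_⟩
    rw [← O.valuation_le_one_iff, map_mul, he, map_zpow₀, ← zpow_add₀ hv0.ne']
    exact zpow_le_one₀ hv0 hv1.le (by omega)
  choose n hn using this
  let m : ι → ℤ := fun j => ∑ i, |n i j|
  have hm : ∀ i j, M i j * π ^ (m j) ∈ O := by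
    intro i j
    refine hn i j _ ?_
    exact (le_abs_self _).trans
      (Finset.single_le_sum (f := fun i => |n i j|) (fun _ _ => abs_nonneg _) (Finset.mem_univ i))
  exact lattice_aux O hk hπ hg hπ0 (d + ∑ j, m j).toNat M m d hd hm (Int.self_le_toNat _)

end lattice
end St6

namespace St6
open Polynomial

lemma isNilpotent_of_trace {κ W : Type*} [Field κ] [CharZero κ] [CommRing W] [Algebra κ W]
    [Module.Finite κ W] (y : W) (h : ∀ z, Algebra.trace κ W (y * z) = 0) : IsNilpotent y := by
  have hint : IsIntegral κ y := Algebra.IsIntegral.isIntegral y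
  have hm := minpoly.ne_zero hint
  obtain ⟨q, hq, hnd⟩ := exists_eq_pow_rootMultiplicity_mul_and_not_dvd (minpoly κ y) hm 0
  set a := rootMultiplicity 0 (minpoly κ y)
  rw [C_0, sub_zero] at hq hnd
  have hcop : IsCoprime (X ^ (a + 1)) q :=
    ((Polynomial.irreducible_X.coprime_iff_not_dvd).2 hnd).pow_left
  obtain ⟨u, v, huv⟩ := hcop
  have hyq : y ^ a * aeval y q = 0 := by
    have := minpoly.aeval κ y
    rw [hq] at this
    simpa using this
  have huv' : aeval y u * y ^ (a + 1) + aeval y v * aeval y q = 1 := by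
    simpa using congrArg (aeval y) huv
  set e := aeval y u * y ^ (a + 1) with he
  have hidem : IsIdempotentElem e := by
    have : e * (1 - e) = 0 := by
      have h1 : 1 - e = aeval y v * aeval y q := by rw [← huv']; ring
      rw [h1, he]
      linear_combination (aeval y u * y * aeval y v) * hyq
    unfold IsIdempotentElem
    linear_combination -this
  have htr : Algebra.trace κ W e = 0 := by
    have : e = y * (aeval y u * y ^ a) := by rw [he]; ring
    rw [this]; exact h _
  have hidem' : IsIdempotentElem (Algebra.lmul κ W e) := by
    unfold IsIdempotentElem
    rw [← map_mul, hidem.eq]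
  have h0 : Algebra.lmul κ W e = 0 := by
    have := LinearMap.IsIdempotentElem.trace_eq_zero_iff hidem'
    exact this.1 htr
  have he0 : e = 0 := by
    have := congrArg (fun f : W →ₗ[κ] W => f 1) h0
    simpa using this
  refine ⟨a, ?_⟩
  calc y ^ a = y ^ a * (e + aeval y v * aeval y q) := by rw [huv', mul_one]
    _ = 0 := by rw [he0]; linear_combination (aeval y v) * hyq

lemma trace_mem_imp {O B : Type*} [CommRing O] [IsLocalRing O] [CommRing B] [Algebra O B]
    [Module.Finite O B] [Module.Free O B] [CharZero (O ⧸ IsLocalRing.maximalIdeal O)] (y : B)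
    (h : ∀ z, Algebra.trace O B (y * z) ∈ IsLocalRing.maximalIdeal O) :
    ∃ n : ℕ, y ^ n ∈ (IsLocalRing.maximalIdeal O).map (algebraMap O B) := by
  let _ : Field (O ⧸ IsLocalRing.maximalIdeal O) := Ideal.Quotient.field _
  have : Module.Finite (O ⧸ IsLocalRing.maximalIdeal O)
      (B ⧸ (IsLocalRing.maximalIdeal O).map (algebraMap O B)) :=
    Module.Finite.of_restrictScalars_finite O _ _
  have := isNilpotent_of_trace (κ := O ⧸ IsLocalRing.maximalIdeal O)
    (W := B ⧸ (IsLocalRing.maximalIdeal O).map (algebraMap O B))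
    (Ideal.Quotient.mk _ y) (by
      intro z
      obtain ⟨z, rfl⟩ := Ideal.Quotient.mk_surjective z
      rw [← map_mul, Algebra.trace_quotient_mk]
      exact Ideal.Quotient.eq_zero_iff_mem.2 (h z))
  obtain ⟨n, hn⟩ := this
  exact ⟨n, by rwa [← map_pow, Ideal.Quotient.eq_zero_iff_mem] at hn⟩

section dvr
variable {k F : Type*} [Field k] [Field F] [Algebra k F]
  (O : ValuationSubring F) (hk : ∀ c : k, algebraMap k F c ∈ O) {π : F}
  (hπ : π ∈ O.nonunits) (hg : FieldGen k π) (hπ0 : π ≠ 0)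

include hk hπ hg hπ0
lemma dvr_of_fieldGen : IsDiscreteValuationRing O := by
  have hmem := O.nonunits_subset hπ
  have hirr : Irreducible (⟨π, hmem⟩ : O) := by
    have hnu : ¬ IsUnit (⟨π, hmem⟩ : O) := by
      have := (O.mem_nonunits_iff_exists_mem_maximalIdeal).1 hπ
      obtain ⟨h1, h2⟩ := this
      exact h2
    refine ⟨hnu, ?_⟩
    intro a b hab
    by_contra! hcon
    have ha : (a : F) ∈ O.nonunits :=
      O.mem_nonunits_iff_exists_mem_maximalIdeal.2 ⟨a.2, hcon.1⟩
    have hb : (b : F) ∈ O.nonunits :=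
      O.mem_nonunits_iff_exists_mem_maximalIdeal.2 ⟨b.2, hcon.2⟩
    have h1 := nonunits_eq O hk hπ hg hπ0 _ ha
    have hab' : π = a * b := congrArg Subtype.val hab
    have h2 : (b : F) * (a / π) = 1 := by
      have hb0 : (a : F) * b ≠ 0 := hab' ▸ hπ0
      rw [hab']
      have := left_ne_zero_of_mul hb0
      have := right_ne_zero_of_mul hb0
      field_simp
    apply hcon.2
    exact IsUnit.of_mul_eq_one ⟨_, h1⟩ (Subtype.ext h2)
  have : IsDiscreteValuationRing.HasUnitMulPowIrreducibleFactorization O := by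
    refine ⟨_, hirr, ?_⟩
    intro x hx
    have hx0 : (x : F) ≠ 0 := by simpa using hx
    obtain ⟨n, p, q, hp, hq, hx'⟩ := exists_zpow O hk hπ hg hπ0 x hx0
    have hvp := valuation_aeval_eq_one O hk hπ p hp
    have hvq := valuation_aeval_eq_one O hk hπ q hq
    have hv : O.valuation (aeval π p / aeval π q) = 1 := by rw [map_div₀, hvp, hvq, div_one]
    have hn : 0 ≤ n := by
      by_contra! hn
      have h1 := (O.valuation_le_one_iff _).2 x.2
      rw [hx', map_mul, hv, mul_one, map_zpow₀] at h1
      rw [ValuationSubring.mem_nonunits_iff] at hπ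
      have h2 : 1 < O.valuation π ^ n := by
        have h0 : 0 < O.valuation π := by
          rw [zero_lt_iff]; simpa using hπ0
        exact one_lt_zpow_of_neg₀ h0 hπ hn
      exact absurd h1 (not_le.2 h2)
    obtain ⟨n, rfl⟩ := Int.eq_ofNat_of_zero_le hn
    refine ⟨n, ?_⟩
    have hu : IsUnit (⟨_, (O.valuation_le_one_iff _).1 hv.le⟩ : O) := by
      rw [O.valuation_eq_one_iff]
      exact hv
    refine ⟨hu.unit, Subtype.ext ?_⟩
    rw [hx']
    simp
  exact IsDiscreteValuationRing.ofHasUnitMulPowIrreducibleFactorization this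

end dvr

lemma comap_nonunits {F K : Type*} [Field F] [Field K] (V : ValuationSubring K) (f : F →+* K)
    (x : F) : x ∈ (V.comap f).nonunits ↔ f x ∈ V.nonunits := by
  rw [ValuationSubring.mem_nonunits_iff_or, ValuationSubring.mem_nonunits_iff_or,
    ValuationSubring.mem_comap, map_inv₀, map_eq_zero]

lemma mul_nonunits {K : Type*} [Field K] (V : ValuationSubring K) {x y : K} (hx : x ∈ V)
    (hy : y ∈ V.nonunits) : x * y ∈ V.nonunits := by
  rw [ValuationSubring.mem_nonunits_iff] at *
  rw [map_mul, mul_comm]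
  exact mul_lt_one_of_lt_of_le hy ((V.valuation_le_one_iff _).2 hx)

lemma sub_nonunits {K : Type*} [Field K] (V : ValuationSubring K) {x y : K} (hx : x ∈ V.nonunits)
    (hy : y ∈ V.nonunits) : x - y ∈ V.nonunits := by
  rw [ValuationSubring.mem_nonunits_iff] at *
  exact lt_of_le_of_lt (Valuation.map_sub _ _ _) (max_lt hx hy)

lemma val_eq_one {K : Type*} [Field K] (V : ValuationSubring K) {x : K} (hx : x ∈ V)
    (hy : x ∉ V.nonunits) : V.valuation x = 1 :=
  le_antisymm ((V.valuation_le_one_iff _).2 hx) (not_lt.1 hy)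

lemma ded_div {B K : Type*} [Field K] [CommRing B] [IsDedekindDomain B] [Algebra B K]
    [IsFractionRing B K] (V : ValuationSubring K) (hB : ∀ b : B, algebraMap B K b ∈ V)
    (hB' : ∃ b : B, b ≠ 0 ∧ algebraMap B K b ∈ V.nonunits) (x : K) (hx : x ∈ V) :
    ∃ b s : B, algebraMap B K s ∉ V.nonunits ∧ x * algebraMap B K s = algebraMap B K b := by
  let φ : B →+* V := (algebraMap B K).codRestrict V.toSubring hB
  let P : Ideal B := (IsLocalRing.maximalIdeal V).comap φ
  have hP : ∀ b : B, b ∈ P ↔ algebraMap B K b ∈ V.nonunits := fun b => by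
    rw [Ideal.mem_comap, ← ValuationSubring.coe_mem_nonunits_iff]; rfl
  have hPb : P ≠ ⊥ := by
    intro h
    obtain ⟨b, hb, hb'⟩ := hB'
    rw [← hP, h, Ideal.mem_bot] at hb'
    exact hb hb'
  have hPp : P.IsPrime := Ideal.comap_isPrime _ _
  have := IsLocalization.AtPrime.isDiscreteValuationRing_of_dedekind_domain B hPb
    (Localization.AtPrime P)
  obtain ⟨a, d, hd, rfl⟩ := IsFractionRing.div_surjective (A := B) x
  have hd0 : algebraMap B K d ≠ 0 := by simpa using nonZeroDivisors.ne_zero hd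
  have key : ∀ a d : B, (algebraMap _ (Localization.AtPrime P) a) ∣ algebraMap _ _ d →
      ∃ c s : B, s ∉ P ∧ d * s = a * c := by
    rintro a d ⟨z, hz⟩
    obtain ⟨c, s, rfl⟩ := IsLocalization.exists_mk'_eq P.primeCompl z
    refine ⟨c, s, s.2, ?_⟩
    have hinj : Function.Injective (algebraMap B (Localization.AtPrime P)) :=
      IsLocalization.injective _ P.primeCompl_le_nonZeroDivisors
    apply hinj
    rw [map_mul, hz, mul_assoc, IsLocalization.mk'_spec, map_mul]
  rcases ValuationRing.dvd_total (algebraMap _ (Localization.AtPrime P) a)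
    (algebraMap _ (Localization.AtPrime P) d) with h | h
  · obtain ⟨c, s, hs, he⟩ := key _ _ h
    have he' : algebraMap B K d * algebraMap B K s = algebraMap B K a * algebraMap B K c := by
      rw [← map_mul, he, map_mul]
    have hxc : algebraMap B K a / algebraMap B K d * algebraMap B K c = algebraMap B K s := by
      field_simp; rw [← he']
    refine ⟨s, c, ?_, hxc⟩
    intro hc
    rw [hP] at hs
    apply hs
    rw [← hxc]
    exact mul_nonunits V hx hc
  · obtain ⟨c, s, hs, he⟩ := key _ _ h
    have he' : algebraMap B K a * algebraMap B K s = algebraMap B K d * algebraMap B K c := by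
      rw [← map_mul, he, map_mul]
    refine ⟨c, s, fun h => hs ((hP _).2 h), ?_⟩
    field_simp; rw [he']

section loc
variable {k F K : Type*} [Field k] [Field F] [Field K] [Algebra k F] [Algebra k K] [Algebra F K]
  [IsScalarTower k F K] [FiniteDimensional F K] [CharZero k]
  (V : ValuationSubring K)

/-- the trace of `V` on the subfield `F`. -/
abbrev ctr (F : Type*) [Field F] [Algebra F K] (V : ValuationSubring K) : ValuationSubring F :=
  V.comap (algebraMap F K)

/-- the integral closure of the trace of `V`. -/
abbrev icl (F : Type*) [Field F] [Algebra F K] (V : ValuationSubring K) :=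
  integralClosure (ctr F V) K

lemma icl_mem (b : icl F V) : (b : K) ∈ V := by
  have hb : IsIntegral (ctr F V) (b : K) := b.2
  have : IsIntegral V (b : K) := by
    refine hb.map_of_comp_eq (φ := ((algebraMap F K).comp (ctr F V).subtype).codRestrict
      V.toSubring (fun x => x.2)) (ψ := RingHom.id K) ?_
    ext x; rfl
  have hi : V.valuation.Integers V := ⟨Subtype.val_injective, fun x => V.valuation_le_one x,
    fun x hx => ⟨⟨x, (V.valuation_le_one_iff _).1 hx⟩, rfl⟩⟩
  have := Valuation.Integers.mem_of_integral hi this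
  exact (V.valuation_le_one_iff _).1 this

/-- inclusion. -/
def iclIncl : icl F V →+* V := ((icl F V).val : icl F V →+* K).codRestrict V.toSubring (icl_mem V)

variable {V} (hkV : ∀ c : k, algebraMap k K c ∈ V) {π : F}
  (hπ : algebraMap F K π ∈ V.nonunits) (hg : FieldGen k π) (hπ0 : π ≠ 0)

include hkV in
lemma ctr_k (c : k) : algebraMap k F c ∈ ctr F V := by
  rw [ValuationSubring.mem_comap, ← IsScalarTower.algebraMap_apply]; exact hkV c

include hπ in
lemma ctr_pi : π ∈ (ctr F V).nonunits := (comap_nonunits V _ π).2 hπ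

include hkV hπ hg hπ0
lemma ctr_dvr : IsDiscreteValuationRing (ctr F V) :=
  dvr_of_fieldGen (ctr F V) (ctr_k hkV) (ctr_pi hπ) hg hπ0

lemma icl_ded : IsDedekindDomain (icl F V) ∧ Module.Finite (ctr F V) (icl F V) ∧
    Module.Free (ctr F V) (icl F V) ∧ IsFractionRing (icl F V) K := by
  have := ctr_dvr hkV hπ hg hπ0
  have : CharZero F := charZero_of_injective_algebraMap (algebraMap k F).injective
  have : Module.IsTorsionFree (ctr F V) K := Module.IsTorsionFree.trans_faithfulSMul (ctr F V) F K
  exact ⟨integralClosure.isDedekindDomain _ F K, IsIntegralClosure.finite _ F K _,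
    IsIntegralClosure.module_free _ F K _, integralClosure.isFractionRing_of_finite_extension F K⟩

lemma exists_div (x : K) (hx : x ∈ V) : ∃ b s : icl F V, (s : K) ∉ V.nonunits ∧ x * s = b := by
  obtain ⟨h1, h2, h3, h4⟩ := icl_ded hkV hπ hg hπ0
  refine ded_div (B := icl F V) V (icl_mem V) ⟨algebraMap (ctr F V) (icl F V)
    ⟨π, (ctr F V).nonunits_subset (ctr_pi hπ)⟩, ?_, hπ⟩ x hx
  intro hm
  have := congrArg (fun b : icl F V => (b : K)) hm
  exact hπ0 ((map_eq_zero (algebraMap F K)).1 this)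

lemma V_dvr : IsDiscreteValuationRing V := by
  obtain ⟨h1, h2, h3, h4⟩ := icl_ded hkV hπ hg hπ0
  have hn : IsNoetherianRing V := by
    rw [isNoetherianRing_iff_ideal_fg]
    intro I
    have : I = (I.comap (iclIncl (F := F) V)).map (iclIncl (F := F) V) := by
      refine le_antisymm ?_ Ideal.map_comap_le
      intro x hx
      obtain ⟨b, s, hs, he⟩ := exists_div hkV hπ hg hπ0 x.1 x.2
      have hu : IsUnit (iclIncl V s) := by
        by_contra hu
        exact hs (ValuationSubring.coe_mem_nonunits_iff.2 hu)
      have he' : x * iclIncl V s = iclIncl V b := Subtype.ext he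
      rw [← Ideal.mul_unit_mem_iff_mem _ hu, he']
      apply Ideal.mem_map_of_mem
      rw [Ideal.mem_comap, ← he']
      exact I.mul_mem_right _ hx
    rw [this]
    have h5 : IsNoetherianRing (icl F V) := inferInstance
    exact Ideal.FG.map ((isNoetherianRing_iff_ideal_fg _).1 h5 _) _
  have hnf : ¬ IsField V := by
    rw [IsLocalRing.isField_iff_maximalIdeal_eq]
    intro h
    obtain ⟨h1, h2⟩ := V.mem_nonunits_iff_exists_mem_maximalIdeal.1 hπ
    rw [h, Ideal.mem_bot] at h2
    exact hπ0 ((map_eq_zero (algebraMap F K)).1 (congrArg Subtype.val h2))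
  have hv : ValuationRing V := inferInstance
  exact ((IsDiscreteValuationRing.TFAE V hnf).out 0 1).2 hv

lemma exists_res_K [IsAlgClosed k] (x : K) (hx : x ∈ V) :
    ∃ c : k, x - algebraMap k K c ∈ V.nonunits := by
  classical
  have step : ∀ b : icl F V, ∃ c : k, (b : K) - algebraMap k K c ∈ V.nonunits := by
    intro b
    obtain ⟨p, hp, hpb⟩ : IsIntegral (ctr F V) (b : K) := b.2
    have hres : ∀ a : ctr F V, ∃ c : k, algebraMap F K a - algebraMap k K c ∈ V.nonunits := by
      intro a
      obtain ⟨c, hc⟩ := exists_res (ctr F V) (ctr_k hkV) (ctr_pi hπ) hg hπ0 a.1 a.2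
      refine ⟨c, ?_⟩
      rw [comap_nonunits, map_sub, ← IsScalarTower.algebraMap_apply] at hc
      exact hc
    -- choose the residues; compare in the residue field
    let ρ : V →+* IsLocalRing.ResidueField V := IsLocalRing.residue V
    let j : k →+* IsLocalRing.ResidueField V :=
      ρ.comp ((algebraMap k K).codRestrict V.toSubring hkV)
    let i : ctr F V →+* IsLocalRing.ResidueField V :=
      ρ.comp (((algebraMap F K).comp (ctr F V).subtype).codRestrict V.toSubring (fun x => x.2))
    have hj : ∀ (y : V) (c : k), (y : K) - algebraMap k K c ∈ V.nonunits ↔ ρ y = j c := by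
      intro y c
      rw [← sub_eq_zero]
      change _ ↔ ρ y - ρ ⟨algebraMap k K c, hkV c⟩ = 0
      rw [← map_sub, IsLocalRing.residue_eq_zero_iff, ← ValuationSubring.coe_mem_nonunits_iff]
      rfl
    have hij : ∀ a, i a ∈ j.range := by
      intro a
      obtain ⟨c, hc⟩ := hres a
      exact ⟨c, ((hj ⟨_, a.2⟩ c).1 hc).symm⟩
    have hroot : (p.map i).eval (ρ (iclIncl V b)) = 0 := by
      have h1 : p.eval₂ (((algebraMap F K).comp (ctr F V).subtype).codRestrict V.toSubring
          (fun x => x.2)) (iclIncl V b) = 0 := by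
        apply Subtype.val_injective
        exact (hom_eval₂ p _ V.subtype (iclIncl V b)).trans hpb
      rw [Polynomial.eval_map, ← hom_eval₂, h1, map_zero]
    have hlift : p.map i ∈ Polynomial.lifts j := by
      rw [lifts_iff_coeff_lifts]
      intro n
      rw [coeff_map]
      exact hij _
    obtain ⟨q, hq, -, hqm⟩ := lifts_and_natDegree_eq_and_monic hlift (hp.map i)
    have hsp := IsAlgClosed.splits q
    rw [hsp.eq_prod_roots_of_monic hqm] at hq
    rw [← hq, Polynomial.map_multiset_prod, eval_multiset_prod, Multiset.prod_eq_zero_iff] at hroot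
    simp only [Multiset.map_map, Multiset.mem_map, Function.comp] at hroot
    obtain ⟨c, -, hc⟩ := hroot
    refine ⟨c, (hj (iclIncl V b) c).2 ?_⟩
    simpa [sub_eq_zero] using hc
  obtain ⟨b, s, hs, he⟩ := exists_div hkV hπ hg hπ0 x hx
  obtain ⟨c, hc⟩ := step b
  obtain ⟨d, hd⟩ := step s
  have hd0 : d ≠ 0 := by
    rintro rfl
    rw [map_zero, sub_zero] at hd
    exact hs hd
  have hs1 : V.valuation (s : K) = 1 := by
    apply le_antisymm ((V.valuation_le_one_iff _).2 (icl_mem V s))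
    exact not_lt.1 hs
  refine ⟨c / d, ?_⟩
  have h1 : algebraMap k K d ≠ 0 := by simpa using hd0
  have h2 : (x - algebraMap k K (c / d)) * s =
      (b - algebraMap k K c) - algebraMap k K (c / d) * (s - algebraMap k K d) := by
    rw [sub_mul, he, map_div₀]; field_simp; ring
  have h3 : (x - algebraMap k K (c / d)) * s ∈ V.nonunits := by
    rw [h2]
    exact sub_nonunits V hc (mul_nonunits V (hkV _) hd)
  rwa [ValuationSubring.mem_nonunits_iff, map_mul, hs1, mul_one] at h3

lemma trace_key (h : K) (hT : ∀ b : icl F V, Algebra.trace F K (h * b) ∈ ctr F V) :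
    algebraMap F K π * h ∈ V.nonunits := by
  obtain ⟨h1, h2, h3, h4⟩ := icl_ded hkV hπ hg hπ0
  have := ctr_dvr hkV hπ hg hπ0
  have hchF : CharZero F := charZero_of_injective_algebraMap (algebraMap k F).injective
  by_contra hcon
  have hinv : (algebraMap F K π * h)⁻¹ ∈ V := by
    rw [ValuationSubring.mem_nonunits_iff_or] at hcon
    push Not at hcon
    exact hcon.2
  have hne : algebraMap F K π * h ≠ 0 := by
    intro h0
    apply hcon
    rw [h0, ValuationSubring.mem_nonunits_iff, map_zero]
    exact zero_lt_one
  obtain ⟨b, s, hs, he⟩ := exists_div hkV hπ hg hπ0 _ hinv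
  have he' : (s : K) = algebraMap F K π * (h * b) := by
    rw [← he, ← mul_assoc, ← mul_assoc, mul_inv_cancel₀ hne, one_mul]
  let j : k →+* (ctr F V ⧸ IsLocalRing.maximalIdeal (ctr F V)) :=
    (Ideal.Quotient.mk _).comp ((algebraMap k F).codRestrict (ctr F V).toSubring (ctr_k hkV))
  have hch : CharZero (ctr F V ⧸ IsLocalRing.maximalIdeal (ctr F V)) :=
    charZero_of_injective_ringHom j.injective
  have hm : ∀ z : icl F V, Algebra.trace (ctr F V) (icl F V) (s * z) ∈
      IsLocalRing.maximalIdeal (ctr F V) := by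
    intro z
    rw [← ValuationSubring.coe_mem_nonunits_iff]
    have h5 : ((Algebra.trace (ctr F V) (icl F V) (s * z) : ctr F V) : F) =
        Algebra.trace F K ((s * z : icl F V) : K) := by
      rw [← Algebra.intTrace_eq_trace]
      exact Algebra.algebraMap_intTrace (A := ctr F V) (K := F) (L := K) (B := icl F V) (s * z)
    rw [h5]
    have h6 : ((s * z : icl F V) : K) = π • (h * ((b * z : icl F V) : K)) := by
      rw [Algebra.smul_def]
      push_cast
      rw [he']; ring
    rw [h6, map_smul, smul_eq_mul, mul_comm]
    exact mul_nonunits _ (hT _) (ctr_pi hπ)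
  obtain ⟨n, hn⟩ := trace_mem_imp s hm
  have hle : (IsLocalRing.maximalIdeal (ctr F V)).map (algebraMap (ctr F V) (icl F V)) ≤
      (IsLocalRing.maximalIdeal V).comap (iclIncl V) := by
    rw [Ideal.map_le_iff_le_comap]
    intro a ha
    rw [Ideal.mem_comap, Ideal.mem_comap, ← ValuationSubring.coe_mem_nonunits_iff]
    rw [← ValuationSubring.coe_mem_nonunits_iff, comap_nonunits] at ha
    exact ha
  have h7 := hle hn
  rw [Ideal.mem_comap, map_pow] at h7
  have h8 := Ideal.IsPrime.mem_of_pow_mem inferInstance _ h7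
  rw [← ValuationSubring.coe_mem_nonunits_iff] at h8
  exact hs h8

end loc
lemma exists_pow_mul {K : Type*} [Field K] {V : ValuationSubring K} [IsDiscreteValuationRing V]
    {u : V} (hu : Irreducible u) (z : K) : ∃ n : ℕ, (u : K) ^ n * z ∈ V := by
  rcases V.mem_or_inv_mem z with h | h
  · exact ⟨0, by simpa using h⟩
  by_cases hz : z = 0
  · exact ⟨0, by simp [hz]⟩
  have h0 : (⟨z⁻¹, h⟩ : V) ≠ 0 := by
    intro h0
    exact inv_ne_zero hz (congrArg Subtype.val h0)
  obtain ⟨n, hn⟩ := IsDiscreteValuationRing.associated_pow_irreducible h0 hu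
  obtain ⟨w, hw⟩ := hn
  refine ⟨n, ?_⟩
  have hw' : z⁻¹ * (w : V) = (u : K) ^ n := by
    have := congrArg Subtype.val hw
    simpa using this
  rw [← hw', mul_assoc, mul_comm, mul_assoc, mul_inv_cancel₀ hz, mul_one]
  exact (w : V).2

section loc2
variable {k F K : Type*} [Field k] [Field F] [Field K] [Algebra k F] [Algebra k K] [Algebra F K]
  [IsScalarTower k F K] [FiniteDimensional F K] [CharZero k]
  {V : ValuationSubring K} (hkV : ∀ c : k, algebraMap k K c ∈ V) {π : F}
  (hπ : algebraMap F K π ∈ V.nonunits) (hg : FieldGen k π) (hπ0 : π ≠ 0)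

include hkV hπ hg hπ0
lemma deriv_O (d : Derivation k K K) (hd : d (algebraMap F K π) = 1) (a : ctr F V) :
    d (algebraMap F K a) ∈ V := by
  obtain ⟨p, q, hq, he⟩ := (mem_iff_exists (ctr F V) (ctr_k hkV) (ctr_pi hπ) hg hπ0 a.1).1 a.2
  set x := algebraMap F K π
  have hpol : ∀ r : k[X], d (aeval x r) = aeval x (derivative r) := by
    intro r
    rw [Derivation.map_aeval, hd, smul_eq_mul, mul_one]
  have hxV : x ∈ V := V.nonunits_subset hπ
  have hqv : V.valuation (aeval x q) = 1 := valuation_aeval_eq_one V hkV hπ q hq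
  have hq0 : aeval x q ≠ 0 := by
    intro h0; rw [h0, map_zero] at hqv; exact zero_ne_one hqv
  have hqi : (aeval x q)⁻¹ ∈ V := by
    rw [← V.valuation_le_one_iff, map_inv₀, hqv, inv_one]
  have he' : algebraMap F K a = aeval x p * (aeval x q)⁻¹ := by
    rw [he, map_div₀, ← aeval_algebraMap_apply, ← aeval_algebraMap_apply, div_eq_mul_inv]
  rw [he', Derivation.leibniz, Derivation.leibniz_inv, hpol, hpol, smul_eq_mul, smul_eq_mul,
    smul_eq_mul]
  have m := fun r => aeval_mem V hkV hxV r
  exact add_mem (mul_mem (m _) (mul_mem (neg_mem (pow_mem hqi 2)) (m _))) (mul_mem hqi (m _))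

lemma deriv_bdd [IsDiscreteValuationRing V] {u : V} (hu : Irreducible u)
    (d : Derivation k K K) (hd : d (algebraMap F K π) = 1) :
    ∃ n : ℕ, ∀ x ∈ V, (u : K) ^ n * d x ∈ V := by
  obtain ⟨h1, h2, h3, h4⟩ := icl_ded hkV hπ hg hπ0
  obtain ⟨S, hS⟩ := h2.fg_top
  choose N hN using fun b : icl F V => exists_pow_mul hu (d b)
  let n := S.sup N
  have hV := fun b : icl F V => icl_mem V b
  have hB : ∀ b : icl F V, (u : K) ^ n * d b ∈ V := by
    intro b
    have hb : b ∈ Submodule.span (ctr F V) (S : Set (icl F V)) := by rw [hS]; trivial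
    induction hb using Submodule.span_induction with
    | mem x hx =>
      have : n = (n - N x) + N x := (Nat.sub_add_cancel (Finset.le_sup (f := N) hx)).symm
      rw [this, pow_add, mul_assoc]
      exact mul_mem (pow_mem u.2 _) (hN x)
    | zero => simp
    | add x y _ _ hx hy =>
      push_cast
      rw [Derivation.map_add, mul_add]
      exact add_mem hx hy
    | smul a x _ hx =>
      have h5 : ((a • x : icl F V) : K) = algebraMap F K a * x := by
        rw [Subalgebra.coe_smul, Algebra.smul_def]; rfl
      rw [h5, Derivation.leibniz, smul_eq_mul, smul_eq_mul, mul_add]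
      refine add_mem ?_ ?_
      · rw [mul_left_comm]
        exact mul_mem a.2 hx
      · exact mul_mem (pow_mem u.2 _) (mul_mem (hV x) (deriv_O hkV hπ hg hπ0 d hd a))
  refine ⟨n, fun x hx => ?_⟩
  obtain ⟨b, s, hs, he⟩ := exists_div hkV hπ hg hπ0 x hx
  have hs1 := val_eq_one V (hV s) hs
  have hs0 : (s : K) ≠ 0 := by
    intro h0; rw [h0, map_zero] at hs1; exact zero_ne_one hs1
  have hsi : (s : K)⁻¹ ∈ V := by
    rw [← V.valuation_le_one_iff, map_inv₀, hs1, inv_one]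
  have h6 : d b = x * d s + s * d x := by
    rw [← he, Derivation.leibniz]; rfl
  have h7 : (u : K) ^ n * d x = (s : K)⁻¹ * ((u : K) ^ n * d b - x * ((u : K) ^ n * d s)) := by
    rw [h6]; field_simp; ring
  rw [h7]
  exact mul_mem hsi (sub_mem (hB b) (mul_mem hx (hB s)))

lemma deriv_unif [IsAlgClosed k] [IsDiscreteValuationRing V] {u : V} (hu : Irreducible u)
    (d : Derivation k K K) (hd : d (algebraMap F K π) = 1) :
    d u ≠ 0 ∧ ∀ x ∈ V, d x / d u ∈ V := by
  obtain ⟨n, hn⟩ := deriv_bdd hkV hπ hg hπ0 hu d hd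
  have hu0 : (u : K) ≠ 0 := by
    intro h; exact hu.ne_zero (Subtype.ext h)
  have hunif : ∀ x ∈ V.nonunits, x / u ∈ V := by
    intro x hx
    obtain ⟨hx1, hx2⟩ := V.mem_nonunits_iff_exists_mem_maximalIdeal.1 hx
    rw [hu.maximalIdeal_eq, Ideal.mem_span_singleton] at hx2
    obtain ⟨y, hy⟩ := hx2
    have : x = u * y := congrArg Subtype.val hy
    rw [this, mul_div_cancel_left₀ _ hu0]
    exact y.2
  have exp : ∀ m : ℕ, ∀ x ∈ V, ∃ y ∈ V, ∃ z ∈ V, d x = y * d u + (u : K) ^ m * d z := by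
    intro m
    induction m with
    | zero => intro x hx; exact ⟨0, zero_mem _, x, hx, by simp⟩
    | succ m ih =>
      intro x hx
      obtain ⟨y, hy, z, hz, he⟩ := ih x hx
      obtain ⟨c, hc⟩ := exists_res_K hkV hπ hg hπ0 z hz
      have hw := hunif _ hc
      set w := (z - algebraMap k K c) / u
      have hz' : z = u * w + algebraMap k K c := by
        rw [mul_div_cancel₀ _ hu0]; ring
      refine ⟨y + (u : K) ^ m * w, add_mem hy (mul_mem (pow_mem u.2 _) hw), w, hw, ?_⟩
      rw [he, hz', Derivation.map_add, Derivation.map_algebraMap, Derivation.leibniz]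
      simp only [smul_eq_mul]
      ring
  have hdu : d u ≠ 0 := by
    intro h0
    have h1 : ∀ m : ℕ, ∃ z ∈ V, (1 : K) = (u : K) ^ m * z := by
      intro m
      obtain ⟨y, hy, z, hz, he⟩ := exp (n + m) _ (V.nonunits_subset hπ)
      rw [hd, h0, mul_zero, zero_add] at he
      exact ⟨_, hn z hz, by rw [he]; ring⟩
    obtain ⟨z, hz, he⟩ := h1 1
    rw [pow_one] at he
    exact hu.not_isUnit (IsUnit.of_mul_eq_one ⟨z, hz⟩ (Subtype.ext he.symm))
  refine ⟨hdu, fun x hx => ?_⟩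
  obtain ⟨m, hm⟩ := exists_pow_mul hu (d u)⁻¹
  obtain ⟨y, hy, z, hz, he⟩ := exp (n + m) x hx
  have : d x / d u = y + ((u : K) ^ m * (d u)⁻¹) * ((u : K) ^ n * d z) := by
    rw [he]; field_simp; ring
  rw [this]
  exact add_mem hy (mul_mem hm (hn z hz))

/-- combined local statement. -/
lemma local_diff [IsAlgClosed k] [IsDiscreteValuationRing V] {u : V} (hu : Irreducible u)
    (d : Derivation k K K) (hd : d (algebraMap F K π) = 1)
    (h : K) (hT : ∀ b : icl F V, Algebra.trace F K (h * b) ∈ ctr F V) :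
    d u ≠ 0 ∧ h / d u ∈ V := by
  obtain ⟨hdu, hV⟩ := deriv_unif hkV hπ hg hπ0 hu d hd
  refine ⟨hdu, ?_⟩
  have hm := trace_key hkV hπ hg hπ0 h hT
  have hu0 : (u : K) ≠ 0 := by
    intro h; exact hu.ne_zero (Subtype.ext h)
  obtain ⟨hx1, hx2⟩ := V.mem_nonunits_iff_exists_mem_maximalIdeal.1 hm
  rw [hu.maximalIdeal_eq, Ideal.mem_span_singleton] at hx2
  obtain ⟨m, hm⟩ := hx2
  have hm' : algebraMap F K π * h = u * m := congrArg Subtype.val hm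
  obtain ⟨hy1, hy2⟩ := V.mem_nonunits_iff_exists_mem_maximalIdeal.1 hπ
  have hpk0 : algebraMap F K π ≠ 0 := by simpa using hπ0
  have hp0 : (⟨algebraMap F K π, hy1⟩ : V) ≠ 0 := by
    intro h0; exact hpk0 (congrArg Subtype.val h0)
  obtain ⟨e, w, hw⟩ := IsDiscreteValuationRing.eq_unit_mul_pow_irreducible hp0 hu
  have hw' : algebraMap F K π = (w : V) * (u : K) ^ e := by
    have := congrArg Subtype.val hw
    simpa using this
  have he0 : e ≠ 0 := by
    rintro rfl
    rw [hw, pow_zero, mul_one] at hy2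
    exact hy2 w.isUnit
  obtain ⟨e, rfl⟩ := Nat.exists_eq_succ_of_ne_zero he0
  have hww : ((w : V) : K) * ((w⁻¹ : Vˣ) : V) = 1 := by
    exact congrArg Subtype.val w.mul_inv
  set wi : K := (((w⁻¹ : Vˣ) : V) : K)
  set W : K := ((w : V) : K)
  have hw0 : W ≠ 0 := left_ne_zero_of_mul_eq_one hww
  have hg' := hV W (w : V).2
  set g := d W / d u
  have hgd : d W = g * d u := by simp only [g]; field_simp
  have h1 : 1 = d u * (u : K) ^ e * ((e + 1) * W + u * g) := by
    refine hd.symm.trans ?_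
    rw [hw', Derivation.leibniz, Derivation.leibniz_pow, hgd]
    simp only [smul_eq_mul, nsmul_eq_mul, Nat.succ_eq_add_one, Nat.add_sub_cancel]
    push_cast; ring
  have h2 : h = m * wi / (u : K) ^ e := by
    rw [hw'] at hm'
    field_simp
    have : (u : K) * (h * u ^ e) = u * (m * wi) := by
      calc (u : K) * (h * u ^ e) = (W * wi) * ((u : K) * (h * u ^ e)) := by rw [hww, one_mul]
        _ = wi * (W * u ^ (e + 1) * h) := by ring
        _ = _ := by rw [hm']; ring
    exact mul_left_cancel₀ hu0 this
  have h3 : h / d u = m * wi * ((e + 1) * W + u * g) := by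
    have hB : (e + 1) * W + u * g = (d u)⁻¹ * ((u : K) ^ e)⁻¹ := by
      have : d u * (u : K) ^ e ≠ 0 := mul_ne_zero hdu (pow_ne_zero _ hu0)
      field_simp
      linear_combination -h1
    rw [hB, h2]; field_simp
  rw [h3]
  have hwV : W ∈ V := (w : V).2
  have hwiV : wi ∈ V := ((w⁻¹ : Vˣ) : V).2
  exact mul_mem (mul_mem m.2 hwiV) (add_mem (mul_mem (add_mem (natCast_mem V e) (one_mem _)) hwV)
    (mul_mem u.2 hg'))

end loc2

end St6

namespace St6
open Polynomial

lemma icl_basis (A F K : Type*) [CommRing A] [IsDomain A] [IsPrincipalIdealRing A] [Field F]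
    [Algebra A F] [IsFractionRing A F] [Field K] [Algebra F K] [Algebra A K] [IsScalarTower A F K]
    [FiniteDimensional F K] [CharZero F] :
    ∃ b : Module.Basis (Fin (Module.finrank F K)) F K, ∀ y : K, IsIntegral A y ↔
      ∀ i, b.repr y i ∈ (algebraMap A F).range := by
  have : Module.IsTorsionFree A K := Module.IsTorsionFree.trans_faithfulSMul A F K
  have h1 : Module.Finite A (integralClosure A K) := IsIntegralClosure.finite A F K _
  have h2 : Module.Free A (integralClosure A K) := IsIntegralClosure.module_free A F K _
  have h3 := IsIntegralClosure.isLocalization A F K (integralClosure A K)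
  let b0 := Module.Free.chooseBasis A (integralClosure A K)
  let b1 := Module.Basis.localizationLocalization F (nonZeroDivisors A) K b0
  let e := Fintype.equivFinOfCardEq (Module.finrank_eq_card_basis b1).symm
  refine ⟨b1.reindex e, fun y => ⟨fun hy i => ?_, fun hy => ?_⟩⟩
  · have := Module.Basis.localizationLocalization_repr_algebraMap F (nonZeroDivisors A) K b0
      ⟨y, hy⟩ (e.symm i)
    rw [Module.Basis.repr_reindex, Finsupp.mapDomain_equiv_apply]
    exact ⟨_, this.symm⟩
  · rw [← (b1.reindex e).sum_repr y]
    refine IsIntegral.sum _ fun i _ => ?_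
    obtain ⟨a, ha⟩ := hy i
    rw [← ha, algebraMap_smul]
    refine IsIntegral.smul _ ?_
    rw [Module.Basis.reindex_apply, Module.Basis.localizationLocalization_apply]
    exact (b0 _).2

section DW
variable {k F K : Type*} [Field k] [CharZero k] [Field F] [Field K] [Algebra k F] [Algebra k K]
  [Algebra F K] [IsScalarTower k F K] [FiniteDimensional F K]
  [Algebra k[X] F] [IsFractionRing k[X] F] [IsScalarTower k k[X] F] [Algebra k[X] K]
  [IsScalarTower k[X] F K]

lemma aeval_eq_algebraMap (p : k[X]) : aeval (algebraMap k[X] F X) p = algebraMap k[X] F p := by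
  rw [aeval_algebraMap_apply, aeval_X_left_apply]

lemma fieldGen_X : FieldGen k (algebraMap k[X] F X) := by
  intro f
  obtain ⟨p, q, hq, rfl⟩ := IsFractionRing.div_surjective (A := k[X]) f
  refine ⟨p, q, ?_, ?_⟩
  · rw [aeval_eq_algebraMap]; simpa using nonZeroDivisors.ne_zero hq
  · rw [aeval_eq_algebraMap, aeval_eq_algebraMap]

lemma x_ne_zero : algebraMap k[X] F X ≠ 0 := by
  simp

variable (O : ValuationSubring F) (hk : ∀ c : k, algebraMap k F c ∈ O)
  (hx : (algebraMap k[X] F X)⁻¹ ∈ O.nonunits)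

include hk hx in
lemma exists_lattice : ∃ (n : ℕ) (b : Fin n → K) (φ : Fin n → K →ₗ[F] F) (m : Fin n → ℤ),
    (∀ y, y = ∑ j, φ j y • b j) ∧ (∀ j, φ j ≠ 0) ∧ (∀ j, IsIntegral k[X] (b j)) ∧
    (∀ j y, IsIntegral k[X] y → φ j y ∈ (algebraMap k[X] F).range) ∧
    (∀ j, IsIntegral O (((algebraMap k[X] F X)⁻¹ ^ m j) • b j)) ∧
    (∀ j y, IsIntegral O y → algebraMap k[X] F X ^ m j * φ j y ∈ O) := by
  classical
  have hchF : CharZero F := charZero_of_injective_algebraMap (algebraMap k F).injective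
  have hg : FieldGen k (algebraMap k[X] F X)⁻¹ := fieldGen_inv fieldGen_X
  set x := algebraMap k[X] F X with hxdef
  have hx0 : x ≠ 0 := x_ne_zero
  have hxi0 : x⁻¹ ≠ 0 := inv_ne_zero hx0
  have := dvr_of_fieldGen O hk hx hg hxi0
  obtain ⟨b0, hb0⟩ := icl_basis k[X] F K
  obtain ⟨c, hc⟩ := icl_basis O F K
  let M := c.toMatrix b0
  have hMu : IsUnit M.det := by
    have : M * b0.toMatrix c = 1 := c.toMatrix_mul_toMatrix_flip b0
    exact Matrix.isUnit_det_of_right_inverse this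
  obtain ⟨U, m, hU, hM1, hM2⟩ := lattice_thm O hk hx hg hxi0 M hMu.ne_zero
  rw [inv_inv] at hM1 hM2
  have hW : U.map (aeval x) = U.map (algebraMap k[X] F) := by
    ext i j; simp only [Matrix.map_apply]; exact aeval_eq_algebraMap _
  set W := U.map (algebraMap k[X] F) with hWdef
  rw [hW] at hM1 hM2
  set N := Matrix.of fun i j => (M * W) i j * x⁻¹ ^ m j with hN
  have hUi : U * U⁻¹ = 1 := Matrix.mul_nonsing_inv _ hU
  have hUi' : U⁻¹ * U = 1 := Matrix.nonsing_inv_mul _ hU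
  let W' := (U⁻¹).map (algebraMap k[X] F)
  have hWW' : W * W' = 1 := by
    have := congrArg (fun A => A.map (algebraMap k[X] F)) hUi
    simpa [Matrix.map_mul, W', W] using this
  have hW'W : W' * W = 1 := by
    have := congrArg (fun A => A.map (algebraMap k[X] F)) hUi'
    simpa [Matrix.map_mul, W', W] using this
  let b : Fin (Module.finrank F K) → K := fun j => ∑ l, W l j • b0 l
  let φ : Fin (Module.finrank F K) → K →ₗ[F] F := fun j => ∑ l, W' j l • b0.coord l
  have hφ : ∀ j y, φ j y = ∑ l, W' j l * b0.repr y l := by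
    intro j y; simp [φ, LinearMap.sum_apply]
  have hrep : ∀ y, y = ∑ j, φ j y • b j := by
    intro y
    simp only [hφ, b, Finset.smul_sum, smul_smul]
    rw [Finset.sum_comm]
    conv_lhs => rw [← b0.sum_repr y]
    refine Finset.sum_congr rfl fun l _ => ?_
    rw [← Finset.sum_smul]
    congr 1
    have : ∀ j, (∑ i, W' j i * b0.repr y i) * W l j = ∑ i, (W l j * W' j i) * b0.repr y i := by
      intro j; rw [Finset.sum_mul]; exact Finset.sum_congr rfl fun i _ => by ring
    simp only [this]
    rw [Finset.sum_comm]
    simp only [← Finset.sum_mul, ← Matrix.mul_apply, hWW', Matrix.one_apply]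
    simp
  have hφb : ∀ j, φ j (b j) = 1 := by
    intro j
    rw [hφ]
    have : ∀ l, b0.repr (b j) l = W l j := by
      intro l
      simp only [b]
      rw [b0.repr_sum_self]
    simp only [this, ← Matrix.mul_apply, hW'W, Matrix.one_apply_eq]
  have hcb : ∀ i j, c.repr (b j) i = (M * W) i j := by
    intro i j
    simp only [b, map_sum, map_smul, Finsupp.coe_finset_sum, Finset.sum_apply, Finsupp.smul_apply,
      smul_eq_mul, Matrix.mul_apply, M, Module.Basis.toMatrix_apply]
    exact Finset.sum_congr rfl fun l _ => mul_comm _ _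
  refine ⟨_, b, φ, m, hrep, ?_, ?_, ?_, ?_, ?_⟩
  · intro j h0
    have := hφb j
    rw [h0] at this
    simp at this
  · intro j
    refine IsIntegral.sum _ fun l _ => ?_
    simp only [W, Matrix.map_apply, algebraMap_smul]
    refine IsIntegral.smul _ ((hb0 _).2 fun i => ?_)
    rw [b0.repr_self, Finsupp.single_apply]
    split_ifs
    · exact one_mem _
    · exact zero_mem _
  · intro j y hy
    rw [hφ]
    exact sum_mem fun l _ => mul_mem ⟨_, rfl⟩ ((hb0 y).1 hy l)
  · intro j
    rw [hc]
    intro i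
    rw [map_smul, Finsupp.smul_apply, hcb, smul_eq_mul, mul_comm]
    exact ⟨⟨_, hM1 i j⟩, rfl⟩
  · intro j y hy
    have hyO : ∀ i, c.repr y i ∈ O := by
      intro i
      obtain ⟨a, ha⟩ := (hc y).1 hy i
      rw [← ha]; exact a.2
    -- c.repr y = N *ᵥ (x^m φ y)
    let z : Fin (Module.finrank F K) → F := fun j => x ^ m j * φ j y
    have hNz : N.mulVec z = fun i => c.repr y i := by
      ext i
      conv_rhs => rw [hrep y]
      simp only [map_sum, map_smul, Finsupp.coe_finset_sum, Finset.sum_apply, Finsupp.smul_apply,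
        smul_eq_mul, hcb, Matrix.mulVec, dotProduct, hN, Matrix.of_apply, z]
      refine Finset.sum_congr rfl fun l _ => ?_
      rw [inv_zpow]
      have := zpow_ne_zero (m l) hx0
      field_simp
    have hNdet : N.det ≠ 0 := by
      intro h0; rw [h0, map_zero] at hM2; exact zero_ne_one hM2
    have hz : z = fun j => N.det⁻¹ * (N.adjugate.mulVec fun i => c.repr y i) j := by
      ext j
      rw [← hNz, Matrix.mulVec_mulVec, Matrix.adjugate_mul, Matrix.smul_mulVec, Matrix.one_mulVec,
        Pi.smul_apply, smul_eq_mul, inv_mul_cancel_left₀ hNdet]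
    change z j ∈ O
    rw [hz]
    refine mul_mem ?_ ?_
    · rw [← O.valuation_le_one_iff, map_inv₀, hM2, inv_one]
    · simp only [Matrix.mulVec, dotProduct]
      refine sum_mem fun i _ => mul_mem ?_ (hyO i)
      let N0 : Matrix (Fin (Module.finrank F K)) (Fin (Module.finrank F K)) O :=
        Matrix.of fun i j => ⟨N i j, hM1 i j⟩
      have : N = N0.map O.subtype := by ext i j; rfl
      rw [this, ← RingHom.mapMatrix_apply, ← RingHom.map_adjugate]
      exact (N0.adjugate j i).2

lemma exists_deriv : ∃ d : Derivation k K K, d (algebraMap F K (algebraMap k[X] F X)) = 1 := by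
  have hchF : CharZero F := charZero_of_injective_algebraMap (algebraMap k F).injective
  have : IsScalarTower k k[X] K := IsScalarTower.of_algebraMap_eq fun c => by
    rw [IsScalarTower.algebraMap_apply k F K, IsScalarTower.algebraMap_apply k k[X] F,
      ← IsScalarTower.algebraMap_apply k[X] F K]
  have h1 : Algebra.FormallyEtale k[X] F := Algebra.FormallyEtale.of_isLocalization
    (nonZeroDivisors k[X])
  have h2 : Algebra.FormallyEtale F K := Algebra.FormallyEtale.of_isSeparable F K
  have h3 : Algebra.FormallyEtale k[X] K := Algebra.FormallyEtale.comp k[X] F K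
  let e := KaehlerDifferential.tensorKaehlerEquivOfFormallyEtale k k[X] K
  let d0 : Derivation k k[X] k[X] := Polynomial.derivative'
  let l0 : Ω[k[X]⁄k] →ₗ[k[X]] K := (Algebra.linearMap k[X] K).comp d0.liftKaehlerDifferential
  let l : Ω[K⁄k] →ₗ[K] K := (LinearMap.liftBaseChange K l0).comp e.symm.toLinearMap
  refine ⟨l.compDer (KaehlerDifferential.D k K), ?_⟩
  rw [← IsScalarTower.algebraMap_apply k[X] F K]
  change l (KaehlerDifferential.D k K (algebraMap k[X] K X)) = 1
  simp only [l, LinearMap.comp_apply, LinearEquiv.coe_coe, e]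
  rw [KaehlerDifferential.tensorKaehlerEquivOfFormallyEtale_symm_D_algebraMap,
    LinearMap.liftBaseChange_tmul, one_smul]
  simp [l0, d0, derivative']

/-- localisation: integral elements over the local ring become integral over `k[X]`. -/
lemma exists_mul_integral {V : ValuationSubring F} (hkV : ∀ c : k, algebraMap k F c ∈ V) {c : k}
    (hc : algebraMap k[X] F X - algebraMap k F c ∈ V.nonunits) (b : K) (hb : IsIntegral V b) :
    ∃ q : k[X], V.valuation (algebraMap k[X] F q) = 1 ∧
      IsIntegral k[X] (algebraMap k[X] K q * b) := by
  have hxV : algebraMap k[X] F X ∈ V := by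
    have := add_mem (V.nonunits_subset hc) (hkV c)
    simpa using this
  have hpV : ∀ p : k[X], algebraMap k[X] F p ∈ V := fun p => by
    rw [← aeval_eq_algebraMap]; exact aeval_mem V hkV hxV p
  let _ : Algebra k[X] V := ((algebraMap k[X] F).codRestrict V.toSubring hpV).toAlgebra
  have hmap : ∀ p : k[X], ((algebraMap k[X] V p : V) : F) = algebraMap k[X] F p := fun p => rfl
  have : IsScalarTower k[X] V K := IsScalarTower.of_algebraMap_eq fun p => by
    rw [IsScalarTower.algebraMap_apply k[X] F K]; rfl
  let S : Submonoid k[X] := (IsUnit.submonoid V).comap (algebraMap k[X] V)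
  have hS : ∀ p, p ∈ S ↔ V.valuation (algebraMap k[X] F p) = 1 := by
    intro p
    rw [← hmap, ← V.valuation_eq_one_iff]; rfl
  have hinj : Function.Injective (algebraMap k[X] F) := IsFractionRing.injective k[X] F
  have : IsLocalization S V := by
    refine ⟨fun s => s.2, fun z => ?_, fun {p q} h => ⟨1, ?_⟩⟩
    · have hx0 : algebraMap k[X] F X - algebraMap k F c ≠ 0 := by
        intro h
        rw [IsScalarTower.algebraMap_apply k k[X] F, ← map_sub] at h
        rw [map_eq_zero_iff _ hinj] at h
        exact X_sub_C_ne_zero c h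
      obtain ⟨p, q, hq, he⟩ := (mem_iff_exists V hkV hc (fieldGen_sub fieldGen_X c) hx0 z.1).1 z.2
      have hq1 := valuation_aeval_eq_one V hkV hc q hq
      have hcomp : ∀ r : k[X], aeval (algebraMap k[X] F X - algebraMap k F c) r =
          algebraMap k[X] F (r.comp (X - C c)) := by
        intro r
        rw [← aeval_eq_algebraMap (F := F) (r.comp (X - C c)), aeval_comp]; simp
      rw [hcomp] at hq1
      refine ⟨⟨p.comp (X - C c), ⟨q.comp (X - C c), (hS _).2 hq1⟩⟩, Subtype.ext ?_⟩
      have h0 : algebraMap k[X] F (q.comp (X - C c)) ≠ 0 := by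
        intro h0; rw [h0, map_zero] at hq1; exact zero_ne_one hq1
      push_cast
      rw [hmap, hmap, he, hcomp, hcomp]
      field_simp
    · have := congrArg Subtype.val h
      rw [hmap, hmap] at this
      rw [hinj this]
  obtain ⟨q, hq⟩ := IsIntegral.exists_multiple_integral_of_isLocalization S b hb
  refine ⟨q, (hS _).1 q.2, ?_⟩
  rw [← Algebra.smul_def]; exact hq

lemma ctr_ne_top {V : ValuationSubring K} (hV : V ≠ ⊤) : ctr F V ≠ ⊤ := by
  intro h
  apply hV
  rw [eq_top_iff]
  intro y _
  have h1 : IsIntegral F y := Algebra.IsIntegral.isIntegral y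
  refine icl_mem (F := F) V ⟨y, ?_⟩
  refine h1.map_of_comp_eq (φ := (RingHom.id F).codRestrict (ctr F V).toSubring (fun x => ?_))
    (ψ := RingHom.id K) (by ext; rfl)
  change x ∈ ctr F V
  rw [h]; trivial

lemma dvr_ne_top {V : ValuationSubring K} [IsDiscreteValuationRing V] : V ≠ ⊤ := by
  rintro rfl
  apply IsDiscreteValuationRing.not_isField (⊤ : ValuationSubring K)
  refine ⟨⟨0, 1, zero_ne_one⟩, mul_comm, fun {a} ha => ⟨⟨(a : K)⁻¹, trivial⟩, Subtype.ext ?_⟩⟩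
  have : (a : K) ≠ 0 := fun h => ha (Subtype.ext h)
  simp [this]

include hk hx in
lemma ctr_eq {V : ValuationSubring K} (hkV : ∀ c : k, algebraMap k K c ∈ V)
    (hxV : algebraMap F K (algebraMap k[X] F X) ∉ V) :
    (algebraMap k[X] F X)⁻¹ ∈ (ctr F V).nonunits ∧ ctr F V = O := by
  have h1 : (algebraMap k[X] F X)⁻¹ ∈ (ctr F V).nonunits := by
    rw [ValuationSubring.mem_nonunits_iff_or]
    right
    rw [inv_inv, ValuationSubring.mem_comap]
    exact hxV
  refine ⟨h1, ?_⟩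
  have hg : FieldGen k (algebraMap k[X] F X)⁻¹ := fieldGen_inv fieldGen_X
  ext f
  rw [mem_iff_exists _ (ctr_k hkV) h1 hg (inv_ne_zero x_ne_zero),
    mem_iff_exists O hk hx hg (inv_ne_zero x_ne_zero)]

include hk hx in
lemma dw_case1 [IsAlgClosed k] (φ : K →ₗ[F] F) (hφ0 : φ ≠ 0)
    (hφ : ∀ y, IsIntegral k[X] y → φ y ∈ (algebraMap k[X] F).range)
    (hφO : ∀ y, IsIntegral O y → algebraMap k[X] F X ^ 2 * φ y ∈ O) :
    ∃ δ : Derivation k K K, ∀ V : ValuationSubring K, (∀ c, algebraMap k K c ∈ V) →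
      ∀ (_ : IsDiscreteValuationRing V) (u : V), Irreducible u → δ u ≠ 0 ∧ (δ u)⁻¹ ∈ V := by
  have hchF : CharZero F := charZero_of_injective_algebraMap (algebraMap k F).injective
  obtain ⟨d, hd⟩ := exists_deriv (k := k) (F := F) (K := K)
  obtain ⟨h, hh⟩ : ∃ h : K, ∀ y, Algebra.trace F K (h * y) = φ y := by
    have hnd := traceForm_nondegenerate F K
    refine ⟨(LinearMap.BilinForm.toDual _ hnd).symm φ, fun y => ?_⟩
    have := LinearMap.BilinForm.apply_toDual_symm_apply (hB := hnd) φ y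
    exact this
  have hh0 : h ≠ 0 := by
    rintro rfl
    apply hφ0
    ext y
    rw [← hh]; simp
  set x := algebraMap k[X] F X with hxdef
  have hx0 : x ≠ 0 := x_ne_zero
  refine ⟨h⁻¹ • d, fun V hkV _ u hu => ?_⟩
  suffices d u ≠ 0 ∧ h / d u ∈ V by
    refine ⟨?_, ?_⟩
    · rw [Derivation.smul_apply, smul_eq_mul]
      exact mul_ne_zero (inv_ne_zero hh0) this.1
    · rw [Derivation.smul_apply, smul_eq_mul, mul_inv, inv_inv, ← div_eq_mul_inv]
      exact this.2
  by_cases hxV : algebraMap F K x ∈ V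
  · obtain ⟨c, hc⟩ := exists_place (k := k) (x := x) fieldGen_X (ctr F V) (ctr_k hkV)
      (ctr_ne_top (F := F) dvr_ne_top) hxV
    have hπ0 : x - algebraMap k F c ≠ 0 := by
      intro h
      rw [IsScalarTower.algebraMap_apply k k[X] F, ← map_sub,
        map_eq_zero_iff _ (IsFractionRing.injective k[X] F)] at h
      exact X_sub_C_ne_zero c h
    refine local_diff hkV ((comap_nonunits V _ _).1 hc) (fieldGen_sub fieldGen_X c) hπ0 hu d ?_ h ?_
    · rw [map_sub, map_sub, hd, ← IsScalarTower.algebraMap_apply, Derivation.map_algebraMap,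
        sub_zero]
    · intro b
      obtain ⟨q, hq, hqb⟩ := exists_mul_integral (ctr_k hkV) hc (b : K) b.2
      rw [hh]
      obtain ⟨r, hr⟩ := hφ _ hqb
      have hq0 : algebraMap k[X] F q ≠ 0 := by
        intro h0; rw [h0, map_zero] at hq; exact zero_ne_one hq
      have h2 : φ b = (algebraMap k[X] F q)⁻¹ * algebraMap k[X] F r := by
        rw [hr, IsScalarTower.algebraMap_apply k[X] F K, ← Algebra.smul_def, map_smul, smul_eq_mul,
          inv_mul_cancel_left₀ hq0]
      rw [h2]
      refine mul_mem ?_ ?_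
      · rw [← (ctr F V).valuation_le_one_iff, map_inv₀, hq, inv_one]
      · rw [← aeval_eq_algebraMap]
        exact aeval_mem (ctr F V) (ctr_k hkV) (x := algebraMap k[X] F X) hxV r
  · obtain ⟨h1, h2⟩ := ctr_eq O hk hx hkV hxV
    have hg : FieldGen k x⁻¹ := fieldGen_inv fieldGen_X
    set xK := algebraMap F K x with hxK
    have hxK0 : xK ≠ 0 := by simpa [hxK] using hx0
    have key := local_diff hkV ((comap_nonunits V _ _).1 h1) hg (inv_ne_zero hx0) hu
      ((-xK ^ 2) • d) ?_ ((-xK ^ 2) * h) ?_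
    · obtain ⟨k1, k2⟩ := key
      rw [Derivation.smul_apply, smul_eq_mul] at k1 k2
      have h3 : d u ≠ 0 := right_ne_zero_of_mul k1
      refine ⟨h3, ?_⟩
      rwa [mul_div_mul_left _ _ (neg_ne_zero.2 (pow_ne_zero 2 hxK0))] at k2
    · rw [Derivation.smul_apply, map_inv₀, Derivation.leibniz_inv, hd, smul_eq_mul, smul_eq_mul]
      field_simp
      rfl
    · intro b
      have h3 : -xK ^ 2 * h * (b : K) = (-x ^ 2) • (h * (b : K)) := by
        rw [Algebra.smul_def, map_neg, map_pow]; ring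
      rw [h3, map_smul, hh, smul_eq_mul, neg_mul]
      have hb : IsIntegral (ctr F V) (b : K) := b.2
      have hgen : ∀ O' : ValuationSubring F, O' = O → IsIntegral O' (b : K) →
          IsIntegral O (b : K) := by rintro _ rfl h; exact h
      exact neg_mem ((SetLike.ext_iff.1 h2 _).2 (hφO _ (hgen _ h2 hb)))

end DW
end St6

namespace St6
open Polynomial
open scoped IntermediateField

lemma isIntegral_of_forall_V {E K : Type*} [Field E] [Field K] [Algebra E K]
    (O : ValuationSubring E) (y : K)
    (h : ∀ V : ValuationSubring K, (∀ a ∈ O, algebraMap E K a ∈ V) → y ∈ V) : IsIntegral O y := by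
  by_contra hy
  let R := (integralClosure O K).toSubring
  have hR : IsIntegrallyClosedIn R K := inferInstanceAs (IsIntegrallyClosedIn (integralClosure O K) K)
  obtain ⟨V, hV, hyV⟩ := Subring.exists_le_valuationSubring_of_isIntegrallyClosedIn
    (R := R) (x := y) hy
  refine hyV (h V fun a ha => hV ?_)
  exact (integralClosure O K).algebraMap_mem ⟨a, ha⟩

lemma fieldGen_adjoin {k K : Type*} [Field k] [Field K] [Algebra k K] (s : K) :
    FieldGen k (IntermediateField.AdjoinSimple.gen k s) := by
  intro f
  obtain ⟨p, q, h⟩ := IntermediateField.mem_adjoin_simple_iff k (α := s) (f : K) |>.1 f.2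
  have hc : ∀ r : k[X], ((aeval (IntermediateField.AdjoinSimple.gen k s) r : k⟮s⟯) : K) =
      aeval s r := by
    intro r
    have := aeval_algebraMap_apply K (IntermediateField.AdjoinSimple.gen k s) r
    rw [IntermediateField.AdjoinSimple.algebraMap_gen] at this
    exact this.symm
  by_cases hq : aeval s q = 0
  · refine ⟨0, 1, by simp, ?_⟩
    apply Subtype.ext
    rw [h, hq]; simp
  · refine ⟨p, q, fun h0 => hq ?_, Subtype.ext ?_⟩
    · rw [← hc, h0]; rfl
    · rw [h, ← hc, ← hc]; rfl

lemma fieldGen_of_unique_pole {k K : Type*} [Field k] [CharZero k] [IsAlgClosed k] [Field K]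
    [Algebra k K] [Algebra.EssFiniteType k K] (s : K)
    (halg : Algebra.IsAlgebraic (IntermediateField.adjoin k {s}) K) (V1 : ValuationSubring K)
    (hkV : ∀ c, algebraMap k K c ∈ V1) (hs : s ∉ V1)
    (hun : ∀ y ∈ V1.nonunits, y * s ∈ V1)
    (huniq : ∀ V : ValuationSubring K, (∀ c, algebraMap k K c ∈ V) → s ∉ V → V = V1) :
    FieldGen k s := by
  let E := IntermediateField.adjoin k {s}
  have hchE : CharZero E := charZero_of_injective_algebraMap (algebraMap k E).injective
  have : Algebra.EssFiniteType E K := Algebra.EssFiniteType.of_comp k E K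
  have : Algebra.FormallyUnramified E K := (Algebra.FormallyUnramified.iff_isSeparable E K).2
    inferInstance
  have : FiniteDimensional E K := Algebra.FormallyUnramified.finite_of_free E K
  set g : E := IntermediateField.AdjoinSimple.gen k s with hg
  have hgs : algebraMap E K g = s := rfl
  have hs0 : s ≠ 0 := by rintro rfl; exact hs (zero_mem _)
  have hg0 : g ≠ 0 := by
    intro h; apply hs0; rw [← hgs, h, map_zero]
  have hFG : FieldGen k g := fieldGen_adjoin s
  have hπ : algebraMap E K g⁻¹ ∈ V1.nonunits := by
    rw [ValuationSubring.mem_nonunits_iff_or, map_inv₀, inv_inv]; right; exact hs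
  have hF' := fieldGen_inv hFG
  obtain ⟨h1, h2, h3, h4⟩ := icl_ded hkV hπ hF' (inv_ne_zero hg0)
  have hdvr := ctr_dvr hkV hπ hF' (inv_ne_zero hg0)
  have hint : ∀ y ∈ V1, IsIntegral (ctr E V1) y := by
    intro y hy
    refine isIntegral_of_forall_V _ _ fun V hV => ?_
    by_cases hsV : s ∈ V
    · -- V ⊇ E
      have hE : ∀ a : E, algebraMap E K a ∈ V := by
        intro a
        by_cases ha : a ∈ ctr E V1
        · exact hV a ha
        · obtain ⟨n, p, q, hp, hq, rfl⟩ := exists_zpow (ctr E V1) (ctr_k hkV) (ctr_pi hπ) hF'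
            (inv_ne_zero hg0) a (by rintro rfl; exact ha (zero_mem _))
          rw [map_mul]
          refine mul_mem ?_ (hV _ ((mem_iff_exists (ctr E V1) (ctr_k hkV) (ctr_pi hπ) hF'
            (inv_ne_zero hg0) _).2 ⟨p, q, hq, rfl⟩))
          have h5 : V.valuation (algebraMap E K g⁻¹) = 1 := by
            refine val_eq_one V (hV _ ((ctr E V1).nonunits_subset (ctr_pi hπ))) ?_
            rw [ValuationSubring.mem_nonunits_iff_or, map_inv₀, inv_inv]
            rintro (h | h)
            · exact hs0 (inv_eq_zero.1 h)
            · exact h hsV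
          rw [← V.valuation_le_one_iff, map_zpow₀, map_zpow₀, h5, one_zpow]
      by_contra hyV
      refine ctr_ne_top (F := E) (V := V) (by rintro rfl; exact hyV trivial) ?_
      rw [eq_top_iff]
      exact fun a _ => hE a
    · rw [huniq V (fun c => ?_) hsV]
      · exact hy
      · have := hV _ (ctr_k (F := E) hkV c)
        rwa [← IsScalarTower.algebraMap_apply] at this
  have hsurj : ∀ b : icl E V1, ∃ a : ctr E V1, algebraMap _ _ a = b := by
    let N : Submodule (ctr E V1) (icl E V1) := LinearMap.range (Algebra.linearMap _ _)
    suffices (⊤ : Submodule (ctr E V1) (icl E V1)) ≤ N by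
      intro b
      exact this (x := b) trivial
    refine Submodule.le_of_le_smul_of_le_jacobson_bot (I := IsLocalRing.maximalIdeal (ctr E V1))
      h2.fg_top (IsLocalRing.maximalIdeal_le_jacobson _) ?_
    rintro b -
    have hbV := icl_mem V1 b
    obtain ⟨c, hc⟩ := exists_res_K hkV hπ hF' (inv_ne_zero hg0) _ hbV
    have hy1 := hun _ hc
    let y1 : icl E V1 := ⟨_, hint _ hy1⟩
    let c1 : ctr E V1 := ⟨algebraMap k E c, ctr_k hkV c⟩
    let p1 : ctr E V1 := ⟨g⁻¹, (ctr E V1).nonunits_subset (ctr_pi hπ)⟩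
    have hb : b = algebraMap _ _ c1 + p1 • y1 := by
      apply Subtype.ext
      change (b : K) = algebraMap k K c + (g⁻¹ : E) • (((b : K) - algebraMap k K c) * s)
      rw [Algebra.smul_def, map_inv₀, hgs]
      field_simp; ring
    rw [hb]
    refine Submodule.add_mem_sup ⟨c1, rfl⟩ (Submodule.smul_mem_smul ?_ trivial)
    rw [← ValuationSubring.coe_mem_nonunits_iff]
    exact ctr_pi hπ
  have hV1 : ∀ y ∈ V1, ∃ a : E, algebraMap E K a = y := by
    intro y hy
    obtain ⟨a, ha⟩ := hsurj ⟨y, hint y hy⟩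
    exact ⟨a, congrArg Subtype.val ha⟩
  have hall : ∀ y : K, ∃ a : E, algebraMap E K a = y := by
    intro y
    rcases V1.mem_or_inv_mem y with h | h
    · exact hV1 y h
    · obtain ⟨a, ha⟩ := hV1 _ h
      exact ⟨a⁻¹, by rw [map_inv₀, ha, inv_inv]⟩
  intro y
  obtain ⟨a, rfl⟩ := hall y
  obtain ⟨p, q, hq, rfl⟩ := hFG a
  refine ⟨p, q, ?_, ?_⟩
  · rw [← hgs, aeval_algebraMap_apply]
    simpa using hq
  · rw [map_div₀, ← hgs, aeval_algebraMap_apply, aeval_algebraMap_apply]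


lemma mem_range_of_isAlgebraic {k K : Type*} [Field k] [IsAlgClosed k] [Field K] [Algebra k K]
    {s : K} (h : IsAlgebraic k s) : ∃ c, algebraMap k K c = s := by
  have h1 : Algebra.IsIntegral k k⟮s⟯ :=
    Algebra.isAlgebraic_iff_isIntegral.1 (IntermediateField.isAlgebraic_adjoin_simple h.isIntegral)
  obtain ⟨y, hy⟩ := (IsAlgClosed.algebraMap_bijective_of_isIntegral (k := k)).2
    (IntermediateField.AdjoinSimple.gen k s)
  exact ⟨y, congrArg (algebraMap k⟮s⟯ K) hy⟩

section DW2
variable {k F K : Type*} [Field k] [CharZero k] [Field F] [Field K] [Algebra k F] [Algebra k K]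
  [Algebra F K] [IsScalarTower k F K] [FiniteDimensional F K]
  [Algebra k[X] F] [IsFractionRing k[X] F] [IsScalarTower k k[X] F] [Algebra k[X] K]
  [IsScalarTower k[X] F K] (O : ValuationSubring F) (hk : ∀ c : k, algebraMap k F c ∈ O)
  (hx : (algebraMap k[X] F X)⁻¹ ∈ O.nonunits)

include hk hx in
lemma div_X_mem (f : F) : ∃ p : k[X], algebraMap k[X] F X * (f - algebraMap k[X] F p) ∈ O := by
  have hg : FieldGen k (algebraMap k[X] F X)⁻¹ := fieldGen_inv fieldGen_X
  have hx0 : algebraMap k[X] F X ≠ 0 := x_ne_zero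
  have key : ∀ p q : k[X], q ≠ 0 → p.natDegree ≤ q.natDegree →
      algebraMap k[X] F p / algebraMap k[X] F q ∈ O := by
    intro p q hq hpq
    rw [mem_iff_exists O hk hx hg (inv_ne_zero hx0)]
    refine ⟨p.reflect q.natDegree, q.reflect q.natDegree, ?_, ?_⟩
    · change (reverse q).coeff 0 ≠ 0
      rw [coeff_zero_reverse]; simpa using hq
    · let _ := invertibleOfNonzero hx0
      have h1 := eval₂_reflect_mul_pow (algebraMap k F) (algebraMap k[X] F X) q.natDegree p hpq
      have h2 := eval₂_reflect_mul_pow (algebraMap k F) (algebraMap k[X] F X) q.natDegree q le_rfl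
      rw [← aeval_eq_algebraMap p, ← aeval_eq_algebraMap q, aeval_def, aeval_def, ← h1, ← h2,
        mul_div_mul_right _ _ (pow_ne_zero _ hx0), invOf_eq_inv]
      rfl
  obtain ⟨p, q, hq, rfl⟩ := IsFractionRing.div_surjective (A := k[X]) f
  have hq0 : q ≠ 0 := nonZeroDivisors.ne_zero hq
  have hq1 : algebraMap k[X] F q ≠ 0 := by simpa using hq0
  refine ⟨p / q, ?_⟩
  have : algebraMap k[X] F X * (algebraMap k[X] F p / algebraMap k[X] F q -
      algebraMap k[X] F (p / q)) = algebraMap k[X] F (X * (p % q)) / algebraMap k[X] F q := by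
    have h := congrArg (algebraMap k[X] F) (EuclideanDomain.div_add_mod p q)
    rw [map_add, map_mul] at h
    rw [map_mul]
    field_simp
    rw [← h]; ring
  rw [this]
  apply key _ _ hq0
  by_cases hr : p % q = 0
  · rw [hr]; simp
  · have := natDegree_lt_natDegree hr (degree_mod_lt p hq0)
    rw [natDegree_X_mul hr]; omega

include hk hx in
lemma split_sum {n : ℕ} {b : Fin n → K} {φ : Fin n → K →ₗ[F] F} {m : Fin n → ℤ}
    (h1 : ∀ y, y = ∑ j, φ j y • b j) (h2 : ∀ j, IsIntegral k[X] (b j))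
    (h3 : ∀ j, IsIntegral O (((algebraMap k[X] F X)⁻¹ ^ m j) • b j)) (hm : ∀ j, m j ≤ 1) (y : K) :
    ∃ s t : K, y = s + t ∧ IsIntegral k[X] s ∧ IsIntegral O t := by
  choose p hp using fun j => div_X_mem O hk hx (φ j y)
  set x := algebraMap k[X] F X with hxdef
  have hx0 : x ≠ 0 := x_ne_zero
  refine ⟨∑ j, p j • b j, ∑ j, (φ j y - algebraMap k[X] F (p j)) • b j, ?_,
    IsIntegral.sum _ fun j _ => (h2 j).smul _, IsIntegral.sum _ fun j _ => ?_⟩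
  · conv_lhs => rw [h1 y]
    rw [← Finset.sum_add_distrib]
    refine Finset.sum_congr rfl fun j _ => ?_
    rw [sub_smul, algebraMap_smul]; abel
  · obtain ⟨l, hl⟩ := Int.eq_ofNat_of_zero_le (sub_nonneg.2 (hm j))
    have h5 : (φ j y - algebraMap k[X] F (p j)) • b j =
        ((x * (φ j y - algebraMap k[X] F (p j))) * x⁻¹ ^ l) • (x⁻¹ ^ m j • b j) := by
      rw [smul_smul, mul_assoc, ← zpow_natCast, ← zpow_add₀ (inv_ne_zero hx0), ← hl,
        sub_add_cancel, zpow_one]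
      congr 1; field_simp
    rw [h5]
    let a : O := ⟨_, mul_mem (hp j) (pow_mem (O.nonunits_subset hx) l)⟩
    exact (h3 j).smul a

include hk hx in
lemma dw_case2 [IsAlgClosed k] [Algebra.EssFiniteType k K] (htr : Algebra.trdeg k K ≤ 1)
    (hsp : ∀ y : K, ∃ s t : K, y = s + t ∧ IsIntegral k[X] s ∧ IsIntegral O t) :
    ∃ s : K, FieldGen k s := by
  have hg : FieldGen k (algebraMap k[X] F X)⁻¹ := fieldGen_inv fieldGen_X
  have hx0 : (algebraMap k[X] F X)⁻¹ ≠ 0 := inv_ne_zero x_ne_zero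
  obtain ⟨V1, hOV, hloc⟩ := IsLocalRing.exists_factor_valuationRing
    ((algebraMap F K).comp O.subtype)
  have hkV : ∀ c : k, algebraMap k K c ∈ V1 := fun c => by
    have := hOV ⟨_, hk c⟩
    change algebraMap F K (algebraMap k F c) ∈ V1 at this
    rwa [← IsScalarTower.algebraMap_apply] at this
  have hπ : algebraMap F K (algebraMap k[X] F X)⁻¹ ∈ V1.nonunits := by
    let a : O := ⟨_, O.nonunits_subset hx⟩
    have h1 : ¬ IsUnit a := by
      have : (a : F) ∈ O.nonunits := hx
      rw [ValuationSubring.coe_mem_nonunits_iff] at this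
      exact this
    have h2 : ¬ IsUnit ((((algebraMap F K).comp O.subtype).codRestrict V1.toSubring hOV) a) :=
      fun h => h1 (hloc.map_nonunit _ h)
    exact (ValuationSubring.coe_mem_nonunits_iff (A := V1)).2 h2
  have hxV1 : algebraMap F K (algebraMap k[X] F X) ∉ V1 := by
    rw [ValuationSubring.mem_nonunits_iff_or, map_inv₀, inv_inv] at hπ
    exact hπ.resolve_left (inv_ne_zero (by simp))
  have hO1 := (ctr_eq O hk hx hkV hxV1).2
  obtain ⟨d1, d2, d3, d4⟩ := icl_ded hkV hπ hg hx0
  have hdvr := ctr_dvr hkV hπ hg hx0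
  -- the integral closure is a PID
  have hpid : IsPrincipalIdealRing (icl F V1) := by
    apply IsPrincipalIdealRing.of_finite_maximals
    refine (IsDedekindDomain.primesOver_finite (IsLocalRing.maximalIdeal (ctr F V1))
      (icl F V1)).subset ?_
    intro I hI
    have hI' : I.IsMaximal := hI
    refine ⟨hI'.isPrime, ⟨?_⟩⟩
    have : Algebra.IsIntegral (ctr F V1) (icl F V1) := inferInstance
    have := Ideal.isMaximal_comap_of_isIntegral_of_isMaximal (R := ctr F V1) I
    exact (IsLocalRing.eq_maximalIdeal this).symm
  let P : Ideal (icl F V1) := (IsLocalRing.maximalIdeal V1).comap (iclIncl V1)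
  have hPprime : P.IsPrime := Ideal.comap_isPrime _ _
  have hP : ∀ b : icl F V1, b ∈ P ↔ (b : K) ∈ V1.nonunits := fun b => by
    rw [Ideal.mem_comap, ← ValuationSubring.coe_mem_nonunits_iff]; rfl
  have hPx : algebraMap (ctr F V1) (icl F V1) ⟨_, (ctr F V1).nonunits_subset (ctr_pi hπ)⟩ ∈ P :=
    (hP _).2 hπ
  have hPbot : P ≠ ⊥ := by
    intro h
    rw [h, Ideal.mem_bot] at hPx
    have := congrArg (fun b : icl F V1 => (b : K)) hPx
    exact hx0 ((map_eq_zero (algebraMap F K)).1 this)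
  have hPmax : P.IsMaximal := hPprime.isMaximal hPbot
  obtain ⟨w, hw⟩ := (hpid.principal P).principal
  have hw' : ∀ b : icl F V1, b ∈ P ↔ ∃ b', b = w * b' := fun b => by
    rw [hw, Ideal.submodule_span_eq, Ideal.mem_span_singleton]; rfl
  have hwP : (w : K) ∈ V1.nonunits := (hP w).1 ((hw' w).2 ⟨1, (mul_one w).symm⟩)
  have hw0 : (w : K) ≠ 0 := by
    intro h
    apply hPbot
    have : w = 0 := Subtype.ext h
    rw [hw, this]; simp
  obtain ⟨s, t, hst, hsi, hti⟩ := hsp (w : K)⁻¹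
  have hgen : ∀ (V : ValuationSubring K), ctr F V = O → t ∈ V := by
    intro V hV
    have : ∀ O' : ValuationSubring F, O' = O → IsIntegral O' t := by rintro _ rfl; exact hti
    exact icl_mem V ⟨t, this _ hV⟩
  have htV := hgen V1 hO1
  have hs_eq : s = (w : K)⁻¹ - t := by rw [hst]; ring
  have hsV : s ∉ V1 := by
    intro h
    have h1 : (w : K)⁻¹ ∈ V1 := by rw [hst]; exact add_mem h htV
    rw [ValuationSubring.mem_nonunits_iff_or] at hwP
    exact hwP.resolve_left hw0 h1
  have hstr : Transcendental k s := by
    intro h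
    obtain ⟨c, hc⟩ := mem_range_of_isAlgebraic h
    apply hsV
    rw [← hc]; exact hkV c
  have halg : Algebra.IsAlgebraic (IntermediateField.adjoin k {s}) K := by
    have h1 : AlgebraicIndependent k (fun _ : Unit => s) := by
      rw [algebraicIndependent_unique_type_iff]; exact hstr
    have h2 := h1.isTranscendenceBasis_of_lift_trdeg_le_of_finite (by simpa using htr)
    have := h2.isAlgebraic_field
    rwa [Set.range_const] at this
  refine ⟨s, fieldGen_of_unique_pole s halg V1 hkV hsV ?_ ?_⟩
  · intro y hy
    obtain ⟨b, t', ht', he⟩ := exists_div hkV hπ hg hx0 y (V1.nonunits_subset hy)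
    have hb : b ∈ P := (hP b).2 (by rw [← he, mul_comm]; exact mul_nonunits V1 (icl_mem V1 t') hy)
    obtain ⟨b', rfl⟩ := (hw' b).1 hb
    have ht1 := val_eq_one V1 (icl_mem V1 t') ht'
    have ht0 : (t' : K) ≠ 0 := by intro h; rw [h, map_zero] at ht1; exact zero_ne_one ht1
    rw [hs_eq, mul_sub]
    refine sub_mem ?_ (mul_mem (V1.nonunits_subset hy) htV)
    have h6 : y * (w : K)⁻¹ = b' * (t' : K)⁻¹ := by
      have : y * t' = w * b' := he
      field_simp
      rw [this]; 
    rw [h6]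
    refine mul_mem (icl_mem V1 b') ?_
    rw [← V1.valuation_le_one_iff, map_inv₀, ht1, inv_one]
  · intro V hkV' hsV'
    have hxV : algebraMap F K (algebraMap k[X] F X) ∉ V := by
      intro hxV
      apply hsV'
      have hpV : ∀ p : k[X], algebraMap k[X] F p ∈ ctr F V := fun p => by
        rw [← aeval_eq_algebraMap]
        exact aeval_mem (ctr F V) (ctr_k hkV') (x := algebraMap k[X] F X) hxV p
      refine icl_mem (F := F) V ⟨s, ?_⟩
      refine hsi.map_of_comp_eq (φ := (algebraMap k[X] F).codRestrict (ctr F V).toSubring hpV)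
        (ψ := RingHom.id K) ?_
      apply RingHom.ext
      intro p
      exact (IsScalarTower.algebraMap_apply k[X] F K p).symm
    obtain ⟨e1, e2⟩ := ctr_eq O hk hx hkV' hxV
    have hBV : ∀ b : icl F V1, (b : K) ∈ V := by
      intro b
      have : ∀ O1 O' : ValuationSubring F, O1 = O' → IsIntegral O1 (b : K) →
        IsIntegral O' (b : K) := by rintro _ _ rfl h; exact h
      exact icl_mem V ⟨b, this _ _ (hO1.trans e2.symm) b.2⟩
    have hwV : (w : K) ∈ V.nonunits := by
      rw [ValuationSubring.mem_nonunits_iff_or]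
      right
      intro h
      apply hsV'
      rw [hs_eq]
      exact sub_mem h (hgen V e2)
    let Q : Ideal (icl F V1) := (IsLocalRing.maximalIdeal V).comap
      ((algebraMap (icl F V1) K).codRestrict V.toSubring hBV)
    have hQ : ∀ b : icl F V1, b ∈ Q ↔ (b : K) ∈ V.nonunits := fun b => by
      rw [Ideal.mem_comap, ← ValuationSubring.coe_mem_nonunits_iff]; rfl
    have hQP : P = Q := by
      refine hPmax.eq_of_le (Ideal.comap_isPrime _ _ : Q.IsPrime).ne_top ?_
      intro b hb
      obtain ⟨b', rfl⟩ := (hw' b).1 hb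
      exact Ideal.mul_mem_right _ _ ((hQ w).2 hwV)
    have hnu : ∀ b : icl F V1, (b : K) ∈ V1.nonunits ↔ (b : K) ∈ V.nonunits := fun b => by
      rw [← hP, ← hQ, hQP]
    have hle : ∀ W W' : ValuationSubring K, (∀ b : icl F V1, (b : K) ∈ W) →
        (∀ b : icl F V1, (b : K) ∈ W') → (w : K) ∈ W.nonunits →
        (∀ b : icl F V1, (b : K) ∈ W.nonunits ↔ (b : K) ∈ W'.nonunits) → W ≤ W' := by
      intro W W' hW hW' hwW hnu y hy
      obtain ⟨b, t', ht', he⟩ := ded_div (B := icl F V1) W hW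
        ⟨w, fun h => hw0 (by rw [h]; rfl), hwW⟩ y hy
      have ht1 := val_eq_one W' (hW' t') (fun h => ht' ((hnu t').2 h))
      have ht0 : (t' : K) ≠ 0 := by intro h; rw [h, map_zero] at ht1; exact zero_ne_one ht1
      have h6 : y = b * (t' : K)⁻¹ := by
        have : y * t' = b := he
        rw [← this]; field_simp
      rw [h6]
      refine mul_mem (hW' b) ?_
      rw [← W'.valuation_le_one_iff, map_inv₀, ht1, inv_one]
    exact le_antisymm (hle V V1 hBV (icl_mem V1) hwV fun b => (hnu b).symm)
      (hle V1 V (icl_mem V1) hBV hwP hnu)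

end DW2

theorem dedekind_weber {k K : Type*} [Field k] [CharZero k] [IsAlgClosed k] [Field K] [Algebra k K]
    [Algebra.EssFiniteType k K] (htr : Algebra.trdeg k K = 1) :
    (∃ s : K, FieldGen k s) ∨
    ∃ δ : Derivation k K K, ∀ V : ValuationSubring K, (∀ c, algebraMap k K c ∈ V) →
      ∀ (_ : IsDiscreteValuationRing V) (u : V), Irreducible u → δ u ≠ 0 ∧ (δ u)⁻¹ ∈ V := by
  classical
  obtain ⟨S, hS⟩ := exists_isTranscendenceBasis k K
  have hcard := hS.cardinalMk_eq_trdeg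
  rw [htr, Cardinal.eq_one_iff_unique] at hcard
  obtain ⟨h1, h2⟩ := hcard
  obtain ⟨x0⟩ := h2
  let x : K := x0
  have hrange : Set.range ((↑) : S → K) = {x} := by
    ext y
    simp only [Set.mem_range, Set.mem_singleton_iff]
    constructor
    · rintro ⟨z, rfl⟩; rw [Subsingleton.elim z x0]
    · rintro rfl; exact ⟨x0, rfl⟩
  have hxt : Transcendental k x := hS.1.transcendental x0
  have halg0 : Algebra.IsAlgebraic (Algebra.adjoin k {x}) K := by
    have := hS.isAlgebraic
    rwa [hrange] at this
  let f0 : k[X] →ₐ[k] K := aeval x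
  have hf0 : Function.Injective f0 := transcendental_iff_injective.1 hxt
  let f : RatFunc k →ₐ[k] K := IsFractionRing.liftAlgHom (A := k[X]) (K := RatFunc k) hf0
  let _ : Algebra (RatFunc k) K := f.toRingHom.toAlgebra
  let _ : Algebra k[X] K := f0.toRingHom.toAlgebra
  have : IsScalarTower k (RatFunc k) K := IsScalarTower.of_algebraMap_eq fun c =>
    (f.commutes c).symm
  have : IsScalarTower k[X] (RatFunc k) K := IsScalarTower.of_algebraMap_eq fun p =>
    (IsFractionRing.lift_algebraMap (K := RatFunc k) hf0 p).symm
  have halg : Algebra.IsAlgebraic (RatFunc k) K := by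
    constructor
    intro y
    have h3 : IsAlgebraic (Algebra.adjoin k {x}) y := halg0.isAlgebraic y
    have h4 : IsAlgebraic k[X] y := by
      refine IsAlgebraic.of_ringHom_of_comp_eq (S := Algebra.adjoin k {x}) (B := K)
        ((f0 : k[X] →+* K).codRestrict (Algebra.adjoin k {x}) ?_) (RingHom.id K) h3 ?_ ?_ ?_
      · intro p; exact aeval_mem_adjoin_singleton k x
      · rintro ⟨z, hz⟩
        rw [Algebra.adjoin_singleton_eq_range_aeval] at hz
        obtain ⟨p, rfl⟩ := hz
        exact ⟨p, rfl⟩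
      · exact Function.injective_id
      · ext <;> rfl
    exact h4.extendScalars (IsFractionRing.injective k[X] (RatFunc k))
  have : Algebra.EssFiniteType (RatFunc k) K := Algebra.EssFiniteType.of_comp k (RatFunc k) K
  have hch : CharZero (RatFunc k) :=
    charZero_of_injective_algebraMap (algebraMap k (RatFunc k)).injective
  have : Algebra.FormallyUnramified (RatFunc k) K :=
    (Algebra.FormallyUnramified.iff_isSeparable (RatFunc k) K).2 inferInstance
  have : FiniteDimensional (RatFunc k) K := Algebra.FormallyUnramified.finite_of_free (RatFunc k) K
  let O : ValuationSubring (RatFunc k) := (RatFunc.inftyValuation k).valuationSubring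
  have hk : ∀ c : k, algebraMap k (RatFunc k) c ∈ O := by
    intro c
    rw [Valuation.mem_valuationSubring_iff]
    by_cases hc : c = 0
    · rw [hc, map_zero, map_zero]; exact zero_le_one
    · have := RatFunc.inftyValuation.C k hc
      rw [RatFunc.algebraMap_eq_C, this]
  have hx : (algebraMap k[X] (RatFunc k) X)⁻¹ ∈ O.nonunits := by
    rw [ValuationSubring.mem_nonunits_iff_or, inv_inv, Valuation.mem_valuationSubring_iff]
    right
    rw [RatFunc.algebraMap_X, RatFunc.inftyValuation.X, not_le, ← WithZero.exp_zero, WithZero.exp_lt_exp]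
    exact zero_lt_one
  obtain ⟨n, b, φ, m, e1, e2, e3, e4, e5, e6⟩ := exists_lattice (K := K) O hk hx
  by_cases hm : ∀ j, m j ≤ 1
  · exact Or.inl (dw_case2 (F := RatFunc k) O hk hx htr.le
      (fun y => split_sum O hk hx e1 e3 e5 hm y))
  · push Not at hm
    obtain ⟨j, hj⟩ := hm
    refine Or.inr (dw_case1 O hk hx (φ j) (e2 j) (e4 j) fun y hy => ?_)
    obtain ⟨l, hl⟩ := Int.eq_ofNat_of_zero_le (show 0 ≤ m j - 2 by omega)
    have h5 := mul_mem (e6 j y hy) (pow_mem (O.nonunits_subset hx) l)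
    convert h5 using 1
    have hx0 : algebraMap k[X] (RatFunc k) X ≠ 0 := x_ne_zero
    have hmj : m j = (l : ℤ) + 2 := by omega
    rw [hmj, zpow_add₀ hx0, zpow_natCast, inv_pow]
    have := pow_ne_zero l hx0
    field_simp

end St6

namespace St6

section kstalk
variable {k : Type} [Field k] {X Y : OverR k}

/-- the structure map from the base field to a stalk -/
def kmap (X : OverR k) (x : X.left) : CommRingCat.of k ⟶ X.left.presheaf.stalk x :=
  Spec.preimage (X.left.fromSpecStalk x ≫ X.hom)

lemma kmap_spec (x : X.left) : Spec.map (kmap X x) = X.left.fromSpecStalk x ≫ X.hom :=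
  Spec.map_preimage _

instance stalkAlg (x : X.left) : Algebra k (X.left.presheaf.stalk x) := (kmap X x).hom.toAlgebra

lemma stalk_algebraMap (x : X.left) : algebraMap k (X.left.presheaf.stalk x) = (kmap X x).hom := rfl

lemma kmap_stalkMap (f : X ⟶ Y) (x : X.left) :
    kmap Y (f.left x) ≫ f.left.stalkMap x = kmap X x := by
  apply Spec.map_injective
  rw [Spec.map_comp, kmap_spec, kmap_spec, ← Category.assoc,
    Scheme.SpecMap_stalkMap_fromSpecStalk, Category.assoc, Over.w]

lemma kmap_specializes {x y : X.left} (h : x ⤳ y) :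
    kmap X y ≫ X.left.presheaf.stalkSpecializes h = kmap X x := by
  apply Spec.map_injective
  rw [Spec.map_comp, kmap_spec, kmap_spec, ← Category.assoc,
    Scheme.SpecMap_stalkSpecializes_fromSpecStalk]

/-- stalk map as an algebra homomorphism -/
def stalkHom (f : X ⟶ Y) (x : X.left) :
    Y.left.presheaf.stalk (f.left x) →ₐ[k] X.left.presheaf.stalk x :=
  { (f.left.stalkMap x).hom with
    commutes' := fun c => by
      have := congr(($(kmap_stalkMap f x)).hom c)
      exact this }

lemma stalkHom_apply (f : X ⟶ Y) (x : X.left) (s) : stalkHom f x s = f.left.stalkMap x s := rfl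

/-- specialization as an algebra homomorphism -/
def specHom {x y : X.left} (h : x ⤳ y) :
    X.left.presheaf.stalk y →ₐ[k] X.left.presheaf.stalk x :=
  { (X.left.presheaf.stalkSpecializes h).hom with
    commutes' := fun c => by
      have := congr(($(kmap_specializes h)).hom c)
      exact this }

lemma specHom_apply {x y : X.left} (h : x ⤳ y) (s) :
    specHom h s = X.left.presheaf.stalkSpecializes h s := rfl

lemma pt_bijective (y : (ptO k).left) : Function.Bijective (kmap (ptO k) y).hom := by
  obtain rfl : y = IsLocalRing.closedPoint k := by
    have : Subsingleton (SR k) := inferInstanceAs (Subsingleton (PrimeSpectrum k))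
    exact this.elim _ _
  have : kmap (ptO k) (IsLocalRing.closedPoint k) = (stalkClosedPointIso (CommRingCat.of k)).inv := by
    apply Spec.map_injective
    exact (kmap_spec (X := ptO k) _).trans ((Category.comp_id _).trans (Spec_stalkClosedPointIso _).symm)
  rw [this]
  exact (ConcreteCategory.isIso_iff_bijective (stalkClosedPointIso (CommRingCat.of k)).inv).1
    inferInstance

/-- structure morphism to the point -/
def toPt (X : OverR k) : X ⟶ ptO k := Over.homMk X.hom (Category.comp_id _)

instance stalk_essFiniteType [LocallyOfFiniteType X.hom] (x : X.left) :
    Algebra.EssFiniteType k (X.left.presheaf.stalk x) := by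
  have h := LocallyOfFiniteType.stalkMap X.hom x
  have h2 := kmap_stalkMap (toPt X) x
  have h4 : (kmap X x).hom.EssFiniteType := by
    rw [← h2, CommRingCat.hom_comp]
    exact RingHom.EssFiniteType.comp
      (RingHom.FiniteType.essFiniteType (RingHom.FiniteType.of_surjective _ (pt_bijective _).2)) h
  exact h4

lemma stalk_formallySmooth [Smooth X.hom] (x : X.left) :
    Algebra.FormallySmooth k (X.left.presheaf.stalk x) := by
  have h : (X.hom.stalkMap x).hom.FormallySmooth := by
    have : x ∈ X.hom.smoothLocus := by rw [Scheme.Hom.smoothLocus_eq_top]; trivial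
    exact this
  have h2 := kmap_stalkMap (toPt X) x
  have h4 : (kmap X x).hom.FormallySmooth := by
    rw [← h2, CommRingCat.hom_comp]
    refine RingHom.FormallySmooth.comp (f := (kmap (ptO k) ((toPt X).left x)).hom) ?_ h
    let := (kmap (ptO k) ((toPt X).left x)).hom.toAlgebra
    exact Algebra.FormallySmooth.of_equiv (AlgEquiv.ofBijective (Algebra.ofId k _) (pt_bijective _))
  exact h4

instance [LocallyOfFiniteType X.hom] : IsLocallyNoetherian X.left :=
  LocallyOfFiniteType.isLocallyNoetherian X.hom

example [LocallyOfFiniteType X.hom] (x : X.left) : IsNoetherianRing (X.left.presheaf.stalk x) := inferInstance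

lemma resField_bijective [IsAlgClosed k] [LocallyOfFiniteType X.hom] (x : X.left) (hx : IsClosed {x}) :
    Function.Bijective (algebraMap k (IsLocalRing.ResidueField (X.left.presheaf.stalk x))) := by
  have h1 : kmap X x ≫ X.left.residue x = (residueFieldIsoBase X.hom x hx).inv := by
    apply Spec.map_injective
    rw [SpecMap_residueFieldIsoBase_inv, Spec.map_comp, kmap_spec]
    rfl
  have := ((ConcreteCategory.isIso_iff_bijective (residueFieldIsoBase X.hom x hx).inv).1 inferInstance)
  rw [← h1] at this
  exact this

end kstalk
open IsLocalRing in
lemma tangentFamily_of_projective {k R : Type} [Field k] [CommRing R] [IsLocalRing R] [Algebra k R]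
    (hk : Function.Bijective (algebraMap k (ResidueField R)))
    [Module.Projective R (Ω[R⁄k])] : TangentFamily k R Set.univ := by
  intro φ
  have hfst : ∀ r, residue R r = algebraMap k (ResidueField R) (φ r).fst := by
    intro r
    have hr := sub_resHom_mem hk r
    have : (φ (r - algebraMap k R (resHom hk r))).fst = 0 := by
      let ψ : R →+* k := (TrivSqZeroExt.fstHom k k k).toRingHom.comp φ.toRingHom
      have hs : Function.Surjective ψ := fun c => ⟨algebraMap k R c, by
        change (φ (algebraMap k R c)).fst = c
        rw [AlgHom.commutes, TrivSqZeroExt.algebraMap_eq_inl, TrivSqZeroExt.fst_inl]⟩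
      have := IsLocalRing.eq_maximalIdeal (RingHom.ker_isMaximal_of_surjective ψ hs)
      rw [← this] at hr
      exact hr
    rw [map_sub, AlgHom.commutes, TrivSqZeroExt.fst_sub, TrivSqZeroExt.algebraMap_eq_inl, TrivSqZeroExt.fst_inl, sub_eq_zero] at this
    rw [this, ← sub_eq_zero]
    rw [← residue_eq_zero_iff] at hr
    rw [← hr, map_sub]; rfl
  let d : Derivation k R (ResidueField R) :=
    { toFun := fun r => algebraMap k (ResidueField R) (φ r).snd
      map_add' := by intros; simp
      map_smul' := by
        intro c r
        rw [map_smul, TrivSqZeroExt.snd_smul, smul_eq_mul, map_mul]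
        exact (Algebra.smul_def _ _).symm
      map_one_eq_zero' := by simp
      leibniz' := by
        intro a b
        change algebraMap k (ResidueField R) (φ (a * b)).snd = a • (algebraMap k (ResidueField R) (φ b).snd) + b • (algebraMap k (ResidueField R) (φ a).snd)
        rw [Algebra.smul_def, Algebra.smul_def]
        change _ = residue R a * _ + residue R b * _
        rw [hfst, hfst]
        simp only [map_mul, TrivSqZeroExt.snd_mul, map_add, smul_eq_mul, MulOpposite.smul_eq_mul_unop, MulOpposite.unop_op]
        ring }
  obtain ⟨g, hg⟩ := Module.projective_lifting_property (Algebra.linearMap R (ResidueField R)) d.liftKaehlerDifferential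
    residue_surjective
  refine ⟨g.compDer (KaehlerDifferential.D k R), trivial, fun r => ?_⟩
  rw [← residue_eq_zero_iff, map_sub, sub_eq_zero]
  have := congr($hg (KaehlerDifferential.D k R r))
  rw [Derivation.liftKaehlerDifferential_comp_D] at this
  exact this

lemma isReduced_stalk_of_specializes (Z : Scheme) {x y : Z} (h : x ⤳ y)
    [IsReduced (Z.presheaf.stalk y)] : IsReduced (Z.presheaf.stalk x) := by
  obtain ⟨_, ⟨U, hU, rfl⟩, hyU, -⟩ :=
    Z.isBasis_affineOpens.exists_subset_of_mem_open (Set.mem_univ y) isOpen_univ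
  replace hU : IsAffineOpen U := hU
  have hxU : x ∈ U := h.mem_open U.2 hyU
  refine ⟨fun a ha => ?_⟩
  let := Z.presheaf.algebra_section_stalk (U := U) ⟨x, hxU⟩
  let := Z.presheaf.algebra_section_stalk (U := U) ⟨y, hyU⟩
  have lx : IsLocalization.AtPrime (Z.presheaf.stalk x) (hU.primeIdealOf ⟨x, hxU⟩).asIdeal := hU.isLocalization_stalk ⟨x, hxU⟩
  have ly : IsLocalization.AtPrime (Z.presheaf.stalk y) (hU.primeIdealOf ⟨y, hyU⟩).asIdeal := hU.isLocalization_stalk ⟨y, hyU⟩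
  obtain ⟨⟨s, t⟩, hst⟩ := IsLocalization.surj (hU.primeIdealOf ⟨x, hxU⟩).asIdeal.primeCompl a
  have hle : (hU.primeIdealOf ⟨x, hxU⟩).asIdeal ≤ (hU.primeIdealOf ⟨y, hyU⟩).asIdeal := by
    rw [PrimeSpectrum.asIdeal_le_asIdeal, PrimeSpectrum.le_iff_specializes]
    refine (hU.fromSpec.isOpenEmbedding.isInducing.specializes_iff).1 ?_
    rw [hU.fromSpec_primeIdealOf, hU.fromSpec_primeIdealOf]
    exact h
  have hn : IsNilpotent (algebraMap Γ(Z, U) (Z.presheaf.stalk x) s) := by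
    rw [← hst]
    exact Commute.isNilpotent_mul_right (Commute.all _ _) ha
  obtain ⟨n, hn⟩ := hn
  rw [← map_pow, IsLocalization.map_eq_zero_iff (hU.primeIdealOf ⟨x, hxU⟩).asIdeal.primeCompl] at hn
  obtain ⟨u, hu⟩ := hn
  have h2 : algebraMap Γ(Z, U) (Z.presheaf.stalk y) (u * s) = 0 := by
    have : IsNilpotent (algebraMap Γ(Z, U) (Z.presheaf.stalk y) (u * s)) := by
      refine ⟨n + 1, ?_⟩
      rw [← map_pow]
      have : ((u : Γ(Z, U)) * s) ^ (n + 1) = u ^ n * s * (u * s ^ n) := by ring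
      rw [this, hu, mul_zero, map_zero]
    exact this.eq_zero
  rw [IsLocalization.map_eq_zero_iff (hU.primeIdealOf ⟨y, hyU⟩).asIdeal.primeCompl] at h2
  obtain ⟨v, hv⟩ := h2
  have h3 : algebraMap Γ(Z, U) (Z.presheaf.stalk x) s = 0 := by
    rw [IsLocalization.map_eq_zero_iff (hU.primeIdealOf ⟨x, hxU⟩).asIdeal.primeCompl]
    exact ⟨⟨v, fun hh => v.2 (hle hh)⟩ * u, by rw [← hv]; simp [mul_assoc]⟩
  rw [h3] at hst
  exact (IsLocalization.map_units (Z.presheaf.stalk x) t).mul_left_eq_zero.1 hst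

lemma exists_closed_spec (Z : Scheme) [CompactSpace Z] (x : Z) : ∃ y, x ⤳ y ∧ IsClosed {y} := by
  obtain ⟨y, hy, hy'⟩ := IsClosed.exists_closed_singleton (isClosed_closure (s := {x}))
    (Set.singleton_nonempty x).closure
  exact ⟨y, specializes_iff_mem_closure.2 hy, hy'⟩

lemma isIntegral_of_stalks (Z : Scheme) [IsLocallyNoetherian Z] [CompactSpace Z] [ConnectedSpace Z]
    (h : ∀ x : Z, IsClosed {x} → IsDomain (Z.presheaf.stalk x)) : IsIntegral Z := by
  have hcl : ∀ x : Z, ∃ y, x ⤳ y ∧ IsClosed {y} := by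
    exact exists_closed_spec Z
  have : IsNoetherian Z := ⟨⟩
  have hred : IsReduced Z := by
    have : ∀ x : Z, _root_.IsReduced (Z.presheaf.stalk x) := by
      intro x
      obtain ⟨y, hxy, hy⟩ := hcl x
      have := h y hy
      exact isReduced_stalk_of_specializes Z hxy
    exact isReduced_of_isReduced_stalk Z
  have hfin := TopologicalSpace.NoetherianSpace.finite_irreducibleComponents (α := Z)
  have hdis : ∀ C ∈ irreducibleComponents Z, ∀ C' ∈ irreducibleComponents Z, (C ∩ C').Nonempty → C = C' := by
    rintro C hC C' hC' ⟨z, hz, hz'⟩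
    obtain ⟨y, hzy, hy⟩ := hcl z
    have := h y hy
    have hCc := isClosed_of_mem_irreducibleComponents C hC
    have hCc' := isClosed_of_mem_irreducibleComponents C' hC'
    have hyC : y ∈ C := hzy.mem_closed hCc hz
    have hyC' : y ∈ C' := hzy.mem_closed hCc' hz'
    let p : Z := Z.fromSpecStalk y (⊥ : PrimeSpectrum (Z.presheaf.stalk y))
    have key : ∀ D ∈ irreducibleComponents Z, y ∈ D → D = closure {p} := by
      intro D hD hyD
      have hirr : IsIrreducible D := hD.1
      have hDc := isClosed_of_mem_irreducibleComponents D hD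
      have hg := hirr.isGenericPoint_genericPoint hDc
      have h1 : hirr.genericPoint ⤳ y := hg.specializes hyD
      rw [← Set.mem_ofPred_eq (p := fun q : Z => q ⤳ y), ← Scheme.range_fromSpecStalk] at h1
      obtain ⟨q, hq⟩ := h1
      have h2 : p ⤳ hirr.genericPoint := by
        rw [← hq]
        refine Specializes.map ?_ (Scheme.Hom.continuous _)
        exact (PrimeSpectrum.le_iff_specializes _ _).1 bot_le
      have h3 : D ⊆ closure {p} := by
        rw [← hg.def]
        exact h2.closure_subset
      exact h3.antisymm (hD.2 isIrreducible_singleton.closure h3)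
    rw [key C hC hyC, key C' hC' hyC']
  obtain ⟨x0⟩ := (inferInstance : Nonempty Z)
  have hC := irreducibleComponent_mem_irreducibleComponents x0
  have hclopen : IsClopen (irreducibleComponent x0) := by
    refine ⟨isClosed_irreducibleComponent, ?_⟩
    rw [← isClosed_compl_iff]
    have : (irreducibleComponent x0)ᶜ = ⋃ C ∈ irreducibleComponents Z \ {irreducibleComponent x0}, C := by
      ext z
      simp only [Set.mem_compl_iff, Set.mem_iUnion, Set.mem_sdiff, Set.mem_singleton_iff]
      constructor
      · intro hz
        refine ⟨irreducibleComponent z, ⟨irreducibleComponent_mem_irreducibleComponents z, ?_⟩, mem_irreducibleComponent⟩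
        intro he
        exact hz (he ▸ mem_irreducibleComponent)
      · rintro ⟨C, ⟨hC1, hC2⟩, hz⟩ hz'
        exact hC2 (hdis _ hC1 _ hC ⟨z, hz, hz'⟩)
    rw [this]
    exact (hfin.subset Set.sdiff_subset).isClosed_biUnion fun C hC => isClosed_of_mem_irreducibleComponents C hC.1
  have huniv := hclopen.eq_univ ⟨x0, mem_irreducibleComponent⟩
  have : IrreducibleSpace Z := by
    have := isIrreducible_irreducibleComponent (x := x0)
    rw [huniv] at this
    exact irreducibleSpace_def .. |>.2 this
  exact isIntegral_of_irreducibleSpace_of_isReduced Z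

end St6

namespace St6

lemma trdeg_eq_one {k B K : Type} [Field k] [CommRing B] [IsDomain B] [Algebra k B] [Algebra.FiniteType k B]
    [Field K] [Algebra B K] [IsFractionRing B K] [Algebra k K] [IsScalarTower k B K]
    (h1 : Ring.KrullDimLE 1 B) (h0 : ¬ IsField B) : Algebra.trdeg k K = 1 := by
  obtain ⟨s, g, hinj, hint⟩ := exists_integral_inj_algHom_of_fg k B
  let P := MvPolynomial (Fin s) k
  algebraize [g.toRingHom]
  have : Algebra.IsIntegral P B := ⟨hint⟩
  have hs2 : s < 2 := by
    by_contra hs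
    push Not at hs
    rw [Ring.krullDimLE_one_iff_of_noZeroDivisors] at h1
    let i0 : Fin s := ⟨0, by omega⟩
    let i1 : Fin s := ⟨1, by omega⟩
    have hi : i1 ≠ i0 := by simp [i0, i1]
    let q1 : P →ₐ[k] P := MvPolynomial.aeval (fun i => if i = i0 then 0 else MvPolynomial.X i)
    let q2 : P →ₐ[k] P := MvPolynomial.aeval (fun i => if i = i1 then 0 else MvPolynomial.X i)
    have e1 : q1 (MvPolynomial.X i0) = 0 := (MvPolynomial.aeval_X _ _).trans (if_pos rfl)
    have e2 : q1 (MvPolynomial.X i1) = MvPolynomial.X i1 := (MvPolynomial.aeval_X _ _).trans (if_neg hi)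
    have e3 : q2 (MvPolynomial.X i1) = 0 := (MvPolynomial.aeval_X _ _).trans (if_pos rfl)
    let Q1 : Ideal P := RingHom.ker q1
    let Q2 : Ideal P := RingHom.ker (q2.comp q1)
    have hQ1 : Q1.IsPrime := RingHom.ker_isPrime _
    have hQ2 : Q2.IsPrime := RingHom.ker_isPrime _
    have hlt : Q1 < Q2 := by
      refine lt_of_le_of_ne (fun x hx => ?_) fun h => ?_
      · have hx : q1 x = 0 := hx
        change q2 (q1 x) = 0
        rw [hx, map_zero]
      · have : MvPolynomial.X i1 ∈ Q1 := by
          rw [h]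
          change q2 (q1 _) = 0
          rw [e2, e3]
        have h' : q1 (MvPolynomial.X i1) = 0 := this
        rw [e2] at h'
        exact MvPolynomial.X_ne_zero _ h'
    obtain ⟨p, -, hp, hpc⟩ := Ideal.exists_ideal_over_prime_of_isIntegral (S := B) Q1 ⊥ (by
      intro x hx
      have hx' : g x = 0 := hx
      have : x = 0 := hinj (by rw [hx', map_zero])
      rw [this]; exact zero_mem _)
    have hpm := h1 p (by
      rintro rfl
      have : MvPolynomial.X i0 ∈ (⊥ : Ideal B).comap (algebraMap P B) := by
        rw [hpc]; exact e1
      have h' : g (MvPolynomial.X i0) = 0 := this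
      exact MvPolynomial.X_ne_zero i0 (hinj (by rw [h', map_zero]))) hp
    have : Q1.IsMaximal := by
      rw [← hpc]
      exact Ideal.isMaximal_comap_of_isIntegral_of_isMaximal p
    exact hQ2.ne_top (this.1.2 _ hlt)
  have hs0 : s ≠ 0 := by
    rintro rfl
    apply h0
    exact isField_of_isIntegral_of_isField' (R := P) ((MvPolynomial.isEmptyAlgEquiv k (Fin 0)).toMulEquiv.isField (Field.toIsField k))
  obtain rfl : s = 1 := by omega
  let : Algebra P K := ((algebraMap B K).comp (algebraMap P B)).toAlgebra
  have : IsScalarTower P B K := .of_algebraMap_eq fun _ => rfl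
  have : IsScalarTower k P B := .of_algebraMap_eq fun c => (g.commutes c).symm
  have : IsScalarTower k P K := .of_algebraMap_eq fun c => by
    rw [IsScalarTower.algebraMap_apply P B K, ← IsScalarTower.algebraMap_apply k P B, ← IsScalarTower.algebraMap_apply k B K]
  have hf : FaithfulSMul P K := (faithfulSMul_iff_algebraMap_injective _ _).2
    ((IsFractionRing.injective B K).comp hinj)
  have : Algebra.IsAlgebraic B K := (IsFractionRing.comap_isAlgebraic_iff (A := B) (K := K) (C := K)).2 inferInstance
  have : FaithfulSMul P B := (faithfulSMul_iff_algebraMap_injective _ _).2 hinj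
  have hal : Algebra.IsAlgebraic P K := Algebra.IsAlgebraic.trans P B K
  have h5 := trdeg_add_eq k P (A := K)
  rw [← h5, trdeg_eq_zero (R := P) (A := K)]
  simp [P]

section der
variable {k K M : Type} [Field k] [CharZero k] [Field K] [Algebra k K] [AddCommGroup M] [Module K M] [Module k M] [IsScalarTower k K M]

lemma algebraic_over_adjoin {u : K} (hu : Transcendental k u) (htr : Algebra.trdeg k K = 1) :
    Algebra.IsAlgebraic (IntermediateField.adjoin k {u}) K := by
  have h1 : AlgebraicIndependent k (fun _ : Unit => u) := by
    rw [algebraicIndependent_unique_type_iff]; exact hu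
  have h2 := h1.isTranscendenceBasis_of_lift_trdeg_le_of_finite (by simpa using htr.le)
  have := h2.isAlgebraic_field
  rwa [Set.range_const] at this

lemma derivation_eq_zero {u : K} (hu : Transcendental k u) (htr : Algebra.trdeg k K = 1)
    (D : Derivation k K M) (h : D u = 0) : D = 0 := by
  have hal := algebraic_over_adjoin hu htr
  let F := IntermediateField.adjoin k {u}
  have : CharZero K := charZero_of_injective_algebraMap (algebraMap k K).injective
  have hF : ∀ c ∈ F, D c = 0 := by
    intro c hc
    induction hc using IntermediateField.adjoin_induction with
    | mem x hx => rw [Set.mem_singleton_iff.1 hx, h]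
    | algebraMap x => exact D.map_algebraMap x
    | add x y _ _ h1 h2 => rw [map_add, h1, h2, add_zero]
    | inv x _ h1 => rw [D.leibniz_inv, h1, smul_zero]
    | mul x y _ _ h1 h2 => rw [D.leibniz, h1, h2, smul_zero, smul_zero, add_zero]
  let : Module F M := Module.compHom M (algebraMap F K)
  have : IsScalarTower F K M := .of_algebraMap_smul fun _ _ => rfl
  let D' : Derivation F K M :=
    { toFun := D
      map_add' := D.map_add
      map_smul' := fun c x => by
        rw [Algebra.smul_def, D.leibniz]
        have : D (algebraMap F K c) = 0 := hF _ c.2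
        rw [this, smul_zero, add_zero]; rfl
      map_one_eq_zero' := D.map_one_eq_zero
      leibniz' := D.leibniz }
  ext x
  have hx : IsIntegral F x := (hal.isAlgebraic x).isIntegral
  have h1 := D'.map_aeval (minpoly F x) x
  rw [minpoly.aeval, map_zero] at h1
  have hsep : (minpoly F x).Separable := (minpoly.irreducible hx).separable
  exact (smul_eq_zero.1 h1.symm).resolve_left (hsep.aeval_derivative_ne_zero (minpoly.aeval _ _))

lemma exists_transcendental (htr : Algebra.trdeg k K = 1) : ∃ u : K, Transcendental k u := by
  by_contra h
  push Not at h
  have : Algebra.IsAlgebraic k K := ⟨fun x => by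
    have := h x
    rwa [Transcendental, not_not] at this⟩
  rw [trdeg_eq_zero] at htr
  exact zero_ne_one htr

/-- The module of derivations is at most one-dimensional. -/
lemma derivation_wronski {E : Type} [Field E] [Algebra K E] [Algebra k E] [IsScalarTower k K E]
    (htr : Algebra.trdeg k K = 1) (D D' : Derivation k K E) (a b : K) :
    D a * D' b = D b * D' a := by
  obtain ⟨u, hu⟩ := exists_transcendental htr
  have h0 : D u • D' - D' u • D = 0 := derivation_eq_zero hu htr _ (by simp [mul_comm])
  have h1 : ∀ x, D u * D' x = D' u * D x := fun x => by
    have := congr($h0 x)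
    simpa [sub_eq_zero] using this
  by_cases hD : D u = 0
  · have := derivation_eq_zero hu htr D hD
    rw [this]; simp
  · apply mul_left_cancel₀ hD
    linear_combination D a * h1 b - D b * h1 a

end der
variable {k : Type} [Field k] {X Y : OverR k}

lemma compactSpace_left [QuasiCompact X.hom] : CompactSpace X.left := by
  exact QuasiCompact.compactSpace_of_compactSpace X.hom

lemma stalk_tangentFamily [IsAlgClosed k] [Smooth X.hom] [LocallyOfFiniteType X.hom] (x : X.left) (hx : IsClosed {x}) :
    TangentFamily k (X.left.presheaf.stalk x) Set.univ := by
  have := stalk_formallySmooth x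
  exact tangentFamily_of_projective (resField_bijective x hx)

lemma isIntegral_of_smooth [IsAlgClosed k] [CharZero k] [Smooth X.hom] [QuasiCompact X.hom] [ConnectedSpace X.left] :
    IsIntegral X.left := by
  have := compactSpace_left (X := X)
  refine isIntegral_of_stalks _ fun x hx => ?_
  exact isDomain_of_tangentFamily (resField_bijective x hx) (stalk_tangentFamily x hx)

/-- basic structure of a curve -/
structure IsCurve (X : OverR k) : Prop where
  lft : LocallyOfFiniteType X.hom
  qc : QuasiCompact X.hom
  sep : IsSeparated X.hom
  int : IsIntegral X.left
  trdeg : Algebra.trdeg k (X.left.presheaf.stalk (genericPoint X.left)) = 1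
  dvr : ∀ x : X.left, IsClosed {x} → IsDomain (X.left.presheaf.stalk x) → IsDiscreteValuationRing (X.left.presheaf.stalk x)


lemma exists_ext_derivation {k R K E : Type} [Field k] [CommRing R] [Algebra k R] [Field K] [Algebra R K]
    [IsFractionRing R K] [Algebra k K] [IsScalarTower k R K] [Field E] [Algebra K E] [Algebra R E] [Algebra k E]
    [IsScalarTower R K E] [IsScalarTower k K E] [IsScalarTower k R E]
    (D : Derivation k R E) : ∃ D' : Derivation k K E, ∀ r, D' (algebraMap R K r) = D r := by
  have : Algebra.FormallyEtale R K := Algebra.FormallyEtale.of_isLocalization (nonZeroDivisors R)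
  let e := KaehlerDifferential.tensorKaehlerEquivOfFormallyEtale k R K
  let L : Ω[K⁄k] →ₗ[K] E := (LinearMap.liftBaseChange K D.liftKaehlerDifferential).comp e.symm.toLinearMap
  refine ⟨L.compDer (KaehlerDifferential.D k K), fun r => ?_⟩
  have h2 := KaehlerDifferential.tensorKaehlerEquivOfFormallyEtale_symm_D_algebraMap k R K r
  change (LinearMap.liftBaseChange K D.liftKaehlerDifferential) (e.symm (KaehlerDifferential.D k K (algebraMap R K r))) = _
  rw [h2]
  simp

lemma dvr_of_tangentFamily {k R K : Type} [Field k] [CharZero k] [CommRing R] [IsDomain R] [IsLocalRing R] [IsNoetherianRing R]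
    [Algebra k R] [Field K] [Algebra R K] [IsFractionRing R K] [Algebra k K] [IsScalarTower k R K]
    (hk : Function.Bijective (algebraMap k (IsLocalRing.ResidueField R)))
    (hT : TangentFamily k R Set.univ) (htr : Algebra.trdeg k K = 1) : IsDiscreteValuationRing R := by
  have hnf : ¬ IsField R := by
    intro hf
    have hm := IsLocalRing.isField_iff_maximalIdeal_eq.1 hf
    have h1 : ∀ r : R, algebraMap k R (resHom hk r) = r := fun r => by
      have := sub_resHom_mem hk r
      rw [hm, Ideal.mem_bot, sub_eq_zero] at this
      exact this.symm
    have : Algebra.IsAlgebraic k K := ⟨fun x => by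
      obtain ⟨a, b, hb, rfl⟩ := IsFractionRing.div_surjective (A := R) x
      rw [← h1 a, ← h1 b, ← IsScalarTower.algebraMap_apply, ← IsScalarTower.algebraMap_apply, ← map_div₀]
      exact isAlgebraic_algebraMap _⟩
    rw [trdeg_eq_zero] at htr
    exact zero_ne_one htr
  refine ((IsDiscreteValuationRing.TFAE R hnf).out 4 0).1 ?_
  obtain ⟨ι, _, x, D, hx, -, hD⟩ := exists_euler hk hT
  have hW : ∀ i j a b, D i a * D j b = D i b * D j a := by
    intro i j a b
    let Di : Derivation k R K := (Algebra.linearMap R K).compDer (D i)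
    let Dj : Derivation k R K := (Algebra.linearMap R K).compDer (D j)
    obtain ⟨E1, hE1⟩ := exists_ext_derivation (K := K) Di
    obtain ⟨E2, hE2⟩ := exists_ext_derivation (K := K) Dj
    have := derivation_wronski htr E1 E2 (algebraMap R K a) (algebraMap R K b)
    rw [hE1, hE1, hE2, hE2] at this
    change algebraMap R K _ * algebraMap R K _ = algebraMap R K _ * algebraMap R K _ at this
    rw [← map_mul, ← map_mul] at this
    exact IsFractionRing.injective R K this
  have hfg : (IsLocalRing.maximalIdeal R).FG := IsNoetherian.noetherian _
  have hnak : ∀ N : Ideal R, N ≤ IsLocalRing.maximalIdeal R →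
      IsLocalRing.maximalIdeal R ≤ N ⊔ IsLocalRing.maximalIdeal R ^ 2 → N = IsLocalRing.maximalIdeal R := by
    intro N h1 h2
    refine le_antisymm h1 ?_
    refine Submodule.le_of_le_smul_of_le_jacobson_bot hfg (IsLocalRing.maximalIdeal_le_jacobson _) ?_
    rw [smul_eq_mul, ← pow_two]
    exact h2
  by_cases h : ∃ i, ∃ w ∈ IsLocalRing.maximalIdeal R, IsUnit (D i w)
  · obtain ⟨i, w, hw, hu⟩ := h
    refine ⟨w, ?_⟩
    rw [← Ideal.span]
    symm
    apply hnak
    · rwa [Ideal.span_singleton_le_iff_mem]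
    · intro w' hw'
      obtain ⟨u, hu⟩ := hu
      let c : R := D i w' * ↑u⁻¹
      have h3 : ∀ j, D j w' = c * D j w := fun j => by
        have := hW i j w w'
        rw [← hu] at this
        calc D j w' = ↑u⁻¹ * (u * D j w') := by simp
          _ = _ := by rw [this]; ring
      have h4 : w' - c * w ∈ IsLocalRing.maximalIdeal R ^ 2 := by
        have e1 := hD w' hw'
        have e2 := Ideal.mul_mem_left _ c (hD w hw)
        have e3 : ∑ i, x i * D i w' = c * ∑ i, x i * D i w := by
          rw [Finset.mul_sum]
          refine Finset.sum_congr rfl fun j _ => ?_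
          rw [h3]; ring
        rw [e3] at e1
        have := sub_mem e2 e1
        convert! this using 1
        ring
      rw [Submodule.mem_sup]
      exact ⟨c * w, Ideal.mul_mem_left _ _ (Ideal.mem_span_singleton_self _), _, h4, by ring⟩
  · exfalso
    push Not at h
    apply hnf
    rw [IsLocalRing.isField_iff_maximalIdeal_eq]
    symm
    apply hnak _ bot_le
    intro w hw
    rw [bot_sup_eq]
    have e1 := hD w hw
    have e2 : ∑ i, x i * D i w ∈ IsLocalRing.maximalIdeal R ^ 2 := by
      refine Ideal.sum_mem _ fun i _ => ?_
      rw [pow_two]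
      exact Ideal.mul_mem_mul (hx i) ((IsLocalRing.mem_maximalIdeal _).2 (h i w hw))
    have := sub_mem e2 e1
    simpa using this

end St6

namespace St6
variable {k : Type} [Field k] {X Y : OverR k}

/-- structure map to sections -/
def kSec (X : OverR k) (U : X.left.Opens) : CommRingCat.of k ⟶ Γ(X.left, U) :=
  (Scheme.ΓSpecIso (CommRingCat.of k)).inv ≫ X.hom.appLE ⊤ U le_top

lemma sec_germ_aux {Z : Scheme} {R : CommRingCat} (f : Z ⟶ Spec R) (U : Z.Opens) (x : Z) (hx : x ∈ U) :
    Spec.map (((Scheme.ΓSpecIso R).inv ≫ f.appLE ⊤ U le_top) ≫ Z.presheaf.germ U x hx) =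
      Z.fromSpecStalk x ≫ f := by
  have h1 := Scheme.Opens.toSpecΓ_SpecMap_appLE f ⊤ U le_top
  have h2 : (⊤ : (Spec R).Opens).toSpecΓ ≫ Spec.map (Scheme.ΓSpecIso R).inv = (⊤ : (Spec R).Opens).ι := by
    rw [Scheme.Opens.toSpecΓ_top, Category.assoc, toSpecΓ_SpecMap_ΓSpecIso_inv, Category.comp_id]
  rw [Spec.map_comp, Spec.map_comp, ← Scheme.Opens.fromSpecStalkOfMem_toSpecΓ, Category.assoc,
    reassoc_of% h1, h2]
  refine (congrArg (U.fromSpecStalkOfMem x hx ≫ ·) (Scheme.Hom.resLE_comp_ι f le_top)).trans ?_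
  exact Scheme.Opens.fromSpecStalkOfMem_ι_assoc ..

lemma kSec_germ (U : X.left.Opens) (x : X.left) (hx : x ∈ U) :
    kSec X U ≫ X.left.presheaf.germ U x hx = kmap X x := by
  apply Spec.map_injective
  rw [kmap_spec]
  exact sec_germ_aux X.hom U x hx

lemma kSec_finiteType [LocallyOfFiniteType X.hom] (U : X.left.Opens) (hU : IsAffineOpen U) :
    (kSec X U).hom.FiniteType := by
  rw [kSec, CommRingCat.hom_comp]
  refine (Scheme.Hom.finiteType_appLE X.hom (isAffineOpen_top _) hU le_top).comp ?_
  apply RingHom.FiniteType.of_surjective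
  exact ((ConcreteCategory.isIso_iff_bijective (Scheme.ΓSpecIso (CommRingCat.of k)).inv).1 inferInstance).2

lemma trdeg_of_dim [LocallyOfFiniteType X.hom] [IsIntegral X.left] (hdim : topologicalKrullDim X.left = 1) :
    Algebra.trdeg k (X.left.presheaf.stalk (genericPoint X.left)) = 1 := by
  obtain ⟨_, ⟨U, hU, rfl⟩, hx, -⟩ := X.left.isBasis_affineOpens.exists_subset_of_mem_open
    (show genericPoint X.left ∈ (⊤ : X.left.Opens) from trivial) isOpen_univ
  replace hU : IsAffineOpen U := hU
  have : Nonempty U := ⟨⟨_, hx⟩⟩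
  let B := Γ(X.left, U)
  let : Algebra k B := (kSec X U).hom.toAlgebra
  have : Algebra.FiniteType k B := kSec_finiteType U hU
  have := functionField_isFractionRing_of_isAffineOpen X.left U hU
  let K := X.left.functionField
  let : Algebra k K := stalkAlg (genericPoint X.left)
  have : IsScalarTower k B K := .of_algebraMap_eq fun c => by
    have := kSec_germ U (genericPoint X.left) hx
    exact congr($(this.symm).hom c)
  have hd : ringKrullDim B ≤ 1 := by
    rw [← PrimeSpectrum.topologicalKrullDim_eq_ringKrullDim, ← hdim]
    exact (hU.fromSpec.isOpenEmbedding.isInducing).topologicalKrullDim_le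
  refine trdeg_eq_one (k := k) (B := B) (K := K) (Ring.krullDimLE_iff.2 hd) fun hf => ?_
  have hpt : Subsingleton U := by
    let := hf.toField
    have : Subsingleton (PrimeSpectrum B) := inferInstance
    exact hU.isoSpec.hom.homeomorph.toEquiv.subsingleton (α := U) (β := PrimeSpectrum B)
  have hc : IsClosed {genericPoint X.left} := by
    have : JacobsonSpace X.left := LocallyOfFiniteType.jacobsonSpace X.hom
    refine isClosed_singleton_of_isLocallyClosed_singleton ?_
    have : ({genericPoint X.left} : Set X.left) = U := by
      refine Set.eq_of_subset_of_subset (Set.singleton_subset_iff.2 hx) fun y hy => ?_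
      exact congrArg Subtype.val (Subsingleton.elim (α := U) ⟨y, hy⟩ ⟨_, hx⟩)
    rw [this]
    exact U.isOpen.isLocallyClosed
  have : Subsingleton X.left := by
    have h2 := (genericPoint_spec X.left)
    have h3 : closure {genericPoint X.left} = Set.univ := h2
    rw [hc.closure_eq] at h3
    exact ⟨fun a b => by
      have ha : a ∈ ({genericPoint X.left} : Set _) := h3 ▸ trivial
      have hb : b ∈ ({genericPoint X.left} : Set _) := h3 ▸ trivial
      rw [Set.mem_singleton_iff.1 ha, Set.mem_singleton_iff.1 hb]⟩
  have := topologicalKrullDim_zero_of_discreteTopology X.left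
  rw [hdim] at this
  exact absurd this (by decide)

lemma kTower (x : X.left) [IsIntegral X.left] :
    @IsScalarTower k (X.left.presheaf.stalk x) X.left.functionField _ _ (stalkAlg (genericPoint X.left)).toSMul :=
  let : Algebra k X.left.functionField := stalkAlg (genericPoint X.left)
  .of_algebraMap_eq fun c => congr($((kmap_specializes ((genericPoint_spec X.left).specializes trivial : genericPoint X.left ⤳ x)).symm).hom c)

lemma isCurve [IsAlgClosed k] [CharZero k] (hX : IsVarietyOver X) (hs : Smooth X.hom) (hc : ConnectedSpace X.left)
    (hdim : topologicalKrullDim X.left = 1) : IsCurve X := by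
  obtain ⟨h1, h2, h3⟩ := hX
  have h4 : IsIntegral X.left := isIntegral_of_smooth
  have h5 := trdeg_of_dim hdim
  refine ⟨h1, h2, h3, h4, h5, fun x hx _ => ?_⟩
  let : Algebra k X.left.functionField := stalkAlg (genericPoint X.left)
  have := kTower x
  exact dvr_of_tangentFamily (K := X.left.functionField) (resField_bijective x hx) (stalk_tangentFamily x hx) h5

end St6

namespace St6

lemma bij_of_val {R S : Type} [CommRing R] [IsDomain R] [ValuationRing R] [CommRing S] [IsDomain S]
    (f : R →+* S) [IsLocalHom f] (hf : Function.Injective f) (h : ∀ s, ∃ a b, b ≠ 0 ∧ f b * s = f a) :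
    Function.Bijective f := by
  refine ⟨hf, fun s => ?_⟩
  obtain ⟨a, b, hb, e⟩ := h s
  have hb' : f b ≠ 0 := fun h => hb (hf (by rw [h, map_zero]))
  obtain ⟨c, hc⟩ := ValuationRing.cond a b
  rcases hc with hc | hc
  · have ha : a ≠ 0 := by
      rintro rfl
      rw [zero_mul] at hc; exact hb hc.symm
    have ha' : f a ≠ 0 := fun h => ha (hf (by rw [h, map_zero]))
    have h1 : f c * s = 1 := by
      apply mul_left_cancel₀ ha'
      rw [← mul_assoc, ← map_mul, hc, e, mul_one]
    have : IsUnit c := isUnit_of_map_unit f c (IsUnit.of_mul_eq_one _ h1)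
    obtain ⟨u, rfl⟩ := this
    refine ⟨↑u⁻¹, ?_⟩
    calc f ↑u⁻¹ = f ↑u⁻¹ * (f u * s) := by rw [h1, mul_one]
      _ = s := by rw [← mul_assoc, ← map_mul]; simp
  · refine ⟨c, mul_left_cancel₀ hb' ?_⟩
    rw [e, ← map_mul, hc]

lemma exists_frac (Y : Scheme.{0}) [IsIntegral Y] {z y : Y} (hz : z = genericPoint Y) (h : z ⤳ y)
    (t : Y.presheaf.stalk z) : ∃ a b : Y.presheaf.stalk y, b ≠ 0 ∧
      (Y.presheaf.stalkSpecializes h).hom b * t = (Y.presheaf.stalkSpecializes h).hom a := by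
  subst hz
  obtain ⟨⟨a, b⟩, e⟩ := IsLocalization.surj (M := nonZeroDivisors (Y.presheaf.stalk y)) (S := Y.functionField) t
  refine ⟨a, b, nonZeroDivisors.ne_zero b.2, ?_⟩
  rw [mul_comm]
  exact e

lemma specializes_injective (Y : Scheme.{0}) [IsIntegral Y] {z y : Y} (hz : z = genericPoint Y) (h : z ⤳ y) :
    Function.Injective (Y.presheaf.stalkSpecializes h).hom := by
  subst hz
  exact IsFractionRing.injective (Y.presheaf.stalk y) Y.functionField

section
variable {X Y : Scheme.{0}} (g : X ⟶ Y) [IsIntegral X] [IsIntegral Y]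
   (hg : g (genericPoint X) = genericPoint Y)
include hg

lemma stalkMap_injective (x : X) : Function.Injective (g.stalkMap x).hom := by
  have hs : genericPoint X ⤳ x := (genericPoint_spec X).specializes trivial
  have hs' : g (genericPoint X) ⤳ g x := by rw [hg]; exact (genericPoint_spec Y).specializes trivial
  have h1 := Scheme.Hom.stalkSpecializes_stalkMap g _ _ hs
  have h2 : ∀ r, (g.stalkMap (genericPoint X)).hom ((Y.presheaf.stalkSpecializes hs').hom r) =
    (X.presheaf.stalkSpecializes hs).hom ((g.stalkMap x).hom r) := fun r => congr($(h1).hom r)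
  have h3 : Function.Injective (g.stalkMap (genericPoint X)).hom := by
    have : IsField (Y.presheaf.stalk (g (genericPoint X))) := by
      rw [hg]
      exact Field.toIsField Y.functionField
    let := this.toField
    exact RingHom.injective (R := Y.presheaf.stalk (g (genericPoint X))) _
  intro a b hab
  apply specializes_injective Y hg hs'
  apply h3
  rw [h2, h2, hab]

lemma stalkMap_bijective [hv : ∀ y : Y, ValuationRing (Y.presheaf.stalk y)]
   (hb : Function.Surjective (g.stalkMap (genericPoint X)).hom) (x : X) : Function.Bijective (g.stalkMap x).hom := by
  have hs : genericPoint X ⤳ x := (genericPoint_spec X).specializes trivial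
  have hs' : g (genericPoint X) ⤳ g x := by rw [hg]; exact (genericPoint_spec Y).specializes trivial
  have h1 := Scheme.Hom.stalkSpecializes_stalkMap g _ _ hs
  refine bij_of_val _ (stalkMap_injective g hg x) fun s => ?_
  obtain ⟨t, ht⟩ := hb ((X.presheaf.stalkSpecializes hs).hom s)
  obtain ⟨a, b, hb, e⟩ := exists_frac Y hg hs' t
  refine ⟨a, b, hb, specializes_injective X rfl hs ?_⟩
  have h2 : ∀ r, (g.stalkMap (genericPoint X)).hom ((Y.presheaf.stalkSpecializes hs').hom r) =
    (X.presheaf.stalkSpecializes hs).hom ((g.stalkMap x).hom r) := fun r => congr($(h1).hom r)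
  rw [map_mul, ← h2, ← ht, ← map_mul, e, h2]

lemma injective_of_val [hv : ∀ y : Y, ValuationRing (Y.presheaf.stalk y)] [IsSeparated g]
    (hb : Function.Surjective (g.stalkMap (genericPoint X)).hom) : Function.Injective g := by
  have hbij := stalkMap_bijective g hg hb
  have hI : ∀ x, IsIso (g.stalkMap x) := fun x => (ConcreteCategory.isIso_iff_bijective _).2 (hbij x)
  have key : ∀ x y (h : g (genericPoint X) ⤳ y), g x = y → ∃ α : Spec (Y.presheaf.stalk y) ⟶ X,
      α ≫ g = Y.fromSpecStalk y ∧ α (IsLocalRing.closedPoint _) = x ∧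
      Spec.map (Y.presheaf.stalkSpecializes h) ≫ α =
        inv (Spec.map (g.stalkMap (genericPoint X))) ≫ X.fromSpecStalk _ := by
    rintro x _ h rfl
    have hs : genericPoint X ⤳ x := (genericPoint_spec X).specializes trivial
    have h1 := Scheme.Hom.stalkSpecializes_stalkMap g _ _ hs
    refine ⟨inv (Spec.map (g.stalkMap x)) ≫ X.fromSpecStalk x, ?_, ?_, ?_⟩
    · rw [Category.assoc, IsIso.inv_comp_eq, Scheme.SpecMap_stalkMap_fromSpecStalk]
    · have : inv (Spec.map (g.stalkMap x)) (IsLocalRing.closedPoint (Y.presheaf.stalk (g x))) =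
          IsLocalRing.closedPoint (X.presheaf.stalk x) := by
        have h2 : Spec.map (g.stalkMap x) (IsLocalRing.closedPoint (X.presheaf.stalk x)) =
          IsLocalRing.closedPoint (Y.presheaf.stalk (g x)) := IsLocalRing.comap_closedPoint _
        rw [← h2]
        refine (Scheme.Hom.comp_apply _ _ _).symm.trans ?_
        rw [IsIso.hom_inv_id]; rfl
      refine (Scheme.Hom.comp_apply _ _ _).trans ?_
      exact (congrArg (X.fromSpecStalk x) this).trans Scheme.fromSpecStalk_closedPoint
    · rw [IsIso.eq_inv_comp, ← Scheme.SpecMap_stalkSpecializes_fromSpecStalk hs, ← Category.assoc, ← Category.assoc,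
        ← Spec.map_comp, h1, Spec.map_comp, Category.assoc, Category.assoc, IsIso.hom_inv_id_assoc]
  intro x x' hxx
  have hs' : g (genericPoint X) ⤳ g x := by rw [hg]; exact (genericPoint_spec Y).specializes trivial
  obtain ⟨α, a1, a2, a3⟩ := key x _ hs' rfl
  obtain ⟨β, b1, b2, b3⟩ := key x' _ hs' hxx.symm
  have : IsDominant (Spec.map (Y.presheaf.stalkSpecializes hs')) :=
    ⟨PrimeSpectrum.denseRange_comap_iff_ker_le_nilRadical _ |>.2 (by
      rw [(RingHom.injective_iff_ker_eq_bot _).1 (specializes_injective Y hg hs')]; exact bot_le)⟩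
  have : α = β := ext_of_isDominant_of_isSeparated g (a1.trans b1.symm) _ (a3.trans b3.symm)
  rw [← a2, ← b2, this]

lemma openImmersion_of_val [hv : ∀ y : Y, ValuationRing (Y.presheaf.stalk y)] [IsSeparated g]
    [IsLocallyNoetherian Y] [LocallyOfFiniteType g]
    (hb : Function.Surjective (g.stalkMap (genericPoint X)).hom) : IsOpenImmersion g := by
  have hbij := stalkMap_bijective g hg hb
  have : ∀ x, IsIso (g.stalkMap x) := fun x => (ConcreteCategory.isIso_iff_bijective _).2 (hbij x)
  have : Flat g := Flat.of_stalkMap g fun x => RingHom.Flat.of_bijective (hbij x)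
  have : LocallyOfFinitePresentation g := inferInstance
  refine IsOpenImmersion.of_isIso_stalkMap g ?_
  exact .of_continuous_injective_isOpenMap g.continuous (injective_of_val g hg hb) g.isOpenMap
end
end St6

namespace St6

lemma isDominant_generic (X : Scheme.{0}) [IsIntegral X] : IsDominant (X.fromSpecStalk (genericPoint X)) := by
  constructor
  have h1 : X.fromSpecStalk (genericPoint X) (IsLocalRing.closedPoint _) = genericPoint X :=
    Scheme.fromSpecStalk_closedPoint
  have h2 : Dense ({genericPoint X} : Set X) := dense_iff_closure_eq.mpr (genericPoint_spec X)
  refine h2.mono ?_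
  rintro _ rfl
  exact ⟨_, h1⟩

lemma partial_spec {X Y : Scheme.{0}} (f : X.PartialMap Y) {z x : X} (h : z ⤳ x) (hx : x ∈ f.domain) (hz : z ∈ f.domain) :
    Spec.map (X.presheaf.stalkSpecializes h) ≫ f.fromSpecStalkOfMem hx = f.fromSpecStalkOfMem hz := by
  unfold Scheme.PartialMap.fromSpecStalkOfMem
  rw [← Category.assoc]
  congr 1
  rw [← cancel_mono f.domain.ι]
  simp

lemma exists_morphism {X Y S : Scheme.{0}} (sX : X ⟶ S) (sY : Y ⟶ S) [S.IsSeparated] [Y.IsSeparated]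
    [IsIntegral X] [LocallyOfFiniteType sY] 
    (φ : Spec (X.presheaf.stalk (genericPoint X)) ⟶ Y)
    (h : ∀ x : X, ∃ ψ : Spec (X.presheaf.stalk x) ⟶ Y, ψ ≫ sY = X.fromSpecStalk x ≫ sX ∧
      Spec.map (X.presheaf.stalkSpecializes ((genericPoint_spec X).specializes (Set.mem_univ x))) ≫ ψ = φ) :
    ∃ g : X ⟶ Y, g ≫ sY = sX ∧ X.fromSpecStalk (genericPoint X) ≫ g = φ := by
  have hφ : φ ≫ sY = X.fromSpecStalk (genericPoint X) ≫ sX := by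
    obtain ⟨ψ, e1, e2⟩ := h (genericPoint X)
    rw [← e2, Category.assoc, e1, ← Category.assoc, Scheme.SpecMap_stalkSpecializes_fromSpecStalk]
  let r := Scheme.RationalMap.ofFunctionField sX sY φ hφ
  have hr : r.fromFunctionField = φ := Scheme.RationalMap.fromFunctionField_ofFunctionField _ _ _ _
  have hdom : r.domain = ⊤ := by
    rw [eq_top_iff]
    rintro x -
    rw [Scheme.RationalMap.mem_domain]
    obtain ⟨ψ, e1, e2⟩ := h x
    refine ⟨Scheme.PartialMap.ofFromSpecStalk sX sY ψ e1, Scheme.PartialMap.mem_domain_ofFromSpecStalk _ _ _ _, ?_⟩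
    apply Scheme.RationalMap.eq_of_fromFunctionField_eq
    rw [hr, ← e2, Scheme.RationalMap.fromFunctionField_toRationalMap]
    have := partial_spec (Scheme.PartialMap.ofFromSpecStalk sX sY ψ e1) 
      ((genericPoint_spec X).specializes (Set.mem_univ x)) (Scheme.PartialMap.mem_domain_ofFromSpecStalk _ _ _ _)
      (((genericPoint_spec X).specializes (Set.mem_univ x)).mem_open (Scheme.PartialMap.ofFromSpecStalk sX sY ψ e1).domain.2 (Scheme.PartialMap.mem_domain_ofFromSpecStalk _ _ _ _))
    rw [Scheme.PartialMap.fromSpecStalkOfMem_ofFromSpecStalk] at this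
    exact this.symm
  have hpf : r.toPartialMap.fromFunctionField = φ := by
    rw [← Scheme.RationalMap.fromFunctionField_toRationalMap, Scheme.RationalMap.toRationalMap_toPartialMap, hr]
  have hdom' : r.toPartialMap.domain = ⊤ := hdom
  have : IsIso r.toPartialMap.domain.ι := by
    rw [hdom']
    exact (inferInstance : IsIso X.topIso.hom)
  have hg : X.fromSpecStalk (genericPoint X) ≫ inv r.toPartialMap.domain.ι ≫ r.toPartialMap.hom = φ := by
    rw [← hpf]
    unfold Scheme.PartialMap.fromFunctionField Scheme.PartialMap.fromSpecStalkOfMem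
    rw [← Category.assoc]
    congr 1
    rw [← cancel_mono r.toPartialMap.domain.ι]
    simp
  refine ⟨inv r.toPartialMap.domain.ι ≫ r.toPartialMap.hom, ?_, hg⟩
  have := isDominant_generic X
  refine ext_of_isDominant (ι := X.fromSpecStalk (genericPoint X)) ?_
  rw [← Category.assoc, hg, hφ]


section curve
variable {k : Type} [Field k] {X Y : OverR k}

lemma IsCurve.generic_or_closed (hY : IsCurve Y) [IsIntegral Y.left] (y : Y.left) : y = genericPoint Y.left ∨ IsClosed {y} := by
  have := hY.qc
  have := hY.lft
  have := compactSpace_left (X := Y)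
  obtain ⟨z, hz, hzc⟩ := exists_closed_spec Y.left y
  have := hY.dvr z hzc inferInstance
  have hr := Scheme.range_fromSpecStalk (X := Y.left) (x := z)
  have hy : y ∈ Set.range (Y.left.fromSpecStalk z) := by rw [hr]; exact hz
  have hη : genericPoint Y.left ∈ Set.range (Y.left.fromSpecStalk z) := by
    rw [hr]; exact (genericPoint_spec Y.left).specializes (Set.mem_univ z)
  obtain ⟨p, rfl⟩ := hy
  obtain ⟨q, hq⟩ := hη
  by_cases hp : p.asIdeal = ⊥
  · left
    have h1 : p ⤳ q := by
      refine (PrimeSpectrum.le_iff_specializes p q).mp ?_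
      exact (PrimeSpectrum.asIdeal_le_asIdeal p q).mp (by rw [hp]; exact bot_le)
    have h2 := h1.map (Y.left.fromSpecStalk z).continuous
    rw [hq] at h2
    exact (h2.antisymm ((genericPoint_spec Y.left).specializes (Set.mem_univ _))).eq
  · right
    have : p.asIdeal.IsMaximal := Ring.DimensionLEOne.maximalOfPrime hp p.2
    have : p = IsLocalRing.closedPoint (Y.left.presheaf.stalk z) := by
      refine PrimeSpectrum.ext ?_
      exact IsLocalRing.eq_maximalIdeal this
    rw [this]
    erw [Scheme.fromSpecStalk_closedPoint]
    exact hzc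

lemma IsCurve.valuationRing (hY : IsCurve Y) [IsIntegral Y.left] (y : Y.left) : ValuationRing (Y.left.presheaf.stalk y) := by
  rcases hY.generic_or_closed y with rfl | h
  · exact ValuationRing.of_field Y.left.functionField
  · have := hY.dvr y h inferInstance
    infer_instance

lemma generic_of_stalk [IsAlgClosed k] (hY : IsCurve Y) [IsIntegral X.left] [IsIntegral Y.left] (g : X ⟶ Y)
    (t : Y.left.presheaf.stalk (g.left (genericPoint X.left)))
    (ht : ∀ c, stalkHom g (genericPoint X.left) t ≠ algebraMap k _ c) :
    g.left (genericPoint X.left) = genericPoint Y.left := by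
  have := hY.lft
  refine (hY.generic_or_closed _).resolve_right fun hc => ?_
  have hk := resField_bijective _ hc
  have h1 := sub_resHom_mem hk t
  apply ht (resHom hk t)
  have h2 : stalkHom g (genericPoint X.left) (t - algebraMap k _ (resHom hk t)) = 0 := by
    by_contra h
    have h3 : IsUnit (stalkHom g (genericPoint X.left) (t - algebraMap k _ (resHom hk t))) :=
      isUnit_iff_ne_zero (G₀ := X.left.functionField).2 h
    exact h1 (isUnit_of_map_unit (g.left.stalkMap (genericPoint X.left)).hom _ h3)
  rw [map_sub, AlgHom.commutes, sub_eq_zero] at h2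
  exact h2

lemma open_of_gen [IsAlgClosed k] [CharZero k] (hX : IsCurve X) (hY : IsCurve Y) [IsIntegral X.left] 
    (i : Spec (CommRingCat.of (Polynomial k)) ⟶ Y.left) [IsOpenImmersion i] (s : X.left.presheaf.stalk (genericPoint X.left))
    (hs : FieldGen k (F := X.left.functionField) s) (g : X ⟶ Y)
    (hg : X.left.fromSpecStalk (genericPoint X.left) ≫ g.left =
      Spec.map (CommRingCat.ofHom (Polynomial.aeval (R := k) s).toRingHom) ≫ i) : IsOpenImmersion g.left := by
  have := hX.lft
  have := hY.lft
  have := hX.sep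
  have := hY.int
  have hv := hY.valuationRing
  have h1 := Scheme.SpecMap_stalkMap_fromSpecStalk g.left (x := genericPoint X.left)
  have hr : Set.range (Y.left.fromSpecStalk (g.left (genericPoint X.left))) ⊆ Set.range i := by
    rw [Scheme.range_fromSpecStalk]
    intro z hz
    refine hz.mem_open i.isOpenEmbedding.isOpen_range ?_
    have h2 : (g.left) (X.left.fromSpecStalk (genericPoint X.left) (IsLocalRing.closedPoint _)) = 
      i (Spec.map (CommRingCat.ofHom (Polynomial.aeval (R := k) s).toRingHom) (IsLocalRing.closedPoint _)) := by
      refine (Scheme.Hom.comp_apply _ _ _).symm.trans (Eq.trans ?_ (Scheme.Hom.comp_apply _ _ _))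
      exact congr($hg _)
    rw [Scheme.fromSpecStalk_closedPoint] at h2
    exact ⟨_, h2.symm⟩
  obtain ⟨l, hl⟩ : ∃ l, Spec.map l ≫ i = Y.left.fromSpecStalk (g.left (genericPoint X.left)) := 
    ⟨Spec.preimage (IsOpenImmersion.lift i _ hr), by
      rw [Spec.map_preimage, IsOpenImmersion.lift_fac]⟩
  have hl2 : l ≫ g.left.stalkMap (genericPoint X.left) = CommRingCat.ofHom (Polynomial.aeval (R := k) s).toRingHom := by
    apply Spec.map_injective
    rw [← cancel_mono i, Spec.map_comp, Category.assoc, hl, h1, hg]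
  have hl3 : ∀ p : Polynomial k, stalkHom g (genericPoint X.left) (l.hom p) = Polynomial.aeval (R := k) s p := 
    fun p => congr($(hl2).hom p)
  have hsurj : Function.Surjective (stalkHom g (genericPoint X.left)) := by
    intro f
    obtain ⟨p, q, hq, rfl⟩ := hs f
    have h3 : IsUnit (stalkHom g (genericPoint X.left) (l.hom q)) := by
      rw [hl3]
      exact isUnit_iff_ne_zero (G₀ := X.left.functionField).2 hq
    obtain ⟨u, hu⟩ := isUnit_of_map_unit (g.left.stalkMap (genericPoint X.left)).hom _ h3
    refine ⟨l.hom p * ↑u⁻¹, ?_⟩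
    rw [eq_div_iff hq, ← hl3, ← hl3, ← hu, ← map_mul, mul_assoc, Units.inv_mul, mul_one]
  have hgen : g.left (genericPoint X.left) = genericPoint Y.left := by
    obtain ⟨u, hu⟩ := exists_transcendental (K := X.left.functionField) hX.trdeg
    obtain ⟨t, ht⟩ := hsurj u
    refine generic_of_stalk hY g t fun c hc => ?_
    rw [ht] at hc
    exact hu (hc ▸ isAlgebraic_algebraMap c)
  have hsg : IsSeparated g.left := by
    have : IsSeparated (g.left ≫ Y.hom) := by rw [Over.w]; infer_instance
    exact IsSeparated.of_comp g.left Y.hom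
  have hlg : LocallyOfFiniteType g.left := by
    have : LocallyOfFiniteType (g.left ≫ Y.hom) := by rw [Over.w]; infer_instance
    exact locallyOfFiniteType_of_comp g.left Y.hom
  exact openImmersion_of_val g.left hgen hsurj

end curve
end St6

namespace St6
variable {k : Type} [Field k]
lemma a1_smooth : Smooth (A1O k).hom := by
  have : Algebra.Smooth k (Polynomial k) := ⟨inferInstance, inferInstance⟩
  have : RingHom.Smooth (algebraMap k (Polynomial k)) := by
    rw [RingHom.smooth_algebraMap]; infer_instance
  exact (HasRingHomProperty.Spec_iff (P := @Smooth)).2 this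
lemma a1_dim : topologicalKrullDim (A1O k).left = 1 := by
  refine (PrimeSpectrum.topologicalKrullDim_eq_ringKrullDim (Polynomial k)).trans ?_
  rw [Polynomial.ringKrullDim_of_isNoetherianRing, ringKrullDim_eq_zero_of_field]; rfl
lemma a1_curve [IsAlgClosed k] [CharZero k] : IsCurve (A1O k) := by
  have : IsIntegral (Spec (CommRingCat.of (Polynomial k))) := inferInstance
  have hc : ConnectedSpace (A1O k).left := inferInstanceAs (ConnectedSpace (PrimeSpectrum (Polynomial k)))
  have := a1_smooth (k := k)
  refine isCurve ⟨inferInstance, ?_, ?_⟩ a1_smooth hc a1_dim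
  · exact (inferInstance : QuasiCompact (Spec.map (CommRingCat.ofHom (algebraMap k (Polynomial k)))))
  · exact (inferInstance : IsSeparated (Spec.map (CommRingCat.ofHom (algebraMap k (Polynomial k)))))

section P1
open MvPolynomial HomogeneousLocalization

lemma aeval_scale {R : Type} [CommRing R] [Algebra k R] (x : Fin 2 → R) (l : R) {n : ℕ} {a : MvPolynomial (Fin 2) k}
    (ha : a ∈ homogeneousSubmodule (Fin 2) k n) : aeval (fun i => l * x i) a = l ^ n * aeval x a := by
  rw [aeval_def, aeval_def, eval₂_eq', eval₂_eq', Finset.mul_sum]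
  refine Finset.sum_congr rfl fun d hd => ?_
  have h1 := (mem_homogeneousSubmodule _ _).1 ha (mem_support_iff.1 hd)
  have h2 : d 0 + d 1 = n := by
    rw [← h1, Finsupp.weight_apply, Finsupp.sum_fintype _ _ (by simp)]
    simp
  rw [Fin.prod_univ_two, Fin.prod_univ_two, ← h2]
  ring

variable {R : Type} [CommRing R] [Algebra k R]

/-- evaluation of a degree zero fraction -/
def ev (f : MvPolynomial (Fin 2) k) (x : Fin 2 → R) (hf : IsUnit (aeval x f)) :
    Away (homogeneousSubmodule (Fin 2) k) f →+* R :=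
  (Localization.awayLift (aeval x).toRingHom f hf).comp 
    (algebraMap (Away (homogeneousSubmodule (Fin 2) k) f) (Localization.Away f))

lemma ev_mk (f : MvPolynomial (Fin 2) k) (x : Fin 2 → R) (hf : IsUnit (aeval x f)) {d : ℕ}
    (hd : f ∈ homogeneousSubmodule (Fin 2) k d) (n : ℕ) (a : MvPolynomial (Fin 2) k) 
    (ha : a ∈ homogeneousSubmodule (Fin 2) k (n • d)) :
    (aeval x f) ^ n * ev f x hf (Away.mk _ hd n a ha) = aeval x a := by
  have h1 : ev f x hf (Away.mk _ hd n a ha) = 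
    Localization.awayLift (aeval x).toRingHom f hf (Localization.mk a ⟨f ^ n, by use n⟩) := rfl
  have h2 : Localization.awayLift (aeval x).toRingHom f hf (algebraMap _ _ (f ^ n)) = aeval x f ^ n := by
    rw [Localization.awayLift, IsLocalization.Away.lift_eq]; simp
  have h3 : algebraMap _ (Localization.Away f) (f ^ n) * Localization.mk a ⟨f ^ n, by use n⟩ = 
      algebraMap (MvPolynomial (Fin 2) k) (Localization.Away f) a := by
    rw [Localization.mk_eq_mk']
    exact IsLocalization.mk'_spec' (M := Submonoid.powers f) (Localization.Away f) a ⟨f ^ n, by use n⟩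
  rw [h1, ← h2, ← map_mul, h3, Localization.awayLift, IsLocalization.Away.lift_eq]
  rfl

lemma ev_zero (f : MvPolynomial (Fin 2) k) (x : Fin 2 → R) (hf : IsUnit (aeval x f)) (c : k) :
    ev f x hf (fromZeroRingHom _ _ (algebraMap k ↥(homogeneousSubmodule (Fin 2) k 0) c)) = algebraMap k R c := by
  have h1 : ev f x hf (fromZeroRingHom _ _ (algebraMap k ↥(homogeneousSubmodule (Fin 2) k 0) c)) = 
    Localization.awayLift (aeval x).toRingHom f hf (algebraMap _ _ (algebraMap k (MvPolynomial (Fin 2) k) c)) := rfl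
  rw [h1, Localization.awayLift, IsLocalization.Away.lift_eq]
  exact (aeval x).commutes c

lemma ev_ext {f : MvPolynomial (Fin 2) k} {x : Fin 2 → R} (hf : IsUnit (aeval x f)) {d : ℕ}
    (hd : f ∈ homogeneousSubmodule (Fin 2) k d) (h : Away (homogeneousSubmodule (Fin 2) k) f →+* R)
    (H : ∀ n a ha, (aeval x f) ^ n * h (Away.mk _ hd n a ha) = aeval x a) : h = ev f x hf := by
  ext z
  obtain ⟨n, a, ha, rfl⟩ := Away.mk_surjective _ hd z
  apply (hf.pow n).mul_left_cancel
  rw [H, ev_mk]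

lemma ev_natural {S : Type} [CommRing S] [Algebra k S] (φ : R →ₐ[k] S) {f : MvPolynomial (Fin 2) k} {x : Fin 2 → R}
    (hf : IsUnit (aeval x f)) {d : ℕ} (hd : f ∈ homogeneousSubmodule (Fin 2) k d)
    (hf' : IsUnit (aeval (fun i => φ (x i)) f)) :
    φ.toRingHom.comp (ev f x hf) = ev f (fun i => φ (x i)) hf' := by
  have h1 : ∀ a, aeval (fun i => φ (x i)) a = φ (aeval x a) := fun a => by
    rw [← AlgHom.comp_apply, comp_aeval]
  refine ev_ext _ hd _ fun n a ha => ?_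
  rw [h1, h1, ← ev_mk f x hf hd n a ha, map_mul, map_pow]
  rfl

lemma ev_scale {f : MvPolynomial (Fin 2) k} {x : Fin 2 → R} (l : R)
    (hf : IsUnit (aeval x f)) {d : ℕ} (hd : f ∈ homogeneousSubmodule (Fin 2) k d)
    (hf' : IsUnit (aeval (fun i => l * x i) f)) :
    ev f x hf = ev f (fun i => l * x i) hf' := by
  refine ev_ext _ hd _ fun n a ha => ?_
  rw [aeval_scale x l hd, aeval_scale x l ha, ← ev_mk f x hf hd n a ha]
  rw [mul_pow, ← pow_mul, smul_eq_mul, mul_comm d n, mul_assoc]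

lemma ev_awayMap {f g p : MvPolynomial (Fin 2) k} {x : Fin 2 → R} 
    (hf : IsUnit (aeval x f)) {d e : ℕ} (hd : f ∈ homogeneousSubmodule (Fin 2) k d)
    (hg : g ∈ homogeneousSubmodule (Fin 2) k e) (hp : p = f * g)
    (hf' : IsUnit (aeval x p)) :
    (ev p x hf').comp (awayMap _ hg hp) = ev f x hf := by
  refine ev_ext _ hd _ fun n a ha => ?_
  rw [RingHom.comp_apply, awayMap_mk]
  have hpd : p ∈ homogeneousSubmodule (Fin 2) k (d + e) := hp ▸ SetLike.mul_mem_graded hd hg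
  have h1 := ev_mk p x hf' hpd n (a * g ^ n) (by rw [smul_add]; exact SetLike.mul_mem_graded ha (SetLike.pow_mem_graded n hg))
  have hgu : IsUnit (aeval x g) := by
    rw [hp, map_mul] at hf'
    exact isUnit_of_mul_isUnit_right hf'
  apply (hgu.pow n).mul_left_cancel
  have h2 : aeval x g * aeval x f = aeval x p := by rw [hp, map_mul, mul_comm]
  rw [← mul_assoc, ← mul_pow, h2]
  refine h1.trans ?_
  rw [map_mul, map_pow, mul_comm]

/-- a point of P1 with given homogeneous coordinates -/
def pointO (f : MvPolynomial (Fin 2) k) (x : Fin 2 → R) (hf : IsUnit (aeval x f)) 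
    (hd : f ∈ homogeneousSubmodule (Fin 2) k 1) :
    Spec (CommRingCat.of R) ⟶ Proj (homogeneousSubmodule (Fin 2) k) :=
  Spec.map (CommRingCat.ofHom (ev f x hf)) ≫ Proj.awayι (homogeneousSubmodule (Fin 2) k) f hd one_pos

lemma pointO_indep {f g : MvPolynomial (Fin 2) k} {x : Fin 2 → R} (hf : IsUnit (aeval x f)) 
    (hd : f ∈ homogeneousSubmodule (Fin 2) k 1) (hg : IsUnit (aeval x g)) 
    (he : g ∈ homogeneousSubmodule (Fin 2) k 1) : pointO f x hf hd = pointO g x hg he := by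
  have hu : IsUnit (aeval x (f * g)) := by rw [map_mul]; exact hf.mul hg
  unfold pointO
  rw [← ev_awayMap hf hd he rfl hu, ← ev_awayMap hg he hd (mul_comm f g) hu, CommRingCat.ofHom_comp, CommRingCat.ofHom_comp,
    Spec.map_comp, Spec.map_comp, Category.assoc, Category.assoc, Proj.SpecMap_awayMap_awayι, Proj.SpecMap_awayMap_awayι]

lemma pointO_hom {f : MvPolynomial (Fin 2) k} {x : Fin 2 → R} (hf : IsUnit (aeval x f)) 
    (hd : f ∈ homogeneousSubmodule (Fin 2) k 1) :
    pointO f x hf hd ≫ Proj.toSpecZero (MvPolynomial.homogeneousSubmodule (Fin 2) k) ≫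
    Spec.map (CommRingCat.ofHom (algebraMap k ↥(MvPolynomial.homogeneousSubmodule (Fin 2) k 0))) = Spec.map (CommRingCat.ofHom (algebraMap k R)) := by
  unfold pointO
  rw [Category.assoc, Proj.awayι_toSpecZero_assoc, ← Spec.map_comp, ← Spec.map_comp]
  congr 1
  ext c
  exact ev_zero f x hf c

/-- coordinates of a chart -/
def chartC (j : Fin 2) (t : R) : Fin 2 → R := fun i => if i = j then 1 else t

lemma chartC_unit (j : Fin 2) (t : R) : IsUnit (aeval (R := k) (chartC j t) (X j)) := by
  rw [aeval_X]; simp [chartC]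

lemma X_mem (j : Fin 2) : (X j : MvPolynomial (Fin 2) k) ∈ homogeneousSubmodule (Fin 2) k 1 := isHomogeneous_X _ _

/-- the two charts -/
def chart (j : Fin 2) : Spec (CommRingCat.of (Polynomial k)) ⟶ Proj (homogeneousSubmodule (Fin 2) k) :=
  pointO (X j) (chartC j Polynomial.X) (chartC_unit j _) (X_mem j)

/-- the two charts -/
def chartO (j : Fin 2) : A1O k ⟶ P1 k := Over.homMk (chart j) (pointO_hom _ _)

lemma chart_pt (j : Fin 2) (t : R) : Spec.map (CommRingCat.ofHom (Polynomial.aeval (R := k) t).toRingHom) ≫ chart j =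
    pointO (X j) (chartC j t) (chartC_unit j t) (X_mem j) := by
  unfold chart pointO
  rw [← Category.assoc, ← Spec.map_comp, ← CommRingCat.ofHom_comp]
  have h1 : (fun i => Polynomial.aeval (R := k) t (chartC j Polynomial.X i)) = chartC j t := by
    ext i; unfold chartC; split_ifs <;> simp
  have h2 := ev_natural (Polynomial.aeval (R := k) t) (chartC_unit j Polynomial.X) (X_mem j) (by rw [h1]; exact chartC_unit j t)
  rw [h2]
  congr 3
  simp only [h1]

lemma chart_glue (t u : R) (h : t * u = 1) : 
    Spec.map (CommRingCat.ofHom (Polynomial.aeval (R := k) t).toRingHom) ≫ chart 0 = 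
    Spec.map (CommRingCat.ofHom (Polynomial.aeval (R := k) u).toRingHom) ≫ chart 1 := by
  rw [chart_pt, chart_pt]
  have h0 : IsUnit (aeval (R := k) (chartC 1 u) (X 0)) := by
    rw [aeval_X]; simp [chartC]; exact IsUnit.of_mul_eq_one_right _ h
  rw [pointO_indep (chartC_unit 1 u) (X_mem 1) h0 (X_mem 0)]
  unfold pointO
  have h1 : (fun i => u * chartC 0 t i) = chartC 1 u := by
    ext i; unfold chartC; fin_cases i <;> simp [h, mul_comm]
  rw [ev_scale u (chartC_unit 0 t) (X_mem 0) (by rw [h1]; exact h0)]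
  congr 3
  simp only [h1]

end P1
end St6

namespace St6
variable {k : Type} [Field k]
section P1
open MvPolynomial HomogeneousLocalization

lemma ev_bijective (j : Fin 2) : Function.Bijective
    (ev (X j) (chartC j Polynomial.X) (chartC_unit j _) : Away (homogeneousSubmodule (Fin 2) k) (X j) →+* Polynomial k) := by
  have h1 : aeval (R := k) (chartC j (Polynomial.X : Polynomial k)) (X j) = 1 := by
    rw [aeval_X]; simp [chartC]
  have h2 : ∀ n a ha, ev (X j) (chartC j (Polynomial.X : Polynomial k)) (chartC_unit j _) (Away.mk _ (X_mem j) n a ha) = 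
      aeval (R := k) (chartC j (Polynomial.X : Polynomial k)) a := fun n a ha => by
    rw [← ev_mk _ _ (chartC_unit j _) (X_mem j) n a ha, h1, one_pow, one_mul]
  constructor
  · rw [injective_iff_map_eq_zero]
    intro z hz
    obtain ⟨n, a, ha, rfl⟩ := Away.mk_surjective _ (X_mem j) z
    rw [h2] at hz
    apply HomogeneousLocalization.val_injective
    rw [Away.val_mk]
    have hXu : IsUnit (algebraMap (MvPolynomial (Fin 2) k) (Localization.Away (X j : MvPolynomial (Fin 2) k)) (X j)) :=
      IsLocalization.Away.algebraMap_isUnit _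
    obtain ⟨u, hu⟩ := hXu
    let j' : Fin 2 := 1 - j
    let t := algebraMap (MvPolynomial (Fin 2) k) (Localization.Away (X j : MvPolynomial (Fin 2) k)) (X j') * ↑u⁻¹
    have h3 : Polynomial.aeval (R := k) t (aeval (R := k) (chartC j (Polynomial.X : Polynomial k)) a) = 0 := by
      rw [hz, map_zero]
    rw [← AlgHom.comp_apply, comp_aeval] at h3
    have h4 := aeval_scale (fun i => Polynomial.aeval (R := k) t (chartC j (Polynomial.X : Polynomial k) i)) (u : Localization.Away (X j : MvPolynomial (Fin 2) k)) ha
    rw [h3, mul_zero] at h4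
    have h5 : (fun i => ↑u * Polynomial.aeval (R := k) t (chartC j (Polynomial.X : Polynomial k) i)) = fun i =>
      algebraMap (MvPolynomial (Fin 2) k) (Localization.Away (X j : MvPolynomial (Fin 2) k)) (X i) := by
      ext i
      unfold chartC
      split_ifs with h
      · rw [h, map_one, mul_one, hu]
      · rw [Polynomial.aeval_X]
        have : i = j' := by
          show i = 1 - j
          fin_cases i <;> fin_cases j <;> simp_all
        rw [this, mul_comm, mul_assoc, Units.inv_mul, mul_one]
    rw [h5] at h4
    have h6 : aeval (R := k) (fun i => algebraMap (MvPolynomial (Fin 2) k) (Localization.Away (X j : MvPolynomial (Fin 2) k)) (X i)) a =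
      algebraMap (MvPolynomial (Fin 2) k) (Localization.Away (X j : MvPolynomial (Fin 2) k)) a := by
      have : aeval (R := k) (fun i => algebraMap (MvPolynomial (Fin 2) k) (Localization.Away (X j : MvPolynomial (Fin 2) k)) (X i)) = 
        IsScalarTower.toAlgHom k (MvPolynomial (Fin 2) k) (Localization.Away (X j : MvPolynomial (Fin 2) k)) := by
        apply MvPolynomial.algHom_ext
        intro i
        rw [aeval_X]; rfl
      rw [this]; rfl
    rw [h6] at h4
    rw [Localization.mk_eq_mk', HomogeneousLocalization.val_zero]
    exact (IsLocalization.mk'_eq_zero_iff _ _).2 ((IsLocalization.map_eq_zero_iff (Submonoid.powers (X j : MvPolynomial (Fin 2) k)) _ _).1 h4)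
  · intro p
    let j' : Fin 2 := 1 - j
    have hj : j' ≠ j := by show 1 - j ≠ j; fin_cases j <;> simp
    induction p using Polynomial.induction_on with
    | C c => exact ⟨_, ev_zero _ _ _ c⟩
    | add p q hp hq => 
      obtain ⟨a, ha⟩ := hp
      obtain ⟨b, hb⟩ := hq
      exact ⟨a + b, by rw [map_add, ha, hb]⟩
    | monomial n c hp => 
      obtain ⟨a, ha⟩ := hp
      refine ⟨a * Away.mk _ (X_mem j) 1 (X j') (X_mem j'), ?_⟩
      rw [map_mul, ha, h2, aeval_X]
      simp [chartC, hj, pow_succ, mul_assoc]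

instance chart_open (j : Fin 2) : IsOpenImmersion (chart (k := k) j) := by
  unfold chart pointO
  have : IsIso (CommRingCat.ofHom (ev (X j) (chartC j Polynomial.X) (chartC_unit j _) : Away (homogeneousSubmodule (Fin 2) k) (X j) →+* Polynomial k)) :=
    (ConcreteCategory.isIso_iff_bijective _).2 (ev_bijective j)
  infer_instance

lemma chart_range (j : Fin 2) : (chart (k := k) j).opensRange = Proj.basicOpen (homogeneousSubmodule (Fin 2) k) (X j) := by
  unfold chart pointO
  have : IsIso (CommRingCat.ofHom (ev (X j) (chartC j Polynomial.X) (chartC_unit j _) : Away (homogeneousSubmodule (Fin 2) k) (X j) →+* Polynomial k)) :=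
    (ConcreteCategory.isIso_iff_bijective _).2 (ev_bijective j)
  refine (Scheme.Hom.opensRange_comp_of_isIso _ _).trans ?_
  exact Proj.opensRange_awayι ..

lemma adjoin_top : Algebra.adjoin ↥(homogeneousSubmodule (Fin 2) k 0) (Set.range (X : Fin 2 → MvPolynomial (Fin 2) k)) = ⊤ := by
  rw [eq_top_iff]
  rintro p -
  induction p using MvPolynomial.induction_on with
  | C c => exact Subalgebra.algebraMap_mem _ (⟨C c, isHomogeneous_C _ _⟩ : ↥(homogeneousSubmodule (Fin 2) k 0))
  | add p q hp hq => exact add_mem hp hq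
  | mul_X p n hp => exact mul_mem hp (Algebra.subset_adjoin ⟨n, rfl⟩)

lemma chart_cover (y : Proj (homogeneousSubmodule (Fin 2) k)) : ∃ j z, chart (k := k) j z = y := by
  have h1 := Proj.iSup_basicOpen_eq_top' (homogeneousSubmodule (Fin 2) k) X (fun i => ⟨1, X_mem i⟩) adjoin_top
  have h2 : y ∈ (⨆ i, Proj.basicOpen (homogeneousSubmodule (Fin 2) k) (X i)) := by rw [h1]; trivial
  obtain ⟨j, hj⟩ := TopologicalSpace.Opens.mem_iSup.1 h2
  rw [← chart_range] at hj
  exact ⟨j, hj⟩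

lemma p1_proper : IsProper (P1 k).hom := by
  have : Algebra.FiniteType ↥(homogeneousSubmodule (Fin 2) k 0) (MvPolynomial (Fin 2) k) := 
    ⟨⟨(Set.finite_range X).toFinset, by rw [Set.Finite.coe_toFinset]; exact adjoin_top⟩⟩
  have : IsIso (CommRingCat.ofHom (algebraMap k ↥(homogeneousSubmodule (Fin 2) k 0))) := by
    refine (ConcreteCategory.isIso_iff_bijective _).2 ⟨?_, ?_⟩
    · intro a b h
      exact C_injective (Fin 2) k congr(($h).1)
    rintro ⟨p, hp⟩
    have h1 := totalDegree_eq_zero_iff_eq_C.1 ((totalDegree_zero_iff_isHomogeneous _).2 hp)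
    exact ⟨coeff 0 p, Subtype.ext h1.symm⟩
  unfold P1
  exact (inferInstance : IsProper (Proj.toSpecZero (homogeneousSubmodule (Fin 2) k) ≫ Spec.map (CommRingCat.ofHom (algebraMap k ↥(homogeneousSubmodule (Fin 2) k 0)))))


instance chartO_open (j : Fin 2) : IsOpenImmersion (chartO (k := k) j).left := chart_open j

lemma chartO_cover (y : (P1 k).left) : ∃ j z, (chartO (k := k) j).left z = y := chart_cover y

/-- the open cover of P1 by the two charts -/
def chartCover : (P1 k).left.OpenCover :=
  Scheme.Cover.mkOfCovers (Fin 2) (fun _ => (A1O k).left) (fun j => (chartO (k := k) j).left)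
    chartO_cover (fun j => chartO_open j)

lemma p1_smooth : Smooth (P1 k).hom := by
  have hL : IsZariskiLocalAtSource.{0} @Smooth := HasRingHomProperty.instIsZariskiLocalAtSource (Q := RingHom.Smooth)
  rw [IsZariskiLocalAtSource.iff_of_openCover (P := @Smooth) chartCover]
  intro j
  have : (chartO (k := k) j).left ≫ (P1 k).hom = (A1O k).hom := Over.w _
  change Smooth ((chartO (k := k) j).left ≫ (P1 k).hom)
  rw [this]
  exact a1_smooth

lemma p1_connected : ConnectedSpace (P1 k).left := by
  have hc : ConnectedSpace (A1O k).left := inferInstanceAs (ConnectedSpace (PrimeSpectrum (Polynomial k)))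
  have h1 : ∀ j, _root_.IsConnected (Set.range (chartO (k := k) j).left) := fun j =>
    isConnected_range (chartO (k := k) j).left.continuous
  have h2 := chart_glue (k := k) (1 : k) 1 (one_mul 1)
  have h3 : Nonempty (Set.range (chartO (k := k) 0).left ∩ Set.range (chartO (k := k) 1).left : Set _) := by
    let z : Spec (CommRingCat.of k) := IsLocalRing.closedPoint k
    refine ⟨chart 0 (Spec.map (CommRingCat.ofHom (Polynomial.aeval (R := k) (1 : k)).toRingHom) z), ⟨_, rfl⟩, 
      Spec.map (CommRingCat.ofHom (Polynomial.aeval (R := k) (1 : k)).toRingHom) z, ?_⟩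
    refine (Scheme.Hom.comp_apply _ _ _).symm.trans (Eq.trans ?_ (Scheme.Hom.comp_apply _ _ _))
    exact congr($h2 z).symm
  have h4 := IsConnected.union (Set.nonempty_coe_sort.1 h3) (h1 0) (h1 1)
  rw [connectedSpace_iff_univ]
  convert h4
  symm
  rw [Set.eq_univ_iff_forall]
  intro y
  obtain ⟨j, z, rfl⟩ := chartO_cover y
  fin_cases j
  · exact Or.inl ⟨z, rfl⟩
  · exact Or.inr ⟨z, rfl⟩

end P1

lemma trdeg_congr {K L : Type} [CommRing K] [CommRing L] [Algebra k K] [Algebra k L] (e : K ≃ₐ[k] L) :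
    Algebra.trdeg k K = Algebra.trdeg k L := by
  exact e.trdeg_eq

lemma isCurve_of_trdeg [IsAlgClosed k] [CharZero k] {X : OverR k} (hX : IsVarietyOver X) (hs : Smooth X.hom) (hc : ConnectedSpace X.left)
    [IsIntegral X.left]
    (h5 : Algebra.trdeg k (X.left.presheaf.stalk (genericPoint X.left)) = 1) : IsCurve X := by
  obtain ⟨h1, h2, h3⟩ := hX
  refine ⟨h1, h2, h3, inferInstance, h5, fun x hx _ => ?_⟩
  let : Algebra k X.left.functionField := stalkAlg (genericPoint X.left)
  have := kTower x
  exact dvr_of_tangentFamily (K := X.left.functionField) (resField_bijective x hx) (stalk_tangentFamily x hx) h5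

lemma trdeg_open {X Y : OverR k} (f : X ⟶ Y) [IsOpenImmersion f.left] [IsIntegral X.left] [IsIntegral Y.left]
    (hX : Algebra.trdeg k (X.left.presheaf.stalk (genericPoint X.left)) = 1) :
    Algebra.trdeg k (Y.left.presheaf.stalk (genericPoint Y.left)) = 1 := by
  have h := genericPoint_eq_of_isOpenImmersion f.left
  rw [← h, ← hX]
  exact trdeg_congr (AlgEquiv.ofBijective (stalkHom f _) ((ConcreteCategory.isIso_iff_bijective (f.left.stalkMap _)).1 inferInstance))

lemma p1_curve [IsAlgClosed k] [CharZero k] : IsCurve (P1 k) := by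
  have := p1_smooth (k := k)
  have := p1_proper (k := k)
  have := p1_connected (k := k)
  have h1 : IsIntegral (P1 k).left := isIntegral_of_smooth
  have := (a1_curve (k := k)).int
  exact isCurve_of_trdeg ⟨inferInstance, inferInstance, inferInstance⟩ inferInstance inferInstance
    (trdeg_open (chartO 0) a1_curve.trdeg)

end St6

namespace St6
variable {k : Type} [Field k]

lemma luroth_fieldGen {K : Type} [Field K] [Algebra k K] (φ : K →ₐ[k] RatFunc k) : ∃ s : K, FieldGen k s := by
  have h := RatFunc.Luroth.eq_adjoin_generator (E := φ.fieldRange)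
  have h1 : RatFunc.Luroth.generator φ.fieldRange ∈ φ.fieldRange := by
    have : RatFunc.Luroth.generator φ.fieldRange ∈ IntermediateField.adjoin k {RatFunc.Luroth.generator φ.fieldRange} :=
      IntermediateField.mem_adjoin_simple_self _ _
    rwa [← h] at this
  obtain ⟨s, hs⟩ := h1
  refine ⟨s, fun f => ?_⟩
  have h2 : φ f ∈ φ.fieldRange := ⟨f, rfl⟩
  rw [h, IntermediateField.mem_adjoin_simple_iff] at h2
  obtain ⟨p, q, hpq⟩ := h2
  have hs' : φ s = RatFunc.Luroth.generator φ.fieldRange := hs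
  rw [← hs', Polynomial.aeval_algHom_apply, Polynomial.aeval_algHom_apply, ← map_div₀] at hpq
  have h3 := φ.toRingHom.injective hpq
  by_cases hq : Polynomial.aeval s q = 0
  · refine ⟨0, 1, by simp, ?_⟩
    rw [h3, hq]; simp
  · exact ⟨p, q, hq, h3⟩

/-- affine scheme of an algebra -/
def specO (k : Type) [Field k] (R : Type) [CommRing R] [Algebra k R] : OverR k :=
  Over.mk (Spec.map (CommRingCat.ofHom (algebraMap k R)))

/-- the function field of an affine integral scheme embeds in any field in which the ring embeds -/
lemma specO_functionField (R : Type) [CommRing R] [Algebra k R] [IsDomain R] [IsIntegral (specO k R).left] (L : Type) [Field L] [Algebra k L]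
    (g : R →ₐ[k] L) (hg : Function.Injective g) :
    Nonempty ((specO k R).left.presheaf.stalk (genericPoint (specO k R).left) →ₐ[k] L) := by
  let K := (Spec (CommRingCat.of R)).functionField
  let _ : Algebra k K := stalkAlg (X := specO k R) (genericPoint (specO k R).left)
  have : IsIntegral (Spec (CommRingCat.of R)) := ‹IsIntegral (specO k R).left›
  have : IsDomain (CommRingCat.of R) := ‹IsDomain R›
  let _ : Algebra (CommRingCat.of R) K := (StructureSheaf.toStalk (CommRingCat.of R) (genericPoint (Spec (CommRingCat.of R)))).hom.toAlgebra
  have hf : IsFractionRing (CommRingCat.of R) K := functionField_isFractionRing_of_affine (CommRingCat.of R)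
  let _ : Algebra k (CommRingCat.of R) := ‹Algebra k R›
  have ht : IsScalarTower k (CommRingCat.of R) K := by
    refine IsScalarTower.of_algebraMap_eq' ?_
    have h1 := kmap_spec (X := specO k R) (genericPoint (specO k R).left)
    have h2 := Spec.fromSpecStalk_eq' (CommRingCat.of R) (genericPoint (Spec (CommRingCat.of R)))
    have h3 : Spec.map (kmap (specO k R) (genericPoint (specO k R).left)) = Spec.map (CommRingCat.ofHom (algebraMap k R) ≫ StructureSheaf.toStalk (CommRingCat.of R) (genericPoint (Spec (CommRingCat.of R)))) := by
      rw [Spec.map_comp, ← h2]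
      exact h1
    have h4 := Spec.map_injective h3
    exact congr($(h4).hom)
  exact ⟨IsFractionRing.liftAlgHom (R := k) (A := (CommRingCat.of R)) (K := K) (g := g) hg⟩

lemma laurent_embed : ∃ g : LaurentPolynomial k →ₐ[k] RatFunc k, Function.Injective g := by
  let u : (RatFunc k)ˣ := Units.mk0 RatFunc.X RatFunc.X_ne_zero
  let g : LaurentPolynomial k →+* RatFunc k := LaurentPolynomial.eval₂ (algebraMap k (RatFunc k)) u
  refine ⟨{ g with commutes' := fun c => ?_ }, ?_⟩
  · exact LaurentPolynomial.eval₂_C _ _ _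
  · change Function.Injective g
    rw [injective_iff_map_eq_zero]
    intro a ha
    obtain ⟨n, p, hp⟩ := LaurentPolynomial.exists_T_pow a
    have h1 : g (Polynomial.toLaurent p) = 0 := by rw [hp, map_mul, ha, zero_mul]
    have h2 : g (Polynomial.toLaurent p) = algebraMap (Polynomial k) (RatFunc k) p := by
      refine (LaurentPolynomial.eval₂_toLaurent _ _ _).trans ?_
      change Polynomial.aeval (RatFunc.X) p = _
      rw [← RatFunc.algebraMap_X, Polynomial.aeval_algebraMap_apply, Polynomial.aeval_X_left_apply]
    rw [h2, map_eq_zero_iff _ (IsFractionRing.injective (Polynomial k) (RatFunc k))] at h1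
    rw [h1, map_zero] at hp
    have h3 : IsUnit (LaurentPolynomial.T n : LaurentPolynomial k) := LaurentPolynomial.isUnit_T _
    exact (h3.mul_left_eq_zero).1 hp.symm

end St6

namespace St6
variable {k : Type} [Field k] {X Y Z : OverR k}

/-- A morphism from an integral scheme sending the generic point to a closed point is constant. -/
lemma const_of_closed [IsAlgClosed k] [LocallyOfFiniteType X.hom] [IsSeparated X.hom] [IsIntegral Z.left] (f : Z ⟶ X)
    (hc : IsClosed {f.left (genericPoint Z.left)}) : IsConstant f := by
  have hk := resField_bijective _ hc
  let y : SR k ⟶ X.left := Spec.map (CommRingCat.ofHom (resHom hk).toRingHom) ≫ X.left.fromSpecStalk (f.left (genericPoint Z.left))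
  refine ⟨y, ?_⟩
  have hy : y ≫ X.hom = 𝟙 _ := by
    rw [Category.assoc, ← kmap_spec, ← Spec.map_comp, ← Spec.map_id]
    congr 1
    ext c
    exact (resHom hk).commutes c
  have := isDominant_generic Z.left
  refine ext_of_isDominant_of_isSeparated X.hom ?_ (Z.left.fromSpecStalk (genericPoint Z.left)) ?_
  · rw [Over.w, Category.assoc, hy, Category.comp_id]
  · rw [← Scheme.SpecMap_stalkMap_fromSpecStalk f.left, ← Category.assoc, ← kmap_spec, ← Category.assoc, ← Spec.map_comp]
    congr 2
    ext t
    have h1 := sub_resHom_mem hk t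
    have h2 : stalkHom f (genericPoint Z.left) (t - algebraMap k _ (resHom hk t)) = 0 := by
      by_contra h
      have h3 : IsUnit (stalkHom f (genericPoint Z.left) (t - algebraMap k _ (resHom hk t))) :=
        isUnit_iff_ne_zero (G₀ := Z.left.functionField).2 h
      exact h1 (isUnit_of_map_unit (f.left.stalkMap (genericPoint Z.left)).hom _ h3)
    rw [map_sub, AlgHom.commutes, sub_eq_zero] at h2
    exact h2

lemma generic_of_nonconst [IsAlgClosed k] (hX : IsCurve X) [IsIntegral X.left] [IsIntegral Z.left] (f : Z ⟶ X)
    (hf : ¬ IsConstant f) : f.left (genericPoint Z.left) = genericPoint X.left := by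
  have := hX.lft
  have := hX.sep
  exact (hX.generic_or_closed _).resolve_right fun hc => hf (const_of_closed f hc)

/-- The generic point specializes. -/
lemma gsp [IsIntegral X.left] (x : X.left) : genericPoint X.left ⤳ x :=
  (genericPoint_spec X.left).specializes (Set.mem_univ x)

/-- The morphism to the affine line given by a function. -/
def av (R : CommRingCat.{0}) [Algebra k R] (r : R) : Spec R ⟶ Spec (CommRingCat.of (Polynomial k)) :=
  Spec.map (CommRingCat.ofHom (Polynomial.aeval (R := k) r).toRingHom)

lemma aeval_hom (x : X.left) (r : X.left.presheaf.stalk x) :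
    av (k := k) _ r ≫ (A1O k).hom = X.left.fromSpecStalk x ≫ X.hom := by
  rw [← kmap_spec]
  refine (Spec.map_comp _ _).symm.trans ?_
  congr 1
  ext c
  exact (Polynomial.aeval (R := k) r).commutes c

lemma aeval_spec {x y : X.left} (h : x ⤳ y) (r : X.left.presheaf.stalk y) :
    Spec.map (X.left.presheaf.stalkSpecializes h) ≫ av (k := k) _ r = av (k := k) _ (specHom h r) := by
  refine (Spec.map_comp _ _).symm.trans ?_
  refine congrArg Spec.map (CommRingCat.hom_ext (RingHom.ext fun p => ?_))
  exact (Polynomial.aeval_algHom_apply (specHom h) r p).symm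

lemma chart_hom (j : Fin 2) : chart (k := k) j ≫ (P1 k).hom = (A1O k).hom := Over.w (chartO j)

lemma p1_isSeparated : (P1 k).left.IsSeparated := by
  have := p1_proper (k := k)
  have : (SR k).IsSeparated := inferInstanceAs (Spec _).IsSeparated
  constructor
  rw [← terminal.comp_from (P1 k).hom]
  infer_instance

lemma p1_map (hX : IsCurve X) [IsIntegral X.left] (s : X.left.presheaf.stalk (genericPoint X.left)) (hs : s ≠ 0) :
    ∃ g : X ⟶ P1 k, X.left.fromSpecStalk (genericPoint X.left) ≫ g.left = av (k := k) _ s ≫ chart 0 := by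
  have := p1_proper (k := k)
  have := p1_isSeparated (k := k)
  have : (SR k).IsSeparated := inferInstanceAs (Spec _).IsSeparated
  obtain ⟨g, hg, hg2⟩ := exists_morphism X.hom (P1 k).hom (av (k := k) _ s ≫ chart 0) (by
    intro x
    have hv := hX.valuationRing x
    let _ : Algebra (X.left.presheaf.stalk x) X.left.functionField := inferInstance
    have hf : IsFractionRing (X.left.presheaf.stalk x) X.left.functionField := inferInstance
    rcases ValuationRing.isInteger_or_isInteger (X.left.presheaf.stalk x) (K := X.left.functionField) s with ⟨r, hr⟩ | ⟨r, hr⟩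
    · refine ⟨av (k := k) _ r ≫ chart 0, ?_, ?_⟩
      · exact (Category.assoc _ _ _).trans ((congrArg (_ ≫ ·) (chart_hom 0)).trans (aeval_hom _ _))
      · refine (Category.assoc _ _ _).symm.trans (congrArg (· ≫ chart 0) ((aeval_spec _ _).trans ?_))
        exact congrArg _ hr
    · refine ⟨av (k := k) _ r ≫ chart 1, ?_, ?_⟩
      · exact (Category.assoc _ _ _).trans ((congrArg (_ ≫ ·) (chart_hom 1)).trans (aeval_hom _ _))
      · refine (Category.assoc _ _ _).symm.trans ((congrArg (· ≫ chart 1) (aeval_spec _ _)).trans ?_)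
        refine (chart_glue (R := X.left.presheaf.stalk (genericPoint X.left)) s (specHom _ r) ?_).symm
        exact (congrArg (s * ·) hr).trans (mul_inv_cancel₀ (G₀ := X.left.functionField) hs))
  exact ⟨Over.homMk g hg, hg2⟩

lemma a1_map [IsIntegral X.left] (s : X.left.presheaf.stalk (genericPoint X.left))
    (hs : ∀ x, ∃ r, specHom (gsp x) r = s) :
    ∃ g : X ⟶ A1O k, X.left.fromSpecStalk (genericPoint X.left) ≫ g.left = av (k := k) _ s := by
  have : LocallyOfFiniteType (A1O k).hom := by
    have := a1_smooth (k := k)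
    infer_instance
  have : (A1O k).left.IsSeparated := inferInstanceAs (Spec (CommRingCat.of (Polynomial k))).IsSeparated
  have : (SR k).IsSeparated := inferInstanceAs (Spec _).IsSeparated
  obtain ⟨g, hg, hg2⟩ := exists_morphism X.hom (A1O k).hom (av (k := k) _ s) (by
    intro x
    obtain ⟨r, hr⟩ := hs x
    exact ⟨av (k := k) _ r, aeval_hom _ _, (aeval_spec _ _).trans (congrArg _ hr)⟩)
  exact ⟨Over.homMk g hg, hg2⟩

end St6

namespace St6
variable {k : Type} [Field k] {X Y Z : OverR k}

/-- The closed point `c` of the affine line. -/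
def ptc (c : k) : Spec (CommRingCat.of (Polynomial k)) :=
  (⟨RingHom.ker (Polynomial.evalRingHom c), RingHom.ker_isPrime _⟩ : PrimeSpectrum (Polynomial k))

lemma exists_ptc [IsAlgClosed k] (z : Spec (CommRingCat.of (Polynomial k))) (hz : z ≠ (⊥ : PrimeSpectrum (Polynomial k))) :
    ∃ c, z = ptc c := by
  change PrimeSpectrum (Polynomial k) at z
  have h1 : z.asIdeal ≠ ⊥ := fun h => hz (PrimeSpectrum.ext h)
  have h2 := Submodule.IsPrincipal.prime_generator_of_isPrime z.asIdeal h1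
  obtain ⟨c, hc⟩ := IsAlgClosed.exists_root (Submodule.IsPrincipal.generator z.asIdeal) 
    (Polynomial.degree_pos_of_irreducible h2.irreducible).ne'
  refine ⟨c, PrimeSpectrum.ext ?_⟩
  have h3 : z.asIdeal.IsMaximal := Ring.DimensionLEOne.maximalOfPrime h1 z.2
  refine h3.eq_of_le (RingHom.ker_ne_top _) ?_
  intro f hf
  obtain ⟨q, rfl⟩ := (Submodule.IsPrincipal.mem_iff_generator_dvd _).1 hf
  change Polynomial.eval c _ = 0
  rw [Polynomial.eval_mul, hc, zero_mul]

lemma ptc_injective {c d : k} (h : ptc c = ptc d) : c = d := by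
  have h1 : (Polynomial.X - Polynomial.C c : Polynomial k) ∈ (ptc c : PrimeSpectrum (Polynomial k)).asIdeal := by
    change Polynomial.eval c _ = 0
    simp
  rw [h] at h1
  have h2 : Polynomial.eval d (Polynomial.X - Polynomial.C c : Polynomial k) = 0 := h1
  simp [sub_eq_zero] at h2
  exact h2.symm

lemma dominant_gsp [IsIntegral X.left] (x : X.left) : IsDominant (Spec.map (X.left.presheaf.stalkSpecializes (gsp x))) := by
  constructor
  refine (PrimeSpectrum.denseRange_comap_iff_ker_le_nilRadical _).2 ?_
  rw [(RingHom.injective_iff_ker_eq_bot _).1 (specializes_injective X.left rfl (gsp x))]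
  exact bot_le

lemma local_form [IsIntegral X.left] {Y : Scheme.{0}} [Y.IsSeparated] (i : Spec (CommRingCat.of (Polynomial k)) ⟶ Y)
    (g : X.left ⟶ Y) (s : X.left.presheaf.stalk (genericPoint X.left))
    (hg : X.left.fromSpecStalk (genericPoint X.left) ≫ g = av (k := k) _ s ≫ i) (x : X.left) 
    (r : X.left.presheaf.stalk x) (hr : specHom (gsp x) r = s) :
    X.left.fromSpecStalk x ≫ g = av (k := k) _ r ≫ i := by
  have := dominant_gsp x
  refine ext_of_isDominant (Spec.map (X.left.presheaf.stalkSpecializes (gsp x))) ?_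
  rw [← Category.assoc, Scheme.SpecMap_stalkSpecializes_fromSpecStalk, hg, ← Category.assoc, aeval_spec, hr]

lemma hit [IsIntegral X.left] {Y : Scheme.{0}} [Y.IsSeparated] (i : Spec (CommRingCat.of (Polynomial k)) ⟶ Y)
    (g : X.left ⟶ Y) (s : X.left.presheaf.stalk (genericPoint X.left))
    (hg : X.left.fromSpecStalk (genericPoint X.left) ≫ g = av (k := k) _ s ≫ i) (x : X.left) 
    (r : X.left.presheaf.stalk x) (hr : specHom (gsp x) r = s) (c : k)
    (hc : r - algebraMap k _ c ∈ IsLocalRing.maximalIdeal _) : g x = i (ptc c) := by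
  have h1 := local_form i g s hg x r hr
  have h2 := congr($h1 (IsLocalRing.closedPoint _))
  have h3 : g (X.left.fromSpecStalk x (IsLocalRing.closedPoint _)) = i (av (k := k) _ r (IsLocalRing.closedPoint _)) :=
    (Scheme.Hom.comp_apply _ _ _).symm.trans (h2.trans (Scheme.Hom.comp_apply _ _ _))
  rw [Scheme.fromSpecStalk_closedPoint] at h3
  rw [h3]
  congr 1
  refine PrimeSpectrum.ext (Ideal.ext fun f => ?_)
  change Polynomial.aeval r f ∈ IsLocalRing.maximalIdeal _ ↔ Polynomial.eval c f = 0
  have h4 : Polynomial.aeval r f - algebraMap k _ (Polynomial.eval c f) ∈ IsLocalRing.maximalIdeal (X.left.presheaf.stalk x) := by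
    rw [← Polynomial.aeval_algebraMap_apply_eq_algebraMap_eval]
    obtain ⟨q, hq⟩ := Polynomial.sub_dvd_eval_sub r (algebraMap k (X.left.presheaf.stalk x) c) (f.map (algebraMap k (X.left.presheaf.stalk x)))
    rw [Polynomial.eval_map_algebraMap, Polynomial.eval_map_algebraMap] at hq
    rw [hq]
    exact Ideal.mul_mem_right _ _ hc
  rw [← Submodule.sub_mem_iff_left _ h4 (x := Polynomial.aeval r f), sub_sub_cancel]
  constructor
  · intro h
    by_contra h5
    have : IsUnit (algebraMap k (X.left.presheaf.stalk x) (Polynomial.eval c f)) := (Ne.isUnit h5).map _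
    exact h this
  · intro h
    rw [h, map_zero]; exact Submodule.zero_mem _

lemma exists_inv (hX : IsCurve X) [IsIntegral X.left] {Y : Scheme.{0}} [Y.IsSeparated] (i : Spec (CommRingCat.of (Polynomial k)) ⟶ Y)
    (g : X.left ⟶ Y) (s : X.left.functionField)
    (hg : X.left.fromSpecStalk (genericPoint X.left) ≫ g = av (k := k) _ s ≫ i) (c : k) (h : ∀ x, g x ≠ i (ptc c)) (x : X.left) :
    ∃ r, specHom (gsp x) r = (s - algebraMap k (X.left.presheaf.stalk (genericPoint X.left)) c)⁻¹ := by
  have hv := hX.valuationRing x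
  let _ : Algebra (X.left.presheaf.stalk x) X.left.functionField := inferInstance
  have hf : IsFractionRing (X.left.presheaf.stalk x) X.left.functionField := inferInstance
  rcases ValuationRing.isInteger_or_isInteger (X.left.presheaf.stalk x) (K := X.left.functionField) 
    (s - algebraMap k (X.left.presheaf.stalk (genericPoint X.left)) c) with ⟨r, hr⟩ | ⟨r, hr⟩
  · have hr' : specHom (gsp x) r = s - algebraMap k (X.left.presheaf.stalk (genericPoint X.left)) c := hr
    by_cases hu : IsUnit r
    · obtain ⟨u, rfl⟩ := hu
      refine ⟨↑u⁻¹, ?_⟩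
      rw [← hr']
      refine eq_inv_of_mul_eq_one_left (G := X.left.functionField) ?_
      exact (map_mul (specHom (gsp x)) _ _).symm.trans (by rw [Units.inv_mul, map_one])
    · exfalso
      refine h x (hit i g s hg x (r + algebraMap k _ c) ?_ c ?_)
      · rw [map_add, hr', AlgHom.commutes]
        exact sub_add_cancel _ _
      · rw [add_sub_cancel_right]; exact hu
  · exact ⟨r, hr⟩

end St6

namespace St6
variable {k : Type} [Field k] {X Y Z : OverR k}

lemma iso_of_range (f : X ⟶ Y) (g : Z ⟶ Y) [IsOpenImmersion f.left] [IsOpenImmersion g.left]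
    (h : Set.range f.left = Set.range g.left) : Nonempty (X ≅ Z) := by
  refine ⟨Over.isoMk (IsOpenImmersion.isoOfRangeEq f.left g.left h) ?_⟩
  rw [← Over.w g, ← Category.assoc, IsOpenImmersion.isoOfRangeEq_hom_fac, Over.w]

lemma iso_of_surj (f : X ⟶ Y) [IsOpenImmersion f.left] (h : Set.range f.left = Set.univ) : Nonempty (X ≅ Y) := by
  have : IsOpenImmersion (𝟙 Y : Y ⟶ Y).left := inferInstanceAs (IsOpenImmersion (𝟙 Y.left))
  refine iso_of_range f (𝟙 Y) ?_
  rw [h]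
  exact (Set.range_id).symm

lemma laurent_unit (u : LaurentPolynomial k) (hu : IsUnit u) : ∃ a : k, ∃ n : ℤ, u = LaurentPolynomial.C a * LaurentPolynomial.T n := by
  obtain ⟨v, hv⟩ := hu.exists_right_inv
  obtain ⟨n, p, hp⟩ := LaurentPolynomial.exists_T_pow u
  obtain ⟨m, q, hq⟩ := LaurentPolynomial.exists_T_pow v
  have h1 : p * q = Polynomial.X ^ (n + m) := by
    apply Polynomial.toLaurent_injective
    rw [map_mul, hp, hq, Polynomial.toLaurent_X_pow, Nat.cast_add, LaurentPolynomial.T_add]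
    linear_combination (LaurentPolynomial.T n * LaurentPolynomial.T m) * hv
  obtain ⟨i, -, hi⟩ := (dvd_prime_pow Polynomial.prime_X _).1 (Dvd.intro _ h1)
  obtain ⟨w, hw⟩ := hi.symm
  obtain ⟨a, -, ha⟩ := Polynomial.isUnit_iff.1 w.isUnit
  refine ⟨a, i - n, ?_⟩
  have h2 : u = Polynomial.toLaurent p * LaurentPolynomial.T (-n) := by
    rw [hp, LaurentPolynomial.mul_T_assoc]; simp
  rw [h2, ← hw, ← ha, map_mul, Polynomial.toLaurent_X_pow, Polynomial.toLaurent_C, LaurentPolynomial.T_sub]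
  ring

lemma laurent_const (F : LaurentPolynomial k) (c d : k) (hcd : c ≠ d) (hc : IsUnit (F - LaurentPolynomial.C c))
    (hd : IsUnit (F - LaurentPolynomial.C d)) : ∃ e, F = LaurentPolynomial.C e := by
  obtain ⟨a, n, ha⟩ := laurent_unit _ hc
  obtain ⟨b, m, hb⟩ := laurent_unit _ hd
  by_cases hn : n = 0
  · refine ⟨a + c, ?_⟩
    rw [hn, LaurentPolynomial.T_zero, mul_one] at ha
    rw [map_add, ← ha, sub_add_cancel]
  exfalso
  have h1 : LaurentPolynomial.C a * LaurentPolynomial.T n - LaurentPolynomial.C b * LaurentPolynomial.T m = LaurentPolynomial.C (d - c) := by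
    rw [← ha, ← hb, map_sub]; ring
  have ha0 : a ≠ 0 := by
    rintro rfl
    rw [ha] at hc
    simp at hc
  have h2 := congr(($h1).coeff n)
  have h0 := congr(($h1).coeff 0)
  have key : ∀ (a : k) (n i : ℤ), (LaurentPolynomial.C a * LaurentPolynomial.T n).coeff i = if n = i then a else 0 := by
    intro a n i
    rw [← LaurentPolynomial.single_eq_C_mul_T]
    exact Finsupp.single_apply
  have key2 : ∀ (a : k) (i : ℤ), (LaurentPolynomial.C a).coeff i = if 0 = i then a else 0 := by
    intro a i
    rw [← key a 0 i, LaurentPolynomial.T_zero, mul_one]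
  have key3 : ∀ (x y : LaurentPolynomial k) (i : ℤ), (x - y).coeff i = x.coeff i - y.coeff i := fun _ _ _ => rfl
  rw [key3, key, key, key2] at h0 h2
  grind

/-- The translated inclusion of the multiplicative group in the affine line. -/
def gmShift (c : k) : GmO k ⟶ A1O k :=
  Over.homMk (Spec.map (CommRingCat.ofHom (algebraMap (Polynomial k) (LaurentPolynomial k))) ≫ 
    Spec.map (CommRingCat.ofHom (Polynomial.algEquivAevalXAddC c).toRingEquiv.toRingHom)) (by
    refine (congrArg (· ≫ _) (Spec.map_comp _ _).symm).trans ((Spec.map_comp _ _).symm.trans ?_)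
    refine congrArg Spec.map (CommRingCat.hom_ext (RingHom.ext fun p => ?_))
    change algebraMap (Polynomial k) (LaurentPolynomial k) (Polynomial.algEquivAevalXAddC c (Polynomial.C p)) = LaurentPolynomial.C p
    have : Polynomial.algEquivAevalXAddC c (Polynomial.C p) = Polynomial.C p := (Polynomial.algEquivAevalXAddC c).commutes p
    rw [this]
    exact Polynomial.toLaurent_C p)

instance gmShift_open (c : k) : IsOpenImmersion (gmShift c).left := by
  have h1 : IsOpenImmersion (Spec.map (CommRingCat.ofHom (algebraMap (Polynomial k) (LaurentPolynomial k)))) :=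
    IsOpenImmersion.of_isLocalization (Polynomial.X : Polynomial k)
  have h2 : IsIso (CommRingCat.ofHom (Polynomial.algEquivAevalXAddC c).toRingEquiv.toRingHom) := 
    (ConcreteCategory.isIso_iff_bijective _).2 (Polynomial.algEquivAevalXAddC c).bijective
  exact inferInstanceAs (IsOpenImmersion (Spec.map (CommRingCat.ofHom (algebraMap (Polynomial k) (LaurentPolynomial k))) ≫ 
    Spec.map (CommRingCat.ofHom (Polynomial.algEquivAevalXAddC c).toRingEquiv.toRingHom)))

lemma gmShift_range [IsAlgClosed k] (c : k) : Set.range (gmShift c).left = {ptc c}ᶜ := by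
  have h2 : IsIso (CommRingCat.ofHom (Polynomial.algEquivAevalXAddC c).toRingEquiv.toRingHom) := 
    (ConcreteCategory.isIso_iff_bijective _).2 (Polynomial.algEquivAevalXAddC c).bijective
  let τ := Spec.map (CommRingCat.ofHom (Polynomial.algEquivAevalXAddC c).toRingEquiv.toRingHom)
  have h3 : Function.Bijective τ := τ.homeomorph.bijective
  have h4 : τ (ptc 0) = ptc c := by
    refine PrimeSpectrum.ext (Ideal.ext fun f => ?_)
    change Polynomial.eval 0 (Polynomial.algEquivAevalXAddC c f) = 0 ↔ Polynomial.eval c f = 0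
    simp [Polynomial.algEquivAevalXAddC, ← Polynomial.comp_eq_aeval]
  have h5 : Set.range (Spec.map (CommRingCat.ofHom (algebraMap (Polynomial k) (LaurentPolynomial k)))) = {ptc 0}ᶜ := by
    refine (PrimeSpectrum.localization_away_comap_range (LaurentPolynomial k) (Polynomial.X : Polynomial k)).trans ?_
    ext z
    change PrimeSpectrum (Polynomial k) at z
    change Polynomial.X ∉ z.asIdeal ↔ ¬ (z = ptc 0)
    refine not_congr ⟨fun h => ?_, fun h => ?_⟩
    · obtain ⟨d, rfl⟩ := exists_ptc z (fun h0 => by rw [h0] at h; exact Polynomial.X_ne_zero h)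
      have : Polynomial.eval d (Polynomial.X : Polynomial k) = 0 := h
      rw [Polynomial.eval_X] at this
      rw [this]
    · rw [h]
      exact Polynomial.eval_X
  have h6 : Set.range (gmShift c).left = τ '' Set.range (Spec.map (CommRingCat.ofHom (algebraMap (Polynomial k) (LaurentPolynomial k)))) := 
    Set.range_comp τ (Spec.map (CommRingCat.ofHom (algebraMap (Polynomial k) (LaurentPolynomial k))))
  rw [h6, h5, Set.image_compl_eq h3, Set.image_singleton, h4]
  rfl

end St6

namespace St6
variable {k : Type} [Field k] {X Y Z : OverR k}

lemma bot_generic {Y : Scheme.{0}} [IsIntegral Y] (i : Spec (CommRingCat.of (Polynomial k)) ⟶ Y) [IsOpenImmersion i] :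
    i (⊥ : PrimeSpectrum (Polynomial k)) = genericPoint Y := by
  have : IsDomain (CommRingCat.of (Polynomial k)) := inferInstanceAs (IsDomain (Polynomial k))
  have : IsIntegral (Spec (CommRingCat.of (Polynomial k))) := inferInstance
  rw [← genericPoint_eq_of_isOpenImmersion i]
  congr 1
  exact (genericPoint_eq_bot_of_affine (CommRingCat.of (Polynomial k))).symm

lemma bot_mem_range {X Y : Scheme.{0}} [IsIntegral Y] [IsIntegral X] (g : X ⟶ Y) [IsOpenImmersion g] (i : Spec (CommRingCat.of (Polynomial k)) ⟶ Y) [IsOpenImmersion i] :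
    i (⊥ : PrimeSpectrum (Polynomial k)) ∈ Set.range g := by
  rw [bot_generic, ← genericPoint_eq_of_isOpenImmersion g]
  exact ⟨_, rfl⟩

lemma bot_mem_range_a1 [IsIntegral X.left] (g : X ⟶ A1O k) [IsOpenImmersion g.left] :
    (⊥ : PrimeSpectrum (Polynomial k)) ∈ Set.range g.left := by
  have : IsDomain (CommRingCat.of (Polynomial k)) := inferInstanceAs (IsDomain (Polynomial k))
  have : IsIntegral (Spec (CommRingCat.of (Polynomial k))) := inferInstance
  have : IsIntegral (A1O k).left := this
  have hi : IsOpenImmersion (𝟙 (Spec (CommRingCat.of (Polynomial k)))) := inferInstance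
  exact @bot_mem_range k _ _ _ _ _ g.left _ (𝟙 (Spec (CommRingCat.of (Polynomial k)))) hi

/-- The function field of a variety as a bundled field algebra. -/
lemma fieldGen_of_gm [IsAlgClosed k] (hX : IsCurve X) [IsIntegral X.left] (f : GmO k ⟶ X) (hf : ¬ IsConstant f) :
    ∃ s : X.left.presheaf.stalk (genericPoint X.left), FieldGen k (F := X.left.functionField) s := by
  have : IsIntegral (specO k (LaurentPolynomial k)).left := inferInstanceAs (IsIntegral (Spec (CommRingCat.of (LaurentPolynomial k))))
  have : IsIntegral (GmO k).left := this
  obtain ⟨g, hg⟩ := laurent_embed (k := k)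
  obtain ⟨φ⟩ := specO_functionField (LaurentPolynomial k) (RatFunc k) g hg
  have h1 := generic_of_nonconst hX f hf
  let φ' : (GmO k).left.presheaf.stalk (genericPoint (GmO k).left) →ₐ[k] RatFunc k := φ
  let ψ := φ'.comp (stalkHom f (genericPoint (GmO k).left))
  let ψ' := ψ.comp (specHom (X := X) (h1 ▸ specializes_refl _ : f.left (genericPoint (GmO k).left) ⤳ genericPoint X.left))
  exact luroth_fieldGen (K := X.left.functionField) ψ'

lemma fieldGen_ne_zero [IsAlgClosed k] [CharZero k] (hX : IsCurve X) [IsIntegral X.left] (s : X.left.functionField)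
    (hs : FieldGen k (F := X.left.functionField) s) : s ≠ 0 := by
  rintro rfl
  obtain ⟨u, hu⟩ := exists_transcendental (K := X.left.functionField) hX.trdeg
  obtain ⟨p, q, hq, h⟩ := hs u
  apply hu
  rw [h]
  rw [← map_zero (algebraMap k X.left.functionField), Polynomial.aeval_algebraMap_apply, Polynomial.aeval_algebraMap_apply, ← map_div₀]
  exact isAlgebraic_algebraMap _

/-- Proper rational curves are the projective line. -/
lemma p1_of_fieldGen [IsAlgClosed k] [CharZero k] (hX : IsCurve X) [IsIntegral X.left] (s : X.left.functionField)
    (hs : FieldGen k (F := X.left.functionField) s) : 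
    ∃ g : X ⟶ P1 k, IsOpenImmersion g.left ∧ X.left.fromSpecStalk (genericPoint X.left) ≫ g.left = av (k := k) _ s ≫ chart 0 := by
  obtain ⟨g, hg⟩ := p1_map hX s (fieldGen_ne_zero hX s hs)
  have hi : IsOpenImmersion (chartO (k := k) 0).left := chartO_open 0
  exact ⟨g, @open_of_gen _ _ _ _ _ _ hX p1_curve _ (chartO 0).left hi s hs g hg, hg⟩

lemma p1_of_fieldGen_proper [IsAlgClosed k] [CharZero k] (hX : IsCurve X) [IsIntegral X.left] (s : X.left.functionField)
    (hs : FieldGen k (F := X.left.functionField) s) [IsProper X.hom] : Nonempty (X ≅ P1 k) := by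
  obtain ⟨g, hg, -⟩ := p1_of_fieldGen hX s hs
  refine iso_of_surj g ?_
  have := p1_connected (k := k)
  have := p1_proper (k := k)
  have : IsProper g.left := by
    have : IsProper (g.left ≫ (P1 k).hom) := by rw [Over.w]; infer_instance
    exact IsProper.of_comp g.left (P1 k).hom
  have h1 : IsClopen (Set.range g.left) := ⟨g.left.isClosedMap.isClosed_range, g.left.isOpenEmbedding.isOpen_range⟩
  exact h1.eq_univ (Set.range_nonempty _)

lemma a1_of_fieldGen [IsAlgClosed k] [CharZero k] (hX : IsCurve X) [IsIntegral X.left] (s : X.left.functionField)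
    (hs : FieldGen k (F := X.left.functionField) s) (hs2 : ∀ x, ∃ r, specHom (gsp x) r = s) : 
    ∃ g : X ⟶ A1O k, IsOpenImmersion g.left := by
  obtain ⟨g, hg⟩ := a1_map (X := X) s hs2
  have hi : IsOpenImmersion (𝟙 (Spec (CommRingCat.of (Polynomial k)))) := inferInstance
  refine ⟨g, @open_of_gen _ _ _ _ _ _ hX a1_curve _ (𝟙 (Spec (CommRingCat.of (Polynomial k)))) hi s hs g ?_⟩
  exact hg.trans (Category.comp_id _).symm

lemma gm_const_of_miss [IsAlgClosed k] (f : GmO k ⟶ A1O k) (c d : k) (hcd : c ≠ d) (hc : ∀ z, f.left z ≠ ptc c)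
    (hd : ∀ z, f.left z ≠ ptc d) : IsConstant f := by
  obtain ⟨φ, hφ⟩ : ∃ φ : CommRingCat.of (Polynomial k) ⟶ CommRingCat.of (LaurentPolynomial k), Spec.map φ = f.left :=
    ⟨Spec.preimage f.left, Spec.map_preimage _⟩
  have hw := Over.w f
  rw [← hφ] at hw
  have hw' : CommRingCat.ofHom (algebraMap k (Polynomial k)) ≫ φ = CommRingCat.ofHom (algebraMap k (LaurentPolynomial k)) := by
    apply Spec.map_injective
    rw [Spec.map_comp]
    exact hw
  have hC : ∀ a : k, φ.hom (Polynomial.C a) = LaurentPolynomial.C a := fun a => congr($(hw').hom a)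
  have key : ∀ c : k, (∀ z, f.left z ≠ ptc c) → IsUnit (φ.hom Polynomial.X - LaurentPolynomial.C c) := by
    intro c hc
    by_contra hu
    obtain ⟨m, hm, hm2⟩ := exists_max_ideal_of_mem_nonunits hu
    let z : PrimeSpectrum (LaurentPolynomial k) := ⟨m, hm.isPrime⟩
    apply hc z
    rw [← hφ]
    have h1 : (Polynomial.X - Polynomial.C c : Polynomial k) ∈ (PrimeSpectrum.comap φ.hom z).asIdeal := by
      change φ.hom _ ∈ m
      rw [map_sub, hC]
      exact hm2
    obtain ⟨e, he⟩ := exists_ptc (PrimeSpectrum.comap φ.hom z) (fun h0 => by 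
      rw [h0] at h1
      exact Polynomial.X_sub_C_ne_zero c h1)
    rw [he] at h1
    have h2 : Polynomial.eval e (Polynomial.X - Polynomial.C c : Polynomial k) = 0 := h1
    rw [Polynomial.eval_sub, Polynomial.eval_X, Polynomial.eval_C, sub_eq_zero] at h2
    rw [← h2]
    exact he
  obtain ⟨e, he⟩ := laurent_const _ c d hcd (key c hc) (key d hd)
  refine ⟨Spec.map (CommRingCat.ofHom (Polynomial.evalRingHom e)), ?_⟩
  rw [← hφ]
  refine Eq.trans ?_ (Spec.map_comp _ _)
  refine congrArg Spec.map (CommRingCat.hom_ext ?_)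
  refine Polynomial.ringHom_ext (fun a => ?_) ?_
  · refine (hC a).trans ?_
    change _ = LaurentPolynomial.C (Polynomial.eval e (Polynomial.C a))
    rw [Polynomial.eval_C]
  · refine he.trans ?_
    change _ = LaurentPolynomial.C (Polynomial.eval e (Polynomial.X))
    rw [Polynomial.eval_X]

/-- The unit section of the multiplicative group. -/
def gmOne : ptO k ⟶ GmO k := Over.homMk (Spec.map (CommRingCat.ofHom (LaurentPolynomial.eval₂ (RingHom.id k) 1))) (by
  refine (Spec.map_comp _ _).symm.trans (Eq.trans ?_ (Spec.map_id _))
  refine congrArg Spec.map (CommRingCat.hom_ext (RingHom.ext fun a => ?_))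
  exact LaurentPolynomial.eval₂_C _ _ _)

lemma const_of_mono (f : GmO k ⟶ X) (g : X ⟶ Y) [Mono g.left] (h : IsConstant (f ≫ g)) : IsConstant f := by
  obtain ⟨y, hy⟩ := h
  refine ⟨(gmOne (k := k)).left ≫ f.left, ?_⟩
  have h1 : (gmOne (k := k)).left ≫ (GmO k).hom = 𝟙 _ := Over.w (gmOne (k := k))
  have hy' : f.left ≫ g.left = (GmO k).hom ≫ y := hy
  rw [← cancel_mono g.left, hy']
  refine Eq.trans ?_ (Category.assoc _ _ _).symm
  refine congrArg (_ ≫ ·) ?_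
  refine Eq.trans ?_ (Category.assoc _ _ _).symm
  refine Eq.trans ?_ (congrArg (_ ≫ ·) hy').symm
  exact ((Category.assoc _ _ _).symm.trans ((congrArg (· ≫ y) h1).trans (Category.id_comp y))).symm

lemma gm_a1 [IsAlgClosed k] [CharZero k] (hX : IsCurve X) [IsIntegral X.left] (f : GmO k ⟶ X) (hf : ¬ IsConstant f) (g : X ⟶ A1O k) 
    [IsOpenImmersion g.left] : Nonempty (X ≅ A1O k) ∨ Nonempty (X ≅ GmO k) := by
  by_cases h : ∃ c, ptc c ∉ Set.range g.left
  · right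
    obtain ⟨c, hc⟩ := h
    refine iso_of_range g (gmShift c) ?_
    rw [gmShift_range]
    refine Set.Subset.antisymm (fun z hz h => hc (h ▸ hz)) fun z hz => ?_
    by_contra hzg
    have hz0 : z ≠ (⊥ : PrimeSpectrum (Polynomial k)) := by
      rintro rfl
      exact hzg (bot_mem_range_a1 g)
    obtain ⟨d, rfl⟩ := exists_ptc z hz0
    refine hf (const_of_mono f g (gm_const_of_miss (f ≫ g) c d (fun hcd => hz (hcd ▸ rfl)) ?_ ?_))
    · intro z hz
      exact hc ⟨f.left z, hz⟩
    · intro z hz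
      exact hzg ⟨f.left z, hz⟩
  · left
    push Not at h
    refine iso_of_surj g (Set.eq_univ_of_forall fun z => ?_)
    by_cases hz0 : z = (⊥ : PrimeSpectrum (Polynomial k))
    · rw [hz0]; exact bot_mem_range_a1 g
    · obtain ⟨d, rfl⟩ := exists_ptc z hz0
      exact h d

theorem gm_case [IsAlgClosed k] [CharZero k] (hX : IsCurve X) (f : GmO k ⟶ X) (hf : ¬ IsConstant f) :
    Nonempty (X ≅ P1 k) ∨ Nonempty (X ≅ A1O k) ∨ Nonempty (X ≅ GmO k) := by
  have := hX.int
  obtain ⟨s, hs⟩ := fieldGen_of_gm hX f hf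
  obtain ⟨g, hg, hg2⟩ := p1_of_fieldGen hX s hs
  have hs0 := fieldGen_ne_zero hX s hs
  by_cases hsurj : Set.range g.left = Set.univ
  · exact Or.inl (iso_of_surj g hsurj)
  right
  obtain ⟨z, hz⟩ := (Set.ne_univ_iff_exists_notMem _).1 hsurj
  obtain ⟨j, w, hw⟩ := chart_cover (k := k) z
  have := p1_isSeparated (k := k)
  have hj : ∃ s' : X.left.functionField, FieldGen k (F := X.left.functionField) s' ∧ 
      X.left.fromSpecStalk (genericPoint X.left) ≫ g.left = av (k := k) _ s' ≫ chart j := by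
    have : j = 0 ∨ j = 1 := by fin_cases j <;> simp
    rcases this with rfl | rfl
    · exact ⟨s, hs, hg2⟩
    · refine ⟨s⁻¹, fieldGen_inv (F := X.left.functionField) hs, hg2.trans ?_⟩
      exact chart_glue (R := X.left.functionField) s s⁻¹ (mul_inv_cancel₀ hs0)
  obtain ⟨s', hs', hg3⟩ := hj
  have hw0 : w ≠ (⊥ : PrimeSpectrum (Polynomial k)) := by
    rintro rfl
    have := (p1_curve (k := k)).int
    have hi : IsOpenImmersion (chartO (k := k) j).left := chartO_open j
    exact hz (hw ▸ @bot_mem_range k _ _ (P1 k).left _ _ g.left _ (chartO j).left hi)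
  obtain ⟨c, rfl⟩ := exists_ptc w hw0
  have h3 := exists_inv hX (chart j) g.left s' hg3 c (fun x hx => hz ⟨x, hx.trans hw⟩)
  obtain ⟨g', hg'⟩ := a1_of_fieldGen hX _ (fieldGen_inv (F := X.left.functionField) (fieldGen_sub (F := X.left.functionField) hs' c)) h3
  exact gm_a1 hX f hf g'

end St6

namespace St6

section pts
variable {k : Type} [Field k] {X Y : OverR k}
variable {R R' R'' : Type} [CommRing R] [Algebra k R] [CommRing R'] [Algebra k R'] [CommRing R''] [Algebra k R'']

/-- the map of affine schemes over k -/
def sMap (φ : R →ₐ[k] R') : specO k R' ⟶ specO k R :=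
  Over.homMk (Spec.map (CommRingCat.ofHom φ.toRingHom)) (by
    refine (Spec.map_comp _ _).symm.trans (congrArg Spec.map (CommRingCat.hom_ext (RingHom.ext fun p => ?_)))
    exact φ.commutes p)

lemma sMap_left (φ : R →ₐ[k] R') : (sMap φ).left = Spec.map (CommRingCat.ofHom φ.toRingHom) := rfl

lemma sMap_comp (φ : R →ₐ[k] R') (ψ : R' →ₐ[k] R'') : sMap (ψ.comp φ) = sMap ψ ≫ sMap φ := by
  apply Over.OverMorphism.ext
  exact Spec.map_comp (CommRingCat.ofHom φ.toRingHom) (CommRingCat.ofHom ψ.toRingHom)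

lemma sMap_id : sMap (AlgHom.id k R) = 𝟙 (specO k R) := by
  apply Over.OverMorphism.ext
  exact Spec.map_id (CommRingCat.of R)

/-- the canonical point with values in the stalk -/
def ptS (X : OverR k) (x : X.left) : specO k (X.left.presheaf.stalk x) ⟶ X :=
  Over.homMk (X.left.fromSpecStalk x) (kmap_spec x).symm

lemma ptS_left (x : X.left) : (ptS X x).left = X.left.fromSpecStalk x := rfl

instance ptS_mono (x : X.left) : Mono (ptS X x) := by
  have : Mono (ptS X x).left := inferInstanceAs (Mono (X.left.fromSpecStalk x))
  exact Over.mono_of_mono_left _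

lemma sMap_injective {φ ψ : R →ₐ[k] R'} (h : sMap φ = sMap ψ) : φ = ψ := by
  have h1 : Spec.map (CommRingCat.ofHom φ.toRingHom) = Spec.map (CommRingCat.ofHom ψ.toRingHom) :=
    congrArg (fun f => f.left) h
  have h2 := Spec.map_injective h1
  apply AlgHom.ext
  intro r
  exact congr(($h2).hom r)

lemma pb_unique {x : X.left} {φ ψ : X.left.presheaf.stalk x →ₐ[k] R}
    (h : sMap φ ≫ ptS X x = sMap ψ ≫ ptS X x) : φ = ψ :=
  sMap_injective ((cancel_mono _).1 h)

lemma exists_sMap (y : specO k R' ⟶ specO k R) : ∃ φ : R →ₐ[k] R', y = sMap φ := by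
  let p : CommRingCat.of R ⟶ CommRingCat.of R' := Spec.preimage y.left
  have hp : Spec.map p = y.left := Spec.map_preimage _
  have hw := Over.w y
  have h2 : CommRingCat.ofHom (algebraMap k R) ≫ p = CommRingCat.ofHom (algebraMap k R') := by
    apply Spec.map_injective
    rw [Spec.map_comp, hp]
    exact hw
  refine ⟨{ p.hom with commutes' := fun c => congr(($h2).hom c) }, ?_⟩
  apply Over.OverMorphism.ext
  exact hp.symm

lemma exists_pb [IsLocalRing R] (y : specO k R ⟶ X) (x : X.left)
    (hx : y.left (IsLocalRing.closedPoint R) = x) :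
    ∃ φ : X.left.presheaf.stalk x →ₐ[k] R, y = sMap φ ≫ ptS X x ∧ IsLocalHom φ := by
  subst hx
  let y' : Spec (CommRingCat.of R) ⟶ X.left := y.left
  let p : X.left.presheaf.stalk (y' (IsLocalRing.closedPoint R)) ⟶ CommRingCat.of R :=
    Scheme.stalkClosedPointTo (R := CommRingCat.of R) y'
  have hp : Spec.map p ≫ X.left.fromSpecStalk _ = y' :=
    Scheme.Spec_stalkClosedPointTo_fromSpecStalk (R := CommRingCat.of R) y'
  have hl : IsLocalHom p.hom := Scheme.isLocalHom_stalkClosedPointTo (R := CommRingCat.of R) y'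
  have hw : y' ≫ X.hom = Spec.map (CommRingCat.ofHom (algebraMap k R)) := Over.w y
  have h2 : kmap X (y' (IsLocalRing.closedPoint R)) ≫ p = CommRingCat.ofHom (algebraMap k R) := by
    apply Spec.map_injective
    rw [Spec.map_comp, kmap_spec, ← Category.assoc, hp, hw]
  refine ⟨{ p.hom with commutes' := fun c => congr(($h2).hom c) }, ?_, ⟨fun r hr => hl.map_nonunit r hr⟩⟩
  apply Over.OverMorphism.ext
  exact hp.symm

lemma ptS_closed (x : X.left) : (ptS X x).left (IsLocalRing.closedPoint (X.left.presheaf.stalk x)) = x :=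
  Scheme.fromSpecStalk_closedPoint

lemma sMap_closed [IsLocalRing R] [IsLocalRing R'] (φ : R →ₐ[k] R') (h : IsLocalHom φ) :
    (sMap φ).left (IsLocalRing.closedPoint R') = IsLocalRing.closedPoint R := by
  have : IsLocalHom φ.toRingHom := ⟨h.map_nonunit⟩
  exact IsLocalRing.comap_closedPoint φ.toRingHom

end pts

section dual
variable (k : Type) [Field k]
variable {R R' R'' : Type} [CommRing R] [Algebra k R] [CommRing R'] [Algebra k R'] [CommRing R''] [Algebra k R'']

variable (R) in
/-- constants -/
def dInl : R →ₐ[k] DualNumber R := TrivSqZeroExt.inlAlgHom k R R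
variable (R) in
/-- reduction -/
def dFst : DualNumber R →ₐ[k] R := TrivSqZeroExt.fstHom k R R

variable {k} in
/-- functoriality of dual numbers -/
def dMap (φ : R →ₐ[k] R') : DualNumber R →ₐ[k] DualNumber R' where
  toFun z := TrivSqZeroExt.inl (φ z.fst) + TrivSqZeroExt.inr (φ z.snd)
  map_one' := by ext <;> simp
  map_zero' := by ext <;> simp
  map_add' a b := by ext <;> simp
  map_mul' a b := by ext <;> simp
  commutes' c := by
    have h1 : algebraMap k (DualNumber R) c = TrivSqZeroExt.inl (algebraMap k R c) := rfl
    have h2 : algebraMap k (DualNumber R') c = TrivSqZeroExt.inl (algebraMap k R' c) := rfl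
    rw [h1, h2]
    ext <;> simp

variable {k} in
@[simp] lemma dMap_fst (φ : R →ₐ[k] R') (z : DualNumber R) : (dMap φ z).fst = φ z.fst := by simp [dMap]
variable {k} in
@[simp] lemma dMap_snd (φ : R →ₐ[k] R') (z : DualNumber R) : (dMap φ z).snd = φ z.snd := by simp [dMap]
@[simp] lemma dInl_fst (r : R) : (dInl k R r).fst = r := rfl
@[simp] lemma dInl_snd (r : R) : (dInl k R r).snd = 0 := rfl
@[simp] lemma dFst_apply (z : DualNumber R) : dFst k R z = z.fst := rfl

variable (R) in
/-- unit map of dual numbers -/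
def dUnit : DualNumber k →ₐ[k] DualNumber R := dMap (Algebra.ofId k R)

variable {k}
lemma dMap_comp (φ : R →ₐ[k] R') (ψ : R' →ₐ[k] R'') : dMap (ψ.comp φ) = (dMap ψ).comp (dMap φ) := by
  refine AlgHom.ext fun z => ?_
  ext <;> simp
lemma dMap_dInl (φ : R →ₐ[k] R') : (dMap φ).comp (dInl k R) = (dInl k R').comp φ := by
  refine AlgHom.ext fun z => ?_
  ext <;> simp
lemma dMap_dFst (φ : R →ₐ[k] R') : (dFst k R').comp (dMap φ) = φ.comp (dFst k R) := by
  refine AlgHom.ext fun z => ?_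
  simp
lemma dFst_dInl : (dFst k R).comp (dInl k R) = AlgHom.id k R := by
  refine AlgHom.ext fun z => ?_
  simp
lemma dMap_dUnit (φ : R →ₐ[k] R') : (dMap φ).comp (dUnit k R) = dUnit k R' := by
  rw [dUnit, dUnit, ← dMap_comp]
  congr 1
  ext
lemma dFst_dUnit : (dFst k R).comp (dUnit k R) = (Algebra.ofId k R).comp (dFst k k) := by
  rw [dUnit, dMap_dFst]

instance dual_local [IsLocalRing R] : IsLocalRing (DualNumber R) :=
  IsLocalRing.of_isUnit_or_isUnit_one_sub_self fun a => by
    rw [TrivSqZeroExt.isUnit_iff_isUnit_fst, TrivSqZeroExt.isUnit_iff_isUnit_fst]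
    exact IsLocalRing.isUnit_or_isUnit_one_sub_self a.fst

lemma dFst_local : IsLocalHom (dFst k R) :=
  ⟨fun a h => TrivSqZeroExt.isUnit_iff_isUnit_fst.2 h⟩

/-- derivation from an algebra hom to the dual numbers -/
def derOf (φ : R →ₐ[k] R') [Algebra R R'] [IsScalarTower k R R'] (hφ : ∀ r, algebraMap R R' r = φ r) (ψ : R →ₐ[k] DualNumber R') (h : (dFst k R').comp ψ = φ) :
    Derivation k R R' where
  toFun r := (ψ r).snd
  map_add' a b := by simp
  map_smul' c a := by simp
  map_one_eq_zero' := by simp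
  leibniz' a b := by
    have ha : (ψ a).fst = φ a := DFunLike.congr_fun h a
    have hb : (ψ b).fst = φ b := DFunLike.congr_fun h b
    change (ψ (a*b)).snd = _
    rw [map_mul, TrivSqZeroExt.snd_mul, ha, hb]
    simp [Algebra.smul_def, hφ, mul_comm]
end dual
end St6

namespace St6

section grp
variable {k : Type} [Field k] (Γ : GroupScheme k)
variable {R R' R'' : Type} [CommRing R] [Algebra k R] [CommRing R'] [Algebra k R'] [CommRing R''] [Algebra k R'']

instance ptGroup (T : OverR k) : Group (T ⟶ Γ.G) :=
  let _ : Mul (T ⟶ Γ.G) := ⟨fun a b => Γ.mul a b⟩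
  let _ : Inv (T ⟶ Γ.G) := ⟨fun a => Γ.inv a⟩
  let _ : One (T ⟶ Γ.G) := ⟨Γ.one T⟩
  Group.ofLeftAxioms (fun a b c => Γ.mul_assoc a b c) (fun a => Γ.one_mul a) (fun a => Γ.inv_mul a)

variable {Γ}
variable {T T' : OverR k}
lemma comp_mul' (f : T ⟶ T') (a b : T' ⟶ Γ.G) : f ≫ (a * b) = (f ≫ a) * (f ≫ b) := Γ.mul_natural f a b
lemma comp_one' (f : T ⟶ T') : f ≫ (1 : T' ⟶ Γ.G) = 1 := Γ.one_natural f
lemma comp_inv' (f : T ⟶ T') (a : T' ⟶ Γ.G) : f ≫ a⁻¹ = (f ≫ a)⁻¹ := by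
  apply eq_inv_of_mul_eq_one_left
  rw [← comp_mul', inv_mul_cancel, comp_one']

/-- infinitesimal right translation -/
def pert (g : specO k R ⟶ Γ.G) (v : specO k (DualNumber k) ⟶ Γ.G) : specO k (DualNumber R) ⟶ Γ.G :=
  (sMap (dInl k R) ≫ g) * (sMap (dUnit k R) ≫ v)

/-- tangent vector at the origin -/
def IsTan (v : specO k (DualNumber k) ⟶ Γ.G) : Prop := sMap (dFst k k) ≫ v = 1

lemma pert_fst (g : specO k R ⟶ Γ.G) {v} (hv : IsTan (Γ := Γ) v) : sMap (dFst k R) ≫ pert g v = g := by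
  rw [pert, comp_mul', ← Category.assoc, ← Category.assoc, ← sMap_comp, ← sMap_comp, dFst_dInl, dFst_dUnit,
    sMap_id, Category.id_comp, sMap_comp, Category.assoc, hv, comp_one', mul_one]

lemma pert_nat (φ : R →ₐ[k] R') (g : specO k R ⟶ Γ.G) (v) :
    sMap (dMap φ) ≫ pert g v = pert (sMap φ ≫ g) v := by
  rw [pert, pert, comp_mul', ← Category.assoc, ← Category.assoc, ← sMap_comp, ← sMap_comp, dMap_dInl, dMap_dUnit,
    sMap_comp, Category.assoc]

/-- structure map to a point -/
def cst (k R : Type) [Field k] [CommRing R] [Algebra k R] : specO k R ⟶ specO k k := sMap (Algebra.ofId k R)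

lemma sMap_cst (φ : R →ₐ[k] R') : sMap φ ≫ cst k R = cst k R' := by
  rw [cst, cst, ← sMap_comp]
  congr 1
  ext

lemma pert_left (b : specO k k ⟶ Γ.G) (g : specO k R ⟶ Γ.G) (v) :
    pert ((cst k R ≫ b) * g) v = (cst k (DualNumber R) ≫ b) * pert g v := by
  rw [pert, pert, comp_mul', ← Category.assoc, sMap_cst, mul_assoc]

lemma pert_kk (g : specO k k ⟶ Γ.G) (v) : pert g v = (cst k (DualNumber k) ≫ g) * v := by
  have h1 : dInl k k = Algebra.ofId k (DualNumber k) := by ext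
  have h2 : dUnit k k = AlgHom.id k _ := by
    refine AlgHom.ext fun z => ?_
    ext <;> simp [dUnit]
  rw [pert, cst, h1, h2, sMap_id, Category.id_comp]

end grp

section tang
variable {k : Type} [Field k] {X : OverR k}

lemma exists_dHom {x : X.left} {R : Type} [CommRing R] [Algebra k R] [IsLocalRing R]
    (φ : X.left.presheaf.stalk x →ₐ[k] R) (hφ : IsLocalHom φ)
    (Φ : specO k (DualNumber R) ⟶ X)
    (h : sMap (dFst k R) ≫ Φ = sMap φ ≫ ptS X x) :
    ∃ ψ : X.left.presheaf.stalk x →ₐ[k] DualNumber R,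
      (dFst k R).comp ψ = φ ∧ Φ = sMap ψ ≫ ptS X x := by
  obtain ⟨ψ, hψ, -⟩ := exists_pb Φ x (by
    rw [← sMap_closed (dFst k _) dFst_local]
    refine (Scheme.Hom.comp_apply _ _ _).symm.trans ?_
    have : (sMap (dFst k R)).left ≫ Φ.left = (sMap φ).left ≫ (ptS X x).left := congrArg (fun f => f.left) h
    refine (congr($this _)).trans ((Scheme.Hom.comp_apply _ _ _).trans ?_)
    exact (congrArg _ (sMap_closed φ hφ)).trans (ptS_closed x))
  refine ⟨ψ, ?_, hψ⟩
  apply pb_unique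
  rw [← h, hψ, sMap_comp, Category.assoc]

lemma ptS_spec {x y : X.left} (h : x ⤳ y) : sMap (specHom h) ≫ ptS X y = ptS X x := by
  apply Over.OverMorphism.ext
  exact Scheme.SpecMap_stalkSpecializes_fromSpecStalk h

lemma ptS_map {Y : OverR k} (f : X ⟶ Y) (x : X.left) :
    sMap (stalkHom f x) ≫ ptS Y (f.left x) = ptS X x ≫ f := by
  apply Over.OverMorphism.ext
  exact Scheme.SpecMap_stalkMap_fromSpecStalk f.left


/-- the k-valued point of a closed point -/
def kpt [IsAlgClosed k] [LocallyOfFiniteType X.hom] (x : X.left) (hx : IsClosed {x}) : specO k k ⟶ X :=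
  sMap (resHom (resField_bijective x hx)) ≫ ptS X x

lemma res_unique {R : Type} [CommRing R] [IsLocalRing R] [Algebra k R]
    (hk : Function.Bijective (algebraMap k (IsLocalRing.ResidueField R))) (φ : R →ₐ[k] k) : φ = resHom hk := by
  refine AlgHom.ext fun r => ?_
  have h := sub_resHom_mem hk r
  have h2 : φ (r - algebraMap k R (resHom hk r)) = 0 := by
    by_contra h3
    set m := r - algebraMap k R (resHom hk r) with hm
    -- m - φ m is a unit killed by φ
    have h4 : IsUnit (algebraMap k R (φ m) - m) := by
      by_contra h5
      have h6 : algebraMap k R (φ m) ∈ IsLocalRing.maximalIdeal R := by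
        have := (IsLocalRing.maximalIdeal R).add_mem ((IsLocalRing.mem_maximalIdeal _).2 h5) h
        simpa using this
      exact h6 ((Ne.isUnit h3).map (algebraMap k R))
    have h7 := h4.map φ
    simp at h7
  simpa [sub_eq_zero] using h2

lemma tangentFamily_of {R : Type} [CommRing R] [IsLocalRing R] [Algebra k R]
    (hk : Function.Bijective (algebraMap k (IsLocalRing.ResidueField R))) (S : Set (Derivation k R R))
    (h : ∀ φ : R →ₐ[k] DualNumber k, ∃ D ∈ S, ∀ r, resHom hk (D r) = (φ r).snd) : TangentFamily k R S := by
  intro φ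
  obtain ⟨D, hD, h⟩ := h φ
  refine ⟨D, hD, fun r => ?_⟩
  rw [← h]
  exact sub_resHom_mem hk _

end tang

section lie
variable {k : Type} [Field k] {Γ : GroupScheme k}

lemma exists_dv (v : specO k (DualNumber k) ⟶ Γ.G) (hv : IsTan v) (a : Γ.G.left) :
    ∃ ψ : Γ.G.left.presheaf.stalk a →ₐ[k] DualNumber (Γ.G.left.presheaf.stalk a),
      (dFst k _).comp ψ = AlgHom.id k _ ∧ pert (ptS Γ.G a) v = sMap ψ ≫ ptS Γ.G a := by
  apply exists_dHom (AlgHom.id k _) ⟨fun a h => h⟩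
  rw [pert_fst _ hv, sMap_id, Category.id_comp]

/-- the Lie action on a stalk -/
def dHom (v : specO k (DualNumber k) ⟶ Γ.G) (hv : IsTan v) (a : Γ.G.left) :
    Γ.G.left.presheaf.stalk a →ₐ[k] DualNumber (Γ.G.left.presheaf.stalk a) :=
  (exists_dv v hv a).choose

lemma dHom_fst {v : specO k (DualNumber k) ⟶ Γ.G} (hv : IsTan v) (a : Γ.G.left) :
    (dFst k _).comp (dHom v hv a) = AlgHom.id k _ := (exists_dv v hv a).choose_spec.1

lemma dHom_spec {v : specO k (DualNumber k) ⟶ Γ.G} (hv : IsTan v) (a : Γ.G.left) :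
    pert (ptS Γ.G a) v = sMap (dHom v hv a) ≫ ptS Γ.G a := (exists_dv v hv a).choose_spec.2

/-- the invariant derivation on a stalk -/
def lieD {v : specO k (DualNumber k) ⟶ Γ.G} (hv : IsTan v) (a : Γ.G.left) :
    Derivation k (Γ.G.left.presheaf.stalk a) (Γ.G.left.presheaf.stalk a) :=
  derOf (AlgHom.id k _) (fun _ => rfl) (dHom v hv a) (dHom_fst hv a)

lemma lieD_apply {v : specO k (DualNumber k) ⟶ Γ.G} (hv : IsTan v) (a : Γ.G.left) (r) :
    lieD hv a r = (dHom v hv a r).snd := rfl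

lemma lieD_spec {v : specO k (DualNumber k) ⟶ Γ.G} (hv : IsTan v) {a b : Γ.G.left} (h : a ⤳ b) (r) :
    specHom h (lieD hv b r) = lieD hv a (specHom h r) := by
  have h1 : (dMap (specHom h)).comp (dHom v hv b) = (dHom v hv a).comp (specHom h) := by
    apply pb_unique
    rw [sMap_comp, sMap_comp, Category.assoc, Category.assoc, ptS_spec, ← dHom_spec, ← dHom_spec, pert_nat, ptS_spec]
  have h2 := DFunLike.congr_fun h1 r
  have h3 := congrArg TrivSqZeroExt.snd h2
  simpa [lieD_apply] using h3

lemma lieD_tangentFamily [IsAlgClosed k] [LocallyOfFiniteType Γ.G.hom] (a : Γ.G.left) (ha : IsClosed {a}) :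
    TangentFamily k (Γ.G.left.presheaf.stalk a) {D | ∃ (v : specO k (DualNumber k) ⟶ Γ.G) (hv : IsTan v), D = lieD hv a} := by
  apply tangentFamily_of (resField_bijective a ha)
  intro φ
  let w := sMap φ ≫ ptS Γ.G a
  have hw : sMap (dFst k k) ≫ w = kpt a ha := by
    rw [← Category.assoc, ← sMap_comp, res_unique (resField_bijective a ha) ((dFst k k).comp φ)]
    rfl
  let v := (cst k (DualNumber k) ≫ kpt a ha)⁻¹ * w
  have hv : IsTan v := by
    have h1 : cst k k = 𝟙 _ := by
      rw [cst, ← sMap_id]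
      congr 1
    rw [IsTan, comp_mul', comp_inv', hw, ← Category.assoc, sMap_cst, h1, Category.id_comp, inv_mul_cancel]
  refine ⟨_, ⟨v, hv, rfl⟩, fun r => ?_⟩
  have h1 : (dMap (resHom (resField_bijective a ha))).comp (dHom v hv a) = φ := by
    apply pb_unique
    rw [sMap_comp, Category.assoc, ← dHom_spec, pert_nat]
    change pert (kpt a ha) v = w
    rw [pert_kk]
    exact mul_inv_cancel_left _ _
  have h2 := congrArg TrivSqZeroExt.snd (DFunLike.congr_fun h1 r)
  simpa [lieD_apply] using h2

lemma group_integral [IsAlgClosed k] [CharZero k] [LocallyOfFiniteType Γ.G.hom] [QuasiCompact Γ.G.hom]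
    [ConnectedSpace Γ.G.left] : IsIntegral Γ.G.left := by
  have : CompactSpace Γ.G.left := compactSpace_left
  apply isIntegral_of_stalks
  intro x hx
  exact isDomain_of_tangentFamily (resField_bijective x hx) (lieD_tangentFamily x hx)

end lie
end St6

namespace St6

section alg
lemma wronski_comp {k K E : Type} [Field k] [CharZero k] [IsAlgClosed k] [Field K] [Algebra k K] [Field E] [Algebra k E]
    (htr : Algebra.trdeg k K = 1) (φ : K →ₐ[k] E) (D : Derivation k E E) (δ : Derivation k K K) (a b : K) :
    D (φ a) * φ (δ b) = D (φ b) * φ (δ a) := by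
  let _ : Algebra K E := φ.toRingHom.toAlgebra
  have _ : IsScalarTower k K E := IsScalarTower.of_algebraMap_eq fun x => (φ.commutes x).symm
  let D1 : Derivation k K E := D.compAlgebraMap K
  let D2 : Derivation k K E := (Algebra.linearMap K E).compDer δ
  exact derivation_wronski htr D1 D2 a b

/-- the property of the Dedekind-Weber derivation -/
def DWProp (k : Type) {K : Type} [Field k] [Field K] [Algebra k K] (δ : Derivation k K K) : Prop :=
  ∀ V : ValuationSubring K, (∀ c, algebraMap k K c ∈ V) →
      ∀ (_ : IsDiscreteValuationRing V) (u : V), Irreducible u → δ u ≠ 0 ∧ (δ u)⁻¹ ∈ V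

lemma dw_local {k K O : Type} [Field k] [Field K] [Algebra k K] [CommRing O] [IsDomain O] [IsDiscreteValuationRing O]
    [Algebra k O] (δ : Derivation k K K) (hδ : DWProp k δ) (ι : O →ₐ[k] K) (hι : Function.Injective ι)
    (hfr : ∀ t : K, ∃ a b : O, b ≠ 0 ∧ ι b * t = ι a) :
    ∃ u w : O, Irreducible u ∧ δ (ι u) ≠ 0 ∧ ι w = (δ (ι u))⁻¹ := by
  have hfr' : ∀ t : K, t ∈ ι.range ∨ t⁻¹ ∈ ι.range := by
    intro t
    obtain ⟨a, b, hb, h⟩ := hfr t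
    have hb' : ι b ≠ 0 := fun h0 => hb (hι (by rw [h0, map_zero]))
    rcases ValuationRing.dvd_total a b with ⟨c, hc⟩ | ⟨c, hc⟩
    · by_cases ht : t = 0
      · left
        exact ⟨0, by simp [ht]⟩
      right
      refine ⟨c, ?_⟩
      have h2 : ι b * (t * ι c) = ι b * 1 := by
        rw [← mul_assoc, h, ← map_mul, ← hc, mul_one]
      have h3 := mul_left_cancel₀ hb' h2
      exact eq_inv_of_mul_eq_one_right h3
    · left
      refine ⟨c, ?_⟩
      have h2 : ι b * t = ι b * ι c := by rw [h, hc, map_mul]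
      exact (mul_left_cancel₀ hb' h2).symm
  let V : ValuationSubring K := { ι.range.toSubring with mem_or_inv_mem' := hfr' }
  have hV : ∀ z, z ∈ V ↔ ∃ o, ι o = z := fun z => Iff.rfl
  let e : O ≃+* V := RingEquiv.ofBijective
    ({ toFun := fun o => ⟨ι o, (hV _).2 ⟨o, rfl⟩⟩, map_one' := Subtype.ext (map_one ι), map_zero' := Subtype.ext (map_zero ι),
       map_add' := fun a b => Subtype.ext (map_add ι a b), map_mul' := fun a b => Subtype.ext (map_mul ι a b) } : O →+* V)
    ⟨fun a b h => hι (congrArg Subtype.val h), fun z => by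
      obtain ⟨o, ho⟩ := (hV _).1 z.2
      exact ⟨o, Subtype.ext ho⟩⟩
  have hd : IsDiscreteValuationRing V := IsDiscreteValuationRing.RingEquivClass.isDiscreteValuationRing e
  obtain ⟨u, hu⟩ := IsDiscreteValuationRing.exists_irreducible O
  obtain ⟨h1, h2⟩ := hδ V (fun c => (hV _).2 ⟨algebraMap k O c, ι.commutes c⟩) hd (e u)
    ((MulEquiv.irreducible_iff e).2 hu)
  obtain ⟨w, hw⟩ := (hV _).1 h2
  exact ⟨u, w, hu, h1, hw⟩
end alg

section glob
variable {k : Type} [Field k] {X : OverR k}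

lemma sec_const [IsAlgClosed k] [IsIntegral X.left] [IsProper X.hom] (s : X.left.presheaf.stalk (genericPoint X.left))
    (hs : ∀ x, ∃ r, specHom (gsp x) r = s) : ∃ c : k, algebraMap k _ c = s := by
  obtain ⟨g, hg⟩ := a1_map s hs
  let g' : X.left ⟶ Spec (CommRingCat.of (Polynomial k)) := g.left
  have h1 := sec_germ_aux g' ⊤ (genericPoint X.left) trivial
  have h2 : (((Scheme.ΓSpecIso (CommRingCat.of (Polynomial k))).inv ≫ g'.appLE ⊤ ⊤ le_top) ≫ X.left.presheaf.germ ⊤ (genericPoint X.left) trivial) =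
    CommRingCat.ofHom (Polynomial.aeval (R := k) s).toRingHom := Spec.map_injective (h1.trans hg)
  let t : Γ(X.left, ⊤) := ((Scheme.ΓSpecIso (CommRingCat.of (Polynomial k))).inv ≫ g'.appLE ⊤ ⊤ le_top) Polynomial.X
  have ht : X.left.presheaf.germ ⊤ (genericPoint X.left) trivial t = s := by
    have := congr(($h2).hom Polynomial.X)
    refine this.trans ?_
    exact Polynomial.aeval_X s
  have hi := isIntegral_appTop_of_universallyClosed X.hom
  have hk : (kSec X ⊤).hom.IsIntegral := by
    have h3 : kSec X ⊤ = (Scheme.ΓSpecIso (CommRingCat.of k)).inv ≫ X.hom.appTop := by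
      rw [kSec]
      congr 1
      exact Scheme.Hom.appLE_eq_app ..
    rw [h3, CommRingCat.hom_comp]
    refine RingHom.IsIntegral.trans _ _ ?_ hi
    exact RingHom.isIntegral_of_surjective _ ((ConcreteCategory.isIso_iff_bijective (Scheme.ΓSpecIso (CommRingCat.of k)).inv).1 inferInstance).2
  obtain ⟨p, hp, hp0⟩ := hk t
  have h5 : IsIntegral k s := by
    refine ⟨p, hp, ?_⟩
    rw [← ht, stalk_algebraMap, ← kSec_germ ⊤ _ trivial, CommRingCat.hom_comp]
    refine (Polynomial.hom_eval₂ p _ _ t).symm.trans ?_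
    rw [hp0, map_zero]
  exact mem_range_of_isAlgebraic (K := X.left.functionField) h5.isAlgebraic

end glob
end St6

namespace St6

section pkg
variable {k : Type} [Field k] {X : OverR k} {Γ : GroupScheme k}

lemma specHom_comp {Y : OverR k} {a b c : Y.left} (h : a ⤳ b) (h' : b ⤳ c) (r) :
    specHom h (specHom h' r) = specHom (h.trans h') r :=
  TopCat.Presheaf.stalkSpecializes_comp_apply _ h h' r

lemma exists_gen_hom {A : OverR k} [IsIntegral A.left] [IsIntegral X.left] (f : A ⟶ X)
    (hg : f.left (genericPoint A.left) = genericPoint X.left) :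
    ∃ φ : X.left.functionField →ₐ[k] A.left.functionField,
      ∀ a h, φ (specHom (gsp (f.left a)) h) = specHom (gsp a) (stalkHom f a h) := by
  obtain ⟨φ, hφ, -⟩ := exists_pb (ptS A (genericPoint A.left) ≫ f) (genericPoint X.left) (by
    refine (Scheme.Hom.comp_apply _ _ _).trans ?_
    rw [ptS_closed, hg])
  refine ⟨φ, fun a => ?_⟩
  have : φ.comp (specHom (gsp (f.left a))) = (specHom (gsp a)).comp (stalkHom f a) := by
    apply pb_unique
    rw [sMap_comp, sMap_comp, Category.assoc, Category.assoc, ptS_spec, ptS_map, ← Category.assoc, ptS_spec, hφ]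
  exact fun h => DFunLike.congr_fun this h

lemma spec_inj {A : OverR k} [IsIntegral A.left] (a : A.left) : Function.Injective (specHom (gsp a)) :=
  specializes_injective A.left rfl (gsp a)

variable [IsAlgClosed k] [CharZero k] [IsIntegral Γ.G.left] [IsIntegral X.left] [IsProper Γ.G.hom]

lemma f_proper (hX : IsCurve X) (f : Γ.G ⟶ X) : IsProper f.left := by
  have := hX.sep
  have : IsProper (f.left ≫ X.hom) := by rw [Over.w]; infer_instance
  exact IsProper.of_comp f.left X.hom

lemma f_closed (hX : IsCurve X) (f : Γ.G ⟶ X) (a : Γ.G.left) (ha : IsClosed {a}) : IsClosed {f.left a} := by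
  have := f_proper hX f
  have := f.left.isClosedMap _ ha
  rwa [Set.image_singleton] at this

lemma dw_stalk (hX : IsCurve X) (δ : Derivation k X.left.functionField X.left.functionField) (hδ : DWProp k δ)
    (x : X.left) (hx : IsClosed {x}) :
    ∃ u w : X.left.presheaf.stalk x, Irreducible u ∧ δ (specHom (gsp x) u) ≠ 0 ∧
      (specHom (gsp x) w : X.left.functionField) * (δ (specHom (gsp x) u)) = 1 := by
  have := hX.dvr x hx inferInstance
  obtain ⟨u, w, h1, h2, h3⟩ := dw_local δ hδ (specHom (gsp x)) (spec_inj x) (fun t => exists_frac X.left rfl (gsp x) t)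
  refine ⟨u, w, h1, h2, ?_⟩
  exact (congrArg (· * _) h3).trans (inv_mul_cancel₀ h2)

lemma lie_const (hX : IsCurve X) (f : Γ.G ⟶ X) (φ : X.left.functionField →ₐ[k] Γ.G.left.functionField)
    (hφ : ∀ a h, φ (specHom (gsp (f.left a)) h) = specHom (gsp a) (stalkHom f a h))
    (δ : Derivation k X.left.functionField X.left.functionField) (hδ : DWProp k δ)
    {v : specO k (DualNumber k) ⟶ Γ.G} (hv : IsTan v) :
    ∃ c : k, ∀ h : X.left.functionField, (lieD hv (genericPoint Γ.G.left) (φ h) : Γ.G.left.functionField) =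
      algebraMap k Γ.G.left.functionField c * φ (δ h) := by
  let D : Derivation k Γ.G.left.functionField Γ.G.left.functionField := lieD hv (genericPoint Γ.G.left)
  have hD : ∀ a r, D (specHom (gsp a) r) = specHom (gsp a) (lieD hv a r) := fun a r => (lieD_spec hv (gsp a) r).symm
  have hw := fun a b => wronski_comp hX.trdeg φ D δ a b
  have : CompactSpace Γ.G.left := QuasiCompact.compactSpace_of_compactSpace Γ.G.hom
  obtain ⟨a0, -, ha0⟩ := exists_closed_spec Γ.G.left (genericPoint Γ.G.left)
  obtain ⟨u0, w0, h01, h02, h03⟩ := dw_stalk hX δ hδ (f.left a0) (f_closed hX f a0 ha0)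
  set U : X.left.functionField := specHom (gsp (f.left a0)) u0 with hU
  have hU' : φ (δ U) ≠ 0 := fun h => h02 ((map_eq_zero φ).1 h)
  have hmem : ∀ a, ∃ r, specHom (gsp a) r = D (φ U) * (φ (δ U))⁻¹ := by
    intro a
    obtain ⟨b, hab, hb⟩ := exists_closed_spec Γ.G.left a
    obtain ⟨u, w, h1, h2, h3⟩ := dw_stalk hX δ hδ (f.left b) (f_closed hX f b hb)
    refine ⟨specHom hab (lieD hv b (stalkHom f b u) * stalkHom f b w), ?_⟩
    rw [specHom_comp]
    refine (map_mul _ _ _).trans ?_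
    refine (congrArg₂ (fun x y : Γ.G.left.functionField => x * y) (hD b _).symm (hφ b _).symm).trans ?_
    rw [← hφ b u]
    have h4 := hw U (specHom (gsp (f.left b)) u)
    have h5 : φ (specHom (gsp (f.left b)) w) * φ (δ (specHom (gsp (f.left b)) u)) = 1 := by
      rw [← map_mul]
      exact (congrArg φ h3).trans (map_one φ)
    have h6 := eq_inv_of_mul_eq_one_left h5
    have h7 : φ (δ (specHom (gsp (f.left b)) u)) ≠ 0 := right_ne_zero_of_mul_eq_one h5
    rw [h6]
    field_simp
    exact h4.symm.trans (mul_comm _ _)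
  obtain ⟨c, hc⟩ := sec_const _ hmem
  refine ⟨c, fun h => ?_⟩
  refine Eq.trans ?_ (congrArg (· * φ (δ h)) hc.symm)
  have h4 := hw U h
  change D (φ h) = D (φ U) * (φ (δ U))⁻¹ * φ (δ h)
  field_simp
  exact h4.symm

lemma span_stable {R : Type} [CommRing R] [Algebra k R] (D : Derivation k R R) (s : Set R)
    (h : ∀ x ∈ s, D x ∈ Ideal.span s) : ∀ w ∈ Ideal.span s, D w ∈ Ideal.span s := by
  intro w hw
  induction hw using Submodule.span_induction with
  | mem x hx => exact h x hx
  | zero => simp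
  | add x y _ _ h1 h2 => rw [map_add]; exact add_mem h1 h2
  | smul a x hx h1 =>
    rw [smul_eq_mul, Derivation.leibniz]
    exact add_mem (Ideal.mul_mem_left _ _ h1) (Ideal.mul_mem_right _ _ hx)

lemma stalkHom_local (f : Γ.G ⟶ X) (a : Γ.G.left) : IsLocalHom (stalkHom f a) :=
  ⟨fun r hr => (inferInstance : IsLocalHom (f.left.stalkMap a).hom).map_nonunit r hr⟩

lemma stalkHom_mem (f : Γ.G ⟶ X) (a : Γ.G.left) (u) (hu : u ∈ IsLocalRing.maximalIdeal (X.left.presheaf.stalk (f.left a))) :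
    stalkHom f a u ∈ IsLocalRing.maximalIdeal (Γ.G.left.presheaf.stalk a) :=
  fun h => hu ((stalkHom_local f a).map_nonunit _ h)

lemma lie_nonzero (hX : IsCurve X) (f : Γ.G ⟶ X) (φ : X.left.functionField →ₐ[k] Γ.G.left.functionField)
    (hφ : ∀ a h, φ (specHom (gsp (f.left a)) h) = specHom (gsp a) (stalkHom f a h)) :
    ∃ (v : specO k (DualNumber k) ⟶ Γ.G) (hv : IsTan v) (h : X.left.functionField),
      (lieD hv (genericPoint Γ.G.left) (φ h) : Γ.G.left.functionField) ≠ 0 := by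
  by_contra! hcon
  have : CompactSpace Γ.G.left := QuasiCompact.compactSpace_of_compactSpace Γ.G.hom
  obtain ⟨a, -, ha⟩ := exists_closed_spec Γ.G.left (genericPoint Γ.G.left)
  have hz : ∀ (v : specO k (DualNumber k) ⟶ Γ.G) (hv : IsTan v) h, lieD hv a (stalkHom f a h) = 0 := by
    intro v hv h
    apply spec_inj a
    rw [lieD_spec, ← hφ, map_zero]
    exact hcon v hv _
  have := hX.dvr (f.left a) (f_closed hX f a ha) inferInstance
  obtain ⟨u, hu⟩ := IsDiscreteValuationRing.exists_irreducible (X.left.presheaf.stalk (f.left a))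
  have hum : u ∈ IsLocalRing.maximalIdeal (X.left.presheaf.stalk (f.left a)) := hu.1
  have h1 := stable_eq_bot (resField_bijective a ha) (lieD_tangentFamily a ha) (Ideal.span {stalkHom f a u}) (by
      intro h
      rw [Ideal.span_singleton_eq_top] at h
      exact stalkHom_mem f a u hum h) (by
      rintro D ⟨v, hv, rfl⟩
      apply span_stable
      rintro _ rfl
      rw [hz]
      exact zero_mem _)
  rw [Ideal.span_singleton_eq_bot] at h1
  have h2 := hφ a u
  rw [h1, map_zero] at h2
  have h3 := (map_eq_zero φ).1 h2
  exact hu.ne_zero (spec_inj _ (h3.trans (map_zero _).symm))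

lemma f_surj (hX : IsCurve X) (f : Γ.G ⟶ X) (hg : f.left (genericPoint Γ.G.left) = genericPoint X.left) :
    Function.Surjective f.left := by
  have := f_proper hX f
  have h1 : IsClosed (Set.range f.left) := f.left.isClosedMap.isClosed_range
  intro x
  exact (gsp x).mem_closed h1 ⟨_, hg⟩

theorem lie_pkg (hX : IsCurve X) (f : Γ.G ⟶ X) (hf : ¬ IsConstant f)
    (hno : ¬ ∃ s : X.left.functionField, FieldGen k s) :
    ∃ (dX : ∀ x : X.left, X.left.presheaf.stalk x → X.left.presheaf.stalk x)
      (c : ∀ v : specO k (DualNumber k) ⟶ Γ.G, IsTan v → k),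
      (∀ v hv a h, lieD hv a (stalkHom f a h) = algebraMap k _ (c v hv) * stalkHom f a (dX (f.left a) h)) ∧
      (∀ x, IsClosed {x} → ∃ u, IsUnit (dX x u)) := by
  have hg := generic_of_nonconst hX f hf
  obtain ⟨φ, hφ⟩ := exists_gen_hom f hg
  have := hX.lft
  have : Algebra.EssFiniteType k X.left.functionField := stalk_essFiniteType (genericPoint X.left)
  obtain ⟨δ, hδ⟩ := (dedekind_weber (K := X.left.functionField) hX.trdeg).resolve_left hno
  choose c hc using fun (v : specO k (DualNumber k) ⟶ Γ.G) (hv : IsTan v) => lie_const hX f φ hφ δ hδ hv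
  obtain ⟨v0, hv0, h0, hne⟩ := lie_nonzero hX f φ hφ
  have hc0 : c v0 hv0 ≠ 0 := by
    intro h
    rw [hc, h] at hne
    simp at hne
  have hst : ∀ x (h : X.left.presheaf.stalk x), ∃ h', specHom (gsp x) h' = δ (specHom (gsp x) h) := by
    intro x h
    obtain ⟨a, rfl⟩ := f_surj hX f hg x
    set g := δ (specHom (gsp (f.left a)) h) with hgdef
    have h1 := hc v0 hv0 (specHom (gsp (f.left a)) h)
    rw [hφ, ← lieD_spec] at h1
    have := hX.valuationRing (f.left a)
    obtain ⟨p, q, hq, hpq⟩ := exists_frac X.left rfl (gsp (f.left a)) g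
    replace hpq : specHom (gsp (f.left a)) q * g = specHom (gsp (f.left a)) p := hpq
    have hq0 : specHom (gsp (f.left a)) q ≠ 0 := fun h => hq (spec_inj _ (h.trans (map_zero _).symm))
    -- reduce to p = q r or q = p r
    rcases ValuationRing.dvd_total q p with ⟨r, hr⟩ | ⟨r, hr⟩
    · refine ⟨r, ?_⟩
      rw [hr, map_mul] at hpq
      exact (mul_left_cancel₀ (M₀ := X.left.functionField) hq0 hpq).symm
    · by_cases hru : IsUnit r
      · obtain ⟨r', hr'⟩ := hru.exists_right_inv
        have hp : p = q * r' := by rw [hr, mul_assoc, hr', mul_one]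
        refine ⟨r', ?_⟩
        rw [hp, map_mul] at hpq
        exact (mul_left_cancel₀ (M₀ := X.left.functionField) hq0 hpq).symm
      · exfalso
        -- g * r = 1
        have hgr : g * specHom (gsp (f.left a)) r = 1 := by
          apply mul_left_cancel₀ (M₀ := X.left.functionField) hq0
          rw [← mul_assoc, hpq, ← map_mul, ← hr]
          exact (mul_one _).symm
        have h2 := stalkHom_mem f a r hru
        apply h2
        have h3 : algebraMap k _ (c v0 hv0)⁻¹ * lieD hv0 a (stalkHom f a h) * stalkHom f a r = 1 := by
          apply spec_inj a
          rw [map_mul, map_mul, h1, ← hφ, AlgHom.commutes, map_one]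
          have h4 : φ g * φ (specHom (gsp (f.left a)) r) = 1 := by
            rw [← map_mul, hgr, map_one]
          have h5 : algebraMap k Γ.G.left.functionField (c v0 hv0)⁻¹ * algebraMap k Γ.G.left.functionField (c v0 hv0) = 1 := by
            rw [← map_mul, inv_mul_cancel₀ hc0, map_one]
          refine (congrArg (· * _) (mul_assoc _ _ _).symm).trans ?_
          refine (congrArg (fun z => z * φ g * φ (specHom (gsp (f.left a)) r)) h5).trans ?_
          rw [one_mul]
          exact h4
        exact IsUnit.of_mul_eq_one_right _ h3
  choose dX hdX using hst
  refine ⟨dX, c, fun v hv a h => ?_, fun x hx => ?_⟩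
  · apply spec_inj a
    rw [lieD_spec, ← hφ, map_mul, ← hφ, hdX, AlgHom.commutes]
    exact hc v hv _
  · obtain ⟨u, w, h1, h2, h3⟩ := dw_stalk hX δ hδ x hx
    refine ⟨u, IsUnit.of_mul_eq_one_right w ?_⟩
    apply spec_inj x
    rw [map_mul, hdX, map_one]
    exact h3
end pkg
end St6

namespace St6

section rig
variable {k : Type} [Field k] {X : OverR k} {Γ : GroupScheme k}

/-- the tangent formula -/
def LieF (f : Γ.G ⟶ X) (dX : ∀ x : X.left, X.left.presheaf.stalk x → X.left.presheaf.stalk x)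
      (c : ∀ v : specO k (DualNumber k) ⟶ Γ.G, IsTan v → k) : Prop :=
  ∀ v hv a h, lieD hv a (stalkHom f a h) = algebraMap k _ (c v hv) * stalkHom f a (dX (f.left a) h)

lemma pert_f {f : Γ.G ⟶ X} {dX c} (hl : LieF f dX c) {v} (hv : IsTan v)
    {R : Type} [CommRing R] [Algebra k R] [IsLocalRing R] (g : specO k R ⟶ Γ.G) (x : X.left)
    (hx : (g ≫ f).left (IsLocalRing.closedPoint R) = x)
    (θ : X.left.presheaf.stalk x →ₐ[k] R) (hθ : g ≫ f = sMap θ ≫ ptS X x) :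
    ∃ ψ : X.left.presheaf.stalk x →ₐ[k] DualNumber R, pert g v ≫ f = sMap ψ ≫ ptS X x ∧
      ∀ h, (ψ h).fst = θ h ∧ (ψ h).snd = algebraMap k R (c v hv) * θ (dX x h) := by
  obtain ⟨a, ha⟩ : ∃ a, g.left (IsLocalRing.closedPoint R) = a := ⟨_, rfl⟩
  obtain ⟨γ, hγ, -⟩ := exists_pb g a ha
  have hx' : f.left a = x := by rw [← ha]; exact hx
  subst hx'
  have e : θ = γ.comp (stalkHom f a) := by
    apply pb_unique
    rw [← hθ, sMap_comp, Category.assoc, ptS_map, ← Category.assoc, ← hγ]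
  refine ⟨(dMap γ).comp ((dHom v hv a).comp (stalkHom f a)), ?_, fun h => ?_⟩
  · rw [sMap_comp, sMap_comp, Category.assoc, Category.assoc, ptS_map]
    conv_lhs => rw [hγ, ← pert_nat, dHom_spec hv]
    simp only [Category.assoc]
  · have h1 : (dHom v hv a (stalkHom f a h)).fst = stalkHom f a h := DFunLike.congr_fun (dHom_fst hv a) _
    have h2 := hl v hv a h
    rw [lieD_apply] at h2
    rw [e]
    constructor
    · simp [h1]
    · simp [h2]

lemma exists_pbc {R : Type} [CommRing R] [Algebra k R] [IsLocalRing R] (y : specO k R ⟶ X) :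
    ∃ φ : X.left.presheaf.stalk (y.left (IsLocalRing.closedPoint R)) →ₐ[k] R, y = sMap φ ≫ ptS X _ ∧ IsLocalHom φ :=
  exists_pb y _ rfl

lemma pert_congr {f : Γ.G ⟶ X} {dX c} (hl : LieF f dX c) {v v'} (hv : IsTan v) (hv' : IsTan v')
    (hc : c v hv = c v' hv')
    {R : Type} [CommRing R] [Algebra k R] [IsLocalRing R] (g g' : specO k R ⟶ Γ.G) (h : g ≫ f = g' ≫ f) :
    pert g v ≫ f = pert g' v' ≫ f := by
  obtain ⟨θ, hθ, -⟩ := exists_pbc (g ≫ f)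
  obtain ⟨ψ, h1, h2⟩ := pert_f hl hv g _ rfl θ hθ
  obtain ⟨ψ', h1', h2'⟩ := pert_f hl hv' g' _ (by rw [h]) θ (h ▸ hθ)
  rw [h1, h1']
  congr 2
  refine AlgHom.ext fun z => ?_
  ext
  · rw [(h2 z).1, (h2' z).1]
  · rw [(h2 z).2, (h2' z).2, hc]

lemma specOk_hom : (specO k k).hom = 𝟙 _ := by
  change Spec.map (CommRingCat.ofHom (RingHom.id k)) = _
  exact Spec.map_id _

lemma kpoint_closed [IsAlgClosed k] (hX : LocallyOfFiniteType X.hom) (y : specO k k ⟶ X) :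
    IsClosed {y.left (IsLocalRing.closedPoint k)} := by
  have h : y.left ≫ X.hom = 𝟙 _ := (Over.w y).trans specOk_hom
  exact (pointEquivClosedPoint X.hom ⟨y.left, h⟩).2

lemma kpoint_eq [IsAlgClosed k] [hX : LocallyOfFiniteType X.hom] (y : specO k k ⟶ X) (x : X.left)
    (hx : IsClosed {x}) (h : y.left (IsLocalRing.closedPoint k) = x) : y = kpt x hx := by
  obtain ⟨φ, h1, -⟩ := exists_pb y x h
  rw [h1, res_unique (resField_bijective x hx) φ]
  rfl

/-- map to the point -/
def toK (T : OverR k) : T ⟶ specO k k := Over.homMk T.hom (by rw [specOk_hom]; exact Category.comp_id _)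

lemma toK_nat {T T' : OverR k} (y : T ⟶ T') : y ≫ toK T' = toK T := by
  apply Over.OverMorphism.ext
  exact Over.w y

lemma toK_unique {T : OverR k} (y : T ⟶ specO k k) : y = toK T := by
  have h := Over.w y
  rw [specOk_hom] at h
  apply Over.OverMorphism.ext
  exact (Category.comp_id _).symm.trans h

lemma cst_eq {R : Type} [CommRing R] [Algebra k R] : cst k R = toK _ := toK_unique _

theorem star [IsAlgClosed k] [CharZero k] [IsIntegral Γ.G.left] [LocallyOfFiniteType Γ.G.hom]
    (hX : IsCurve X) {f : Γ.G ⟶ X} {dX c} (hl : LieF f dX c) (a a' : specO k k ⟶ Γ.G) (h : a ≫ f = a' ≫ f) :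
    ((toK Γ.G ≫ a) * 𝟙 _) ≫ f = ((toK Γ.G ≫ a') * 𝟙 _) ≫ f := by
  obtain ⟨e, he⟩ : ∃ e, (1 : specO k k ⟶ Γ.G).left (IsLocalRing.closedPoint k) = e := ⟨_, rfl⟩
  have hec : IsClosed {e} := he ▸ kpoint_closed inferInstance _
  have h1 := kpoint_eq _ e hec he
  have hres := resField_bijective e hec
  -- stalkwise translated points
  have key : ∀ b : specO k k ⟶ Γ.G, ∀ x, (b ≫ f).left (IsLocalRing.closedPoint k) = x →
      ∃ φ : X.left.presheaf.stalk x →ₐ[k] Γ.G.left.presheaf.stalk e,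
      ((cst k _ ≫ b) * ptS Γ.G e) ≫ f = sMap φ ≫ ptS X x ∧
      b ≫ f = sMap ((resHom hres).comp φ) ≫ ptS X x ∧
      ∀ v hv h, lieD (v := v) hv e (φ h) = algebraMap k _ (c v hv) * φ (dX x h) := by
    intro b x hx
    have hb : sMap (resHom hres) ≫ ((cst k _ ≫ b) * ptS Γ.G e) = b := by
      rw [comp_mul', ← Category.assoc, sMap_cst]
      have : sMap (resHom hres) ≫ ptS Γ.G e = 1 := h1.symm
      rw [this, mul_one, cst_eq, ← toK_unique (𝟙 _), Category.id_comp]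
    have hx' : (((cst k _ ≫ b) * ptS Γ.G e) ≫ f).left (IsLocalRing.closedPoint _) = x := by
      rw [← hx]
      conv_rhs => rw [← hb, Category.assoc]
      refine Eq.trans ?_ (Scheme.Hom.comp_apply _ _ _).symm
      congr 1
      symm
      refine sMap_closed _ ⟨fun z hz => ?_⟩
      by_contra h5
      rw [(resHom_eq_zero_iff hres z).2 ((IsLocalRing.mem_maximalIdeal _).2 h5)] at hz
      exact not_isUnit_zero hz
    obtain ⟨φ, hφ, -⟩ := exists_pb _ x hx'
    refine ⟨φ, hφ, ?_, fun v hv h => ?_⟩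
    · rw [sMap_comp, Category.assoc, ← hφ, ← Category.assoc, hb]
    · obtain ⟨ψ, h2, h3⟩ := pert_f hl hv _ x hx' φ hφ
      have h4 : ψ = (dHom v hv e).comp φ := by
        apply pb_unique
        rw [← h2, sMap_comp, Category.assoc, ← hφ, ← Category.assoc, pert_left, dHom_spec hv, comp_mul',
          ← Category.assoc, sMap_cst]
      rw [lieD_apply, ← (h3 h).2, h4]
      rfl
  obtain ⟨x, hx⟩ : ∃ x, (a ≫ f).left (IsLocalRing.closedPoint k) = x := ⟨_, rfl⟩
  obtain ⟨φ, hφ1, hφ2, hφ3⟩ := key a x hx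
  obtain ⟨φ', hφ1', hφ2', hφ3'⟩ := key a' x (h ▸ hx)
  have hcomp : (resHom hres).comp φ = (resHom hres).comp φ' := by
    apply pb_unique
    rw [← hφ2, ← hφ2', h]
  have hN : Ideal.span {z | ∃ h, z = φ h - φ' h} = ⊥ := by
    apply stable_eq_bot hres (lieD_tangentFamily e hec)
    · apply ne_top_of_le_ne_top (IsLocalRing.maximalIdeal.isMaximal _).ne_top
      rw [Ideal.span_le]
      rintro _ ⟨h, rfl⟩
      refine (resHom_eq_zero_iff hres _).1 ?_
      rw [map_sub, sub_eq_zero]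
      exact DFunLike.congr_fun hcomp h
    · rintro _ ⟨v, hv, rfl⟩
      apply span_stable
      rintro _ ⟨h, rfl⟩
      rw [map_sub, hφ3, hφ3', ← mul_sub]
      exact Ideal.mul_mem_left _ _ (Ideal.subset_span ⟨_, rfl⟩)
  have hφφ : φ = φ' := by
    refine AlgHom.ext fun z => sub_eq_zero.1 ?_
    rw [← Ideal.mem_bot, ← hN]
    exact Ideal.subset_span ⟨_, rfl⟩
  have hpt : ∀ b : specO k k ⟶ Γ.G, ptS Γ.G e ≫ ((toK Γ.G ≫ b) * 𝟙 _) = (cst k _ ≫ b) * ptS Γ.G e := by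
    intro b
    rw [comp_mul', ← Category.assoc, toK_nat, Category.comp_id, cst_eq]
  have hst : ptS Γ.G e ≫ (((toK Γ.G ≫ a) * 𝟙 _) ≫ f) = ptS Γ.G e ≫ (((toK Γ.G ≫ a') * 𝟙 _) ≫ f) := by
    rw [← Category.assoc, ← Category.assoc, hpt, hpt, hφ1, hφ1', hφφ]
  have := hX.sep
  apply Over.OverMorphism.ext
  have hd : IsDominant (Γ.G.left.fromSpecStalk e) := by
    have := isDominant_generic Γ.G.left
    rw [← Scheme.SpecMap_stalkSpecializes_fromSpecStalk (gsp e)] at this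
    exact IsDominant.of_comp (Spec.map (Γ.G.left.presheaf.stalkSpecializes (gsp e))) _
  refine ext_of_isDominant_of_isSeparated X.hom ?_ (Γ.G.left.fromSpecStalk e) ?_
  · rw [Over.w, Over.w]
  · exact congrArg (·.left) hst

lemma star_T [IsAlgClosed k] [CharZero k] [IsIntegral Γ.G.left] [LocallyOfFiniteType Γ.G.hom]
    (hX : IsCurve X) {f : Γ.G ⟶ X} {dX c} (hl : LieF f dX c) (a a' : specO k k ⟶ Γ.G) (h : a ≫ f = a' ≫ f)
    (b : specO k k ⟶ Γ.G) : (a * b) ≫ f = (a' * b) ≫ f := by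
  have h2 := congrArg (b ≫ ·) (star hX hl a a' h)
  have hb : ∀ a : specO k k ⟶ Γ.G, b ≫ ((toK Γ.G ≫ a) * 𝟙 _) = a * b := by
    intro a
    rw [comp_mul', ← Category.assoc, toK_nat, Category.comp_id, ← toK_unique (𝟙 _), Category.id_comp]
  simp only [← Category.assoc, hb] at h2
  exact h2

end rig
end St6

namespace St6

section fib
variable {k : Type} [Field k] {X Y Z T : OverR k}

/-- fibre product of schemes over k -/
def fib (f : Y ⟶ X) (g : Z ⟶ X) : OverR k := Over.mk (pullback.fst f.left g.left ≫ Y.hom)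

/-- first projection -/
def fibFst (f : Y ⟶ X) (g : Z ⟶ X) : fib f g ⟶ Y := Over.homMk (pullback.fst f.left g.left) rfl

/-- second projection -/
def fibSnd (f : Y ⟶ X) (g : Z ⟶ X) : fib f g ⟶ Z := Over.homMk (pullback.snd f.left g.left) (by
  change _ = pullback.fst f.left g.left ≫ Y.hom
  rw [← Over.w f, ← Over.w g, pullback.condition_assoc]
  rfl)

lemma fib_w (f : Y ⟶ X) (g : Z ⟶ X) : fibFst f g ≫ f = fibSnd f g ≫ g := by
  apply Over.OverMorphism.ext
  exact pullback.condition

/-- universal property -/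
def fibLift (f : Y ⟶ X) (g : Z ⟶ X) (a : T ⟶ Y) (b : T ⟶ Z) (h : a ≫ f = b ≫ g) : T ⟶ fib f g :=
  Over.homMk (pullback.lift a.left b.left (congrArg (·.left) h)) (by
    change _ ≫ pullback.fst f.left g.left ≫ Y.hom = _
    rw [pullback.lift_fst_assoc, Over.w])

lemma fibLift_fst (f : Y ⟶ X) (g : Z ⟶ X) (a : T ⟶ Y) (b : T ⟶ Z) (h : a ≫ f = b ≫ g) :
    fibLift f g a b h ≫ fibFst f g = a := by
  apply Over.OverMorphism.ext
  exact pullback.lift_fst _ _ _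

lemma fibLift_snd (f : Y ⟶ X) (g : Z ⟶ X) (a : T ⟶ Y) (b : T ⟶ Z) (h : a ≫ f = b ≫ g) :
    fibLift f g a b h ≫ fibSnd f g = b := by
  apply Over.OverMorphism.ext
  exact pullback.lift_snd _ _ _

lemma fib_ext (f : Y ⟶ X) (g : Z ⟶ X) {a b : T ⟶ fib f g} (h1 : a ≫ fibFst f g = b ≫ fibFst f g)
    (h2 : a ≫ fibSnd f g = b ≫ fibSnd f g) : a = b := by
  apply Over.OverMorphism.ext
  exact pullback.hom_ext (congrArg (·.left) h1) (congrArg (·.left) h2)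

lemma fib_proper (f : Y ⟶ X) (g : Z ⟶ X) [IsProper Y.hom] [IsProper g.left] : IsProper (fib f g).hom := by
  change IsProper (pullback.fst f.left g.left ≫ Y.hom)
  infer_instance

instance toK_proper [h : IsProper Y.hom] : IsProper (toK Y).left := h

end fib

section W
variable {k : Type} [Field k] {X : OverR k} {Γ : GroupScheme k} [IsAlgClosed k] [CharZero k]

lemma kpt_pt {W : OverR k} [LocallyOfFiniteType W.hom] (w : W.left) (hw : IsClosed {w}) :
    (kpt w hw).left (IsLocalRing.closedPoint k) = w := by
  refine (Scheme.Hom.comp_apply _ _ _).trans ?_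
  refine (congrArg _ (sMap_closed _ ⟨fun z hz => ?_⟩)).trans (ptS_closed w)
  by_contra h5
  rw [(resHom_eq_zero_iff (resField_bijective w hw) z).2 ((IsLocalRing.mem_maximalIdeal _).2 h5)] at hz
  exact not_isUnit_zero hz

/-- tangent vectors from dual number points -/
lemma exists_tan (y : specO k (DualNumber k) ⟶ Γ.G) (a : specO k k ⟶ Γ.G) (ha : sMap (dFst k k) ≫ y = a) :
    ∃ v, IsTan v ∧ pert a v = y := by
  refine ⟨(cst k (DualNumber k) ≫ a)⁻¹ * y, ?_, ?_⟩
  · have h1 : cst k k = 𝟙 _ := by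
      rw [cst, ← sMap_id]
      congr 1
    rw [IsTan, comp_mul', comp_inv', ha, ← Category.assoc, sMap_cst, h1, Category.id_comp, inv_mul_cancel]
  · rw [pert_kk]
    exact mul_inv_cancel_left _ _

lemma c_eq (hX : IsCurve X) {f : Γ.G ⟶ X} {dX c} (hl : LieF f dX c) (hu : ∀ x, IsClosed {x} → ∃ u, IsUnit (dX x u))
    (a a' : specO k k ⟶ Γ.G) (h : a ≫ f = a' ≫ f) {v v'} (hv : IsTan v) (hv' : IsTan v')
    (h2 : pert a v ≫ f = pert a' v' ≫ f) : c v hv = c v' hv' := by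
  obtain ⟨x, hx⟩ : ∃ x, (a ≫ f).left (IsLocalRing.closedPoint k) = x := ⟨_, rfl⟩
  obtain ⟨θ, hθ, -⟩ := exists_pb (a ≫ f) x hx
  obtain ⟨ψ, h3, h4⟩ := pert_f hl hv a x hx θ hθ
  obtain ⟨ψ', h3', h4'⟩ := pert_f hl hv' a' x (by rw [← hx, h]) θ (h ▸ hθ)
  have e : ψ = ψ' := by
    apply pb_unique
    rw [← h3, ← h3', h2]
  have hxc : IsClosed {x} := hx ▸ kpoint_closed hX.lft _
  obtain ⟨u, hu⟩ := hu x hxc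
  have h5 := (h4 u).2
  rw [e, (h4' u).2] at h5
  exact ((hu.map θ).mul_left_injective h5).symm

lemma W_reduced (hX : IsCurve X) {f : Γ.G ⟶ X} {dX c} (hl : LieF f dX c)
    (hu : ∀ x, IsClosed {x} → ∃ u, IsUnit (dX x u))
    (W : OverR k) [LocallyOfFiniteType W.hom] [QuasiCompact W.hom] (p q b : W ⟶ Γ.G) (hpq : p ≫ f = q ≫ f)
    (hex : ∀ (T : OverR k) (p' q' b' : T ⟶ Γ.G), p' ≫ f = q' ≫ f → ∃ t : T ⟶ W, t ≫ p = p' ∧ t ≫ q = q' ∧ t ≫ b = b')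
    (hun : ∀ (T : OverR k) (t t' : T ⟶ W), t ≫ p = t' ≫ p → t ≫ q = t' ≫ q → t ≫ b = t' ≫ b → t = t') :
    IsReduced W.left := by
  have hc : ∀ w : W.left, IsClosed {w} → IsDomain (W.left.presheaf.stalk w) := by
    intro w hw
    have hk := resField_bijective w hw
    refine isDomain_of_tangentFamily hk (S := Set.univ) (tangentFamily_of hk _ fun φ => ?_)
    let y := sMap φ ≫ ptS W w
    have hy : sMap (dFst k k) ≫ y = sMap (resHom hk) ≫ ptS W w := by
      rw [← Category.assoc, ← sMap_comp, res_unique hk ((dFst k k).comp φ)]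
    have h0 : ∀ g : W ⟶ Γ.G, sMap (dFst k k) ≫ (y ≫ g) = (sMap (resHom hk) ≫ ptS W w) ≫ g := by
      intro g
      rw [← Category.assoc, hy]
    obtain ⟨v1, hv1, e1⟩ := exists_tan (y ≫ p) _ (h0 p)
    obtain ⟨v2, hv2, e2⟩ := exists_tan (y ≫ q) _ (h0 q)
    obtain ⟨v3, hv3, e3⟩ := exists_tan (y ≫ b) _ (h0 b)
    have hcc : c v1 hv1 = c v2 hv2 := by
      refine c_eq hX hl hu ((sMap (resHom hk) ≫ ptS W w) ≫ p) ((sMap (resHom hk) ≫ ptS W w) ≫ q) ?_ hv1 hv2 ?_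
      · rw [Category.assoc, hpq, ← Category.assoc]
      · rw [e1, e2, Category.assoc, hpq, ← Category.assoc]
    obtain ⟨Φ, hΦ1, hΦ2, hΦ3⟩ := hex _ (pert (ptS W w ≫ p) v1) (pert (ptS W w ≫ q) v2) (pert (ptS W w ≫ b) v3)
      (pert_congr hl hv1 hv2 hcc _ _ (by rw [Category.assoc, hpq, ← Category.assoc]))
    obtain ⟨ψ, hψ1, hψ2⟩ := exists_dHom (AlgHom.id k _) ⟨fun a h => h⟩ Φ (by
      rw [sMap_id, Category.id_comp]
      apply hun
      · rw [Category.assoc, hΦ1, pert_fst _ hv1]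
      · rw [Category.assoc, hΦ2, pert_fst _ hv2]
      · rw [Category.assoc, hΦ3, pert_fst _ hv3])
    refine ⟨derOf (AlgHom.id k _) (fun _ => rfl) ψ hψ1, trivial, fun r => ?_⟩
    have h1 : (dMap (resHom hk)).comp ψ = φ := by
      apply pb_unique
      rw [sMap_comp, Category.assoc, ← hψ2]
      apply hun
      · rw [Category.assoc, hΦ1, pert_nat, ← Category.assoc, e1]
      · rw [Category.assoc, hΦ2, pert_nat, ← Category.assoc, e2]
      · rw [Category.assoc, hΦ3, pert_nat, ← Category.assoc, e3]
    have h2 := congrArg TrivSqZeroExt.snd (DFunLike.congr_fun h1 r)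
    change resHom hk (TrivSqZeroExt.snd (ψ r)) = _
    simpa using h2
  have : CompactSpace W.left := compactSpace_left
  have : ∀ x : W.left, _root_.IsReduced (W.left.presheaf.stalk x) := by
    intro x
    obtain ⟨y, hxy, hy⟩ := exists_closed_spec W.left x
    have := hc y hy
    exact isReduced_stalk_of_specializes W.left hxy
  exact isReduced_of_isReduced_stalk _

theorem S1 (hX : IsCurve X) {f : Γ.G ⟶ X} {dX c} (hl : LieF f dX c)
    (hu : ∀ x, IsClosed {x} → ∃ u, IsUnit (dX x u)) [IsProper Γ.G.hom] [IsIntegral Γ.G.left] [IsProper f.left]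
    (T : OverR k) (a a' b : T ⟶ Γ.G) (h : a ≫ f = a' ≫ f) : (a * b) ≫ f = (a' * b) ≫ f := by
  have := hX.sep
  have := hX.lft
  let E := fib f f
  have : IsProper E.hom := fib_proper f f
  let W := fib (toK E) (toK Γ.G)
  have hWp : IsProper W.hom := fib_proper _ _
  let p : W ⟶ Γ.G := fibFst _ _ ≫ fibFst f f
  let q : W ⟶ Γ.G := fibFst _ _ ≫ fibSnd f f
  let r : W ⟶ Γ.G := fibSnd _ _
  have hpq : p ≫ f = q ≫ f := by rw [Category.assoc, Category.assoc, fib_w]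
  have hex : ∀ (T : OverR k) (p' q' b' : T ⟶ Γ.G), p' ≫ f = q' ≫ f →
      ∃ t : T ⟶ W, t ≫ p = p' ∧ t ≫ q = q' ∧ t ≫ r = b' := by
    intro T p' q' b' h
    refine ⟨fibLift _ _ (fibLift f f p' q' h) b' (by rw [toK_nat, toK_nat]), ?_, ?_, ?_⟩
    · rw [← Category.assoc, fibLift_fst, fibLift_fst]
    · rw [← Category.assoc, fibLift_fst, fibLift_snd]
    · rw [fibLift_snd]
  have hred : IsReduced W.left := by
    refine W_reduced hX hl hu W p q r hpq hex fun T t t' h1 h2 h3 => ?_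
    refine fib_ext _ _ (fib_ext _ _ ?_ ?_) h3
    · simpa using h1
    · simpa using h2
  have main : (p * r) ≫ f = (q * r) ≫ f := by
    apply Over.OverMorphism.ext
    have hl2 : LocallyOfFiniteType (((p * r) ≫ f).left ≫ X.hom) := by rw [Over.w]; infer_instance
    refine ext_of_apply_eq X.hom Set.univ isClosed_univ.isLocallyClosed dense_univ (fun w _ hw => ?_) (by rw [Over.w, Over.w])
    have h1 := star_T hX hl (kpt w hw ≫ p) (kpt w hw ≫ q) (by rw [Category.assoc, hpq, ← Category.assoc]) (kpt w hw ≫ r)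
    rw [← comp_mul', ← comp_mul', Category.assoc, Category.assoc] at h1
    have hz : ∀ g : W ⟶ X, (kpt w hw ≫ g).left (IsLocalRing.closedPoint k) = g.left w := by
      intro g
      refine (Scheme.Hom.comp_apply _ _ _).trans ?_
      rw [kpt_pt]
    rw [← hz, ← hz, h1]
  obtain ⟨t, h1, h2, h3⟩ := hex T a a' b h
  have := congrArg (t ≫ ·) main
  simp only [← Category.assoc, comp_mul', h1, h2, h3] at this
  exact this

end W
end St6

namespace St6

section op
variable {k : Type} [Field k] {X : OverR k} {Γ : GroupScheme k}

/-- opposite group scheme -/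
def opG (Γ : GroupScheme k) : GroupScheme k where
  G := Γ.G
  mul {T} a b := (b * a : T ⟶ Γ.G)
  one T := (1 : T ⟶ Γ.G)
  inv {T} a := (a⁻¹ : T ⟶ Γ.G)
  mul_assoc a b c := (_root_.mul_assoc _ _ _).symm
  one_mul a := _root_.mul_one _
  inv_mul a := mul_inv_cancel _
  mul_natural f a b := comp_mul' f b a
  one_natural f := comp_one' f

theorem S12 [IsAlgClosed k] [CharZero k] [IsIntegral Γ.G.left] [IsIntegral X.left] [IsProper Γ.G.hom]
    (hX : IsCurve X) (f : Γ.G ⟶ X) (hf : ¬ IsConstant f) (hno : ¬ ∃ s : X.left.functionField, FieldGen k s)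
    (T : OverR k) (a a' b b' : T ⟶ Γ.G) (ha : a ≫ f = a' ≫ f) (hb : b ≫ f = b' ≫ f) :
    (a * b) ≫ f = (a' * b') ≫ f := by
  have hp := f_proper hX f
  obtain ⟨dX, c, h1, h2⟩ := lie_pkg hX f hf hno
  have e1 := S1 hX h1 h2 T a a' b ha
  have i1 : IsIntegral (opG Γ).G.left := ‹IsIntegral Γ.G.left›
  have i2 : IsProper (opG Γ).G.hom := ‹IsProper Γ.G.hom›
  have hp2 := f_proper (Γ := opG Γ) hX f
  obtain ⟨dX', c', h1', h2'⟩ := lie_pkg (Γ := opG Γ) hX f hf hno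
  have e2 := S1 (Γ := opG Γ) hX h1' h2' T b b' a' hb
  exact e1.trans e2

theorem S_inv [IsAlgClosed k] [CharZero k] [IsIntegral Γ.G.left] [IsIntegral X.left] [IsProper Γ.G.hom]
    (hX : IsCurve X) (f : Γ.G ⟶ X) (hf : ¬ IsConstant f) (hno : ¬ ∃ s : X.left.functionField, FieldGen k s)
    (T : OverR k) (a a' : T ⟶ Γ.G) (ha : a ≫ f = a' ≫ f) :
    a⁻¹ ≫ f = a'⁻¹ ≫ f := by
  have h1 := S12 hX f hf hno T (a⁻¹ * a) (a⁻¹ * a') a'⁻¹ a'⁻¹ (S12 hX f hf hno T _ _ _ _ rfl ha) rfl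
  rw [inv_mul_cancel, one_mul, mul_assoc, mul_inv_cancel, mul_one] at h1
  exact h1.symm

end op
end St6

namespace St6

section cov
variable {k : Type} [Field k] {X Y Z T T' T'' : OverR k}

/-- fpqc covers -/
structure Cov (p : T' ⟶ T) : Prop where
  flat : Flat p.left
  surj : Surjective p.left
  qc : QuasiCompact p.left

lemma Cov.comp {p : T' ⟶ T} {q : T'' ⟶ T'} (hp : Cov p) (hq : Cov q) : Cov (q ≫ p) := by
  obtain ⟨h1, h2, h3⟩ := hp
  obtain ⟨h1', h2', h3'⟩ := hq
  refine ⟨?_, ?_, ?_⟩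
  · rw [Over.comp_left]; infer_instance
  · rw [Over.comp_left]; infer_instance
  · rw [Over.comp_left]; infer_instance

lemma Cov.epi {p : T' ⟶ T} (hp : Cov p) : Epi p := by
  obtain ⟨h1, h2, h3⟩ := hp
  have : Epi p.left := Flat.epi_of_flat_of_surjective p.left
  exact Over.epi_of_epi_left p

lemma Cov.fst (f : Y ⟶ X) {g : Z ⟶ X} (hg : Cov g) : Cov (fibFst f g) := by
  obtain ⟨h1, h2, h3⟩ := hg
  refine ⟨?_, ?_, ?_⟩
  · change Flat (pullback.fst f.left g.left); infer_instance
  · change Surjective (pullback.fst f.left g.left); infer_instance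
  · change QuasiCompact (pullback.fst f.left g.left); infer_instance

lemma Cov.desc {p : T' ⟶ T} (hp : Cov p) (h : T' ⟶ X)
    (H : ∀ (S : OverR k) (u w : S ⟶ T'), u ≫ p = w ≫ p → u ≫ h = w ≫ h) : ∃ m : T ⟶ X, p ≫ m = h := by
  have hepi := hp.epi
  obtain ⟨h1, h2, h3⟩ := hp
  have H' : ∀ {S : Scheme.{0}} (u w : S ⟶ T'.left), u ≫ p.left = w ≫ p.left → u ≫ h.left = w ≫ h.left := by
    intro S u w e
    let S' : OverR k := Over.mk (u ≫ T'.hom)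
    let u' : S' ⟶ T' := Over.homMk u rfl
    let w' : S' ⟶ T' := Over.homMk w (by
      change w ≫ T'.hom = u ≫ T'.hom
      rw [← Over.w p]
      exact (Category.assoc _ _ _).symm.trans ((congrArg (· ≫ T.hom) e.symm).trans (Category.assoc _ _ _)))
    exact congrArg (·.left) (H S' u' w' (Over.OverMorphism.ext e))
  have hf := EffectiveEpi.fac p.left h.left H'
  refine ⟨Over.homMk (EffectiveEpi.desc p.left h.left H') ?_, ?_⟩
  · have : Epi p.left := Flat.epi_of_flat_of_surjective p.left
    rw [← cancel_epi p.left, ← Category.assoc, hf, Over.w, Over.w]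
  · apply Over.OverMorphism.ext
    exact hf

end cov

section quot
variable {k : Type} [Field k] {X : OverR k} {Γ : GroupScheme k} (f : Γ.G ⟶ X)

lemma exists_lift (hf : Cov f) {T : OverR k} (a : T ⟶ X) :
    ∃ (T' : OverR k) (p : T' ⟶ T) (a' : T' ⟶ Γ.G), Cov p ∧ a' ≫ f = p ≫ a :=
  ⟨fib a f, fibFst a f, fibSnd a f, hf.fst a, (fib_w a f).symm⟩

lemma exists_lift2 (hf : Cov f) {T : OverR k} (a b : T ⟶ X) :
    ∃ (T' : OverR k) (p : T' ⟶ T) (a' b' : T' ⟶ Γ.G), Cov p ∧ a' ≫ f = p ≫ a ∧ b' ≫ f = p ≫ b := by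
  obtain ⟨T1, p1, a1, h1, e1⟩ := exists_lift f hf a
  obtain ⟨T2, p2, b2, h2, e2⟩ := exists_lift f hf (p1 ≫ b)
  refine ⟨T2, p2 ≫ p1, p2 ≫ a1, b2, h1.comp h2, ?_, ?_⟩
  · rw [Category.assoc, e1, Category.assoc]
  · rw [e2, Category.assoc]

lemma exists_lift3 (hf : Cov f) {T : OverR k} (a b c : T ⟶ X) :
    ∃ (T' : OverR k) (p : T' ⟶ T) (a' b' c' : T' ⟶ Γ.G), Cov p ∧ a' ≫ f = p ≫ a ∧ b' ≫ f = p ≫ b ∧ c' ≫ f = p ≫ c := by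
  obtain ⟨T1, p1, a1, b1, h1, e1, e1'⟩ := exists_lift2 f hf a b
  obtain ⟨T2, p2, c2, h2, e2⟩ := exists_lift f hf (p1 ≫ c)
  refine ⟨T2, p2 ≫ p1, p2 ≫ a1, p2 ≫ b1, c2, h1.comp h2, ?_, ?_, ?_⟩
  · rw [Category.assoc, e1, Category.assoc]
  · rw [Category.assoc, e1', Category.assoc]
  · rw [e2, Category.assoc]

lemma exists_qmul (hf : Cov f)
    (hS : ∀ (T : OverR k) (a a' b b' : T ⟶ Γ.G), a ≫ f = a' ≫ f → b ≫ f = b' ≫ f → (a * b) ≫ f = (a' * b') ≫ f)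
    {T : OverR k} (a b : T ⟶ X) :
    ∃ m : T ⟶ X, ∀ (S : OverR k) (q : S ⟶ T) (a' b' : S ⟶ Γ.G), a' ≫ f = q ≫ a → b' ≫ f = q ≫ b →
      q ≫ m = (a' * b') ≫ f := by
  obtain ⟨T', p, a1, b1, hp, ea, eb⟩ := exists_lift2 f hf a b
  obtain ⟨m, hm⟩ := hp.desc ((a1 * b1) ≫ f) (fun S u w e => by
    rw [← Category.assoc, ← Category.assoc, comp_mul', comp_mul']
    apply hS
    · rw [Category.assoc, Category.assoc, ea, ← Category.assoc, ← Category.assoc, e]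
    · rw [Category.assoc, Category.assoc, eb, ← Category.assoc, ← Category.assoc, e])
  refine ⟨m, fun S q a' b' ha hb => ?_⟩
  have := (hp.fst q).epi
  have hw := fib_w q p
  rw [← cancel_epi (fibFst q p), ← Category.assoc, hw, Category.assoc, hm, ← Category.assoc, ← Category.assoc,
    comp_mul', comp_mul']
  apply hS
  · rw [Category.assoc, Category.assoc, ea, ha, ← Category.assoc, ← Category.assoc, hw]
  · rw [Category.assoc, Category.assoc, eb, hb, ← Category.assoc, ← Category.assoc, hw]

lemma exists_qinv (hf : Cov f)
    (hI : ∀ (T : OverR k) (a a' : T ⟶ Γ.G), a ≫ f = a' ≫ f → a⁻¹ ≫ f = a'⁻¹ ≫ f)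
    {T : OverR k} (a : T ⟶ X) :
    ∃ m : T ⟶ X, ∀ (S : OverR k) (q : S ⟶ T) (a' : S ⟶ Γ.G), a' ≫ f = q ≫ a → q ≫ m = a'⁻¹ ≫ f := by
  obtain ⟨T', p, a1, hp, ea⟩ := exists_lift f hf a
  obtain ⟨m, hm⟩ := hp.desc (a1⁻¹ ≫ f) (fun S u w e => by
    rw [← Category.assoc, ← Category.assoc, comp_inv', comp_inv']
    apply hI
    rw [Category.assoc, Category.assoc, ea, ← Category.assoc, ← Category.assoc, e])
  refine ⟨m, fun S q a' ha => ?_⟩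
  have := (hp.fst q).epi
  have hw := fib_w q p
  rw [← cancel_epi (fibFst q p), ← Category.assoc, hw, Category.assoc, hm, ← Category.assoc, ← Category.assoc,
    comp_inv', comp_inv']
  apply hI
  rw [Category.assoc, Category.assoc, ea, ha, ← Category.assoc, ← Category.assoc, hw]

theorem exists_quot (hf : Cov f)
    (hS : ∀ (T : OverR k) (a a' b b' : T ⟶ Γ.G), a ≫ f = a' ≫ f → b ≫ f = b' ≫ f → (a * b) ≫ f = (a' * b') ≫ f)
    (hI : ∀ (T : OverR k) (a a' : T ⟶ Γ.G), a ≫ f = a' ≫ f → a⁻¹ ≫ f = a'⁻¹ ≫ f) :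
    ∃ Δ : GroupScheme k, Δ.G = X := by
  choose mul hmul using fun (T : OverR k) (a b : T ⟶ X) => exists_qmul f hf hS a b
  choose inv hinv using fun (T : OverR k) (a : T ⟶ X) => exists_qinv f hf hI a
  refine ⟨{ G := X, mul := fun {T} a b => mul T a b, one := fun T => (1 : T ⟶ Γ.G) ≫ f, inv := fun {T} a => inv T a,
            mul_assoc := ?_, one_mul := ?_, inv_mul := ?_, mul_natural := ?_, one_natural := ?_ }, rfl⟩
  · intro T a b c
    obtain ⟨T', p, a', b', c', hp, ea, eb, ec⟩ := exists_lift3 f hf a b c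
    have := hp.epi
    rw [← cancel_epi p, hmul T (mul T a b) c T' p (a' * b') c' (hmul T a b T' p a' b' ea eb).symm ec,
      hmul T a (mul T b c) T' p a' (b' * c') ea (hmul T b c T' p b' c' eb ec).symm, mul_assoc]
  · intro T a
    obtain ⟨T', p, a', hp, ea⟩ := exists_lift f hf a
    have := hp.epi
    rw [← cancel_epi p, hmul T _ a T' p 1 a' (by rw [← Category.assoc, comp_one']) ea, one_mul, ea]
  · intro T a
    obtain ⟨T', p, a', hp, ea⟩ := exists_lift f hf a
    have := hp.epi
    rw [← cancel_epi p, hmul T _ a T' p a'⁻¹ a' (hinv T a T' p a' ea).symm ea, inv_mul_cancel, ← Category.assoc,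
      comp_one']
  · intro T T' g a b
    obtain ⟨T1, p, a', b', hp, ea, eb⟩ := exists_lift2 f hf (g ≫ a) (g ≫ b)
    have := hp.epi
    rw [← cancel_epi p, hmul T _ _ T1 p a' b' ea eb, ← Category.assoc,
      hmul T' a b T1 (p ≫ g) a' b' (by rw [ea, Category.assoc]) (by rw [eb, Category.assoc])]
  · intro T T' g
    rw [← Category.assoc, comp_one']

end quot

section final
variable {k : Type} [Field k] {X : OverR k} {Γ : GroupScheme k} [IsAlgClosed k] [CharZero k] [IsIntegral Γ.G.left]
  [IsIntegral X.left] [IsProper Γ.G.hom]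

lemma f_cov (hX : IsCurve X) (f : Γ.G ⟶ X) (hf : ¬ IsConstant f) : Cov f := by
  have hg := generic_of_nonconst hX f hf
  obtain ⟨φ, hφ⟩ := exists_gen_hom f hg
  have := f_proper hX f
  refine ⟨?_, ⟨f_surj hX f hg⟩, inferInstance⟩
  apply Flat.of_stalkMap
  intro a
  have hv := hX.valuationRing (f.left a)
  have hinj : Function.Injective (stalkHom f a) := by
    intro r s h
    apply spec_inj (f.left a)
    apply φ.injective
    exact (hφ a r).trans ((congrArg _ h).trans (hφ a s).symm)
  change (stalkHom f a).toRingHom.Flat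
  let alg := (stalkHom f a).toRingHom.toAlgebra
  change Module.Flat (X.left.presheaf.stalk (f.left a)) (Γ.G.left.presheaf.stalk a)
  have hb : IsBezout (X.left.presheaf.stalk (f.left a)) := inferInstance
  rw [Module.Flat.flat_iff_torsion_eq_bot_of_isBezout, eq_bot_iff]
  rintro m ⟨⟨r, hr⟩, h⟩
  have h2 : stalkHom f a r * m = 0 := h
  rcases mul_eq_zero.1 h2 with h3 | h3
  · exact absurd (hinj (h3.trans (map_zero _).symm)) (nonZeroDivisors.ne_zero hr)
  · exact h3

lemma proper_of_nonconst (hX : IsCurve X) (f : Γ.G ⟶ X) (hf : ¬ IsConstant f) : IsProper X.hom := by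
  have h1 := (f_cov hX f hf).surj
  have := hX.sep
  have := hX.lft
  have := hX.qc
  have h : UniversallyClosed (f.left ≫ X.hom) := by rw [Over.w]; infer_instance
  have : UniversallyClosed X.hom := .of_comp_surjective f.left X.hom
  exact {}

theorem av_case (hX : IsCurve X) (f : Γ.G ⟶ X) (hf : ¬ IsConstant f) :
    Nonempty (X ≅ P1 k) ∨ (IsProper X.hom ∧ ∃ Δ : GroupScheme k, Δ.IsAbelianVariety ∧ Δ.G = X) := by
  have hp := proper_of_nonconst hX f hf
  by_cases h : ∃ s : X.left.functionField, FieldGen k s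
  · obtain ⟨s, hs⟩ := h
    exact Or.inl (p1_of_fieldGen_proper hX s hs)
  · obtain ⟨Δ, hΔ⟩ := exists_quot f (f_cov hX f hf) (S12 hX f hf h) (S_inv hX f hf h)
    refine Or.inr ⟨hp, Δ, ⟨⟨?_, ?_, ?_⟩, ?_⟩, hΔ⟩ <;> rw [hΔ]
    · exact hX.lft
    · exact hX.qc
    · infer_instance
    · exact hp

end final
end St6

namespace St6

section fin
variable {k : Type} [Field k] {X Y : OverR k}

lemma gm_id_nonconst : ¬ IsConstant (𝟙 (GmO k)) := by
  rintro ⟨y, hy⟩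
  obtain ⟨ψ, rfl⟩ := Spec.map_surjective y
  have h1 : Spec.map (𝟙 _) = Spec.map (ψ ≫ CommRingCat.ofHom (algebraMap k (LaurentPolynomial k))) :=
    (Spec.map_id _).trans (hy.trans (Spec.map_comp _ _).symm)
  have h2 := Spec.map_injective h1
  have h3 : (LaurentPolynomial.T 1 : LaurentPolynomial k) = LaurentPolynomial.C (ψ.hom (LaurentPolynomial.T 1)) :=
    congr($h2 (LaurentPolynomial.T 1))
  have h4 := LaurentPolynomial.degree_C_le (ψ.hom (LaurentPolynomial.T 1))
  rw [← h3, LaurentPolynomial.degree_T] at h4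
  exact absurd h4 (by decide)

lemma gm_mono_nonconst (g : GmO k ⟶ X) [Mono g.left] : ¬ IsConstant g := fun h =>
  gm_id_nonconst (const_of_mono (𝟙 _) g (by rwa [Category.id_comp]))

lemma id_nonconst (hdim : topologicalKrullDim X.left = 1) (e : X ≅ Y) (f : Y ⟶ X) (hf : f = e.inv) : ¬ IsConstant f := by
  subst hf
  rintro ⟨y, hy⟩
  have hs : Subsingleton X.left := by
    have h1 : ∀ x : X.left, x = y (IsLocalRing.closedPoint k) := by
      intro x
      have h2 : e.hom.left ≫ e.inv.left = 𝟙 X.left := congrArg (·.left) e.hom_inv_id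
      have h3 : e.inv.left (e.hom.left x) = x :=
        (Scheme.Hom.comp_apply _ _ _).symm.trans ((congr($h2 x)).trans rfl)
      rw [← h3, hy]
      refine (Scheme.Hom.comp_apply _ _ _).trans ?_
      exact congrArg y (Subsingleton.elim (α := PrimeSpectrum k) _ _)
    exact ⟨fun a b => (h1 a).trans (h1 b).symm⟩
  have h5 : topologicalKrullDim X.left ≤ 0 := by
    have : Subsingleton (TopologicalSpace.IrreducibleCloseds X.left) := by
      constructor
      intro a b
      apply TopologicalSpace.IrreducibleCloseds.ext
      obtain ⟨x, hx⟩ := a.isIrreducible.nonempty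
      obtain ⟨z, hz⟩ := b.isIrreducible.nonempty
      ext w
      rw [Subsingleton.elim w x]
      exact ⟨fun _ => Subsingleton.elim z x ▸ hz, fun _ => hx⟩
    exact Order.krullDim_nonpos_of_subsingleton
  rw [hdim] at h5
  exact absurd h5 (by decide)

theorem main [IsAlgClosed k] [CharZero k]
    (hX : IsVarietyOver X) (hsmooth : IsSmooth X.hom)
    (hconn : ConnectedSpace X.left) (hdim : topologicalKrullDim X.left = 1) :
    IsGroupless k X ↔
      (¬ Nonempty (X ≅ P1 k)) ∧ (¬ Nonempty (X ≅ A1O k)) ∧ (¬ Nonempty (X ≅ GmO k)) ∧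
      (¬ ∃ D : SmoothProjectiveCurve k, D.genus = 1 ∧ Nonempty (X ≅ D.C)) := by
  constructor
  · rintro ⟨h1, h2⟩
    refine ⟨?_, ?_, ?_, ?_⟩
    · rintro ⟨e⟩
      have : Mono (gmShift (0 : k) ≫ chartO 0 ≫ e.inv).left := by
        have : IsIso e.inv.left := inferInstanceAs (IsIso ((Over.forget _).map e.inv))
        change Mono ((gmShift (0 : k)).left ≫ (chartO 0).left ≫ e.inv.left)
        infer_instance
      exact gm_mono_nonconst _ (h1 (gmShift 0 ≫ chartO 0 ≫ e.inv))
    · rintro ⟨e⟩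
      have : Mono (gmShift (0 : k) ≫ e.inv).left := by
        have : IsIso e.inv.left := inferInstanceAs (IsIso ((Over.forget _).map e.inv))
        change Mono ((gmShift (0 : k)).left ≫ e.inv.left)
        infer_instance
      exact gm_mono_nonconst _ (h1 (gmShift 0 ≫ e.inv))
    · rintro ⟨e⟩
      have : IsIso e.inv.left := inferInstanceAs (IsIso ((Over.forget _).map e.inv))
      exact gm_mono_nonconst _ (h1 e.inv)
    · rintro ⟨D, hD, ⟨e⟩⟩
      obtain ⟨Γ, hΓ, ⟨e'⟩⟩ := D.genus_one_iff.1 hD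
      exact id_nonconst hdim (e ≪≫ e') _ rfl (h2 Γ hΓ _)
  · rintro ⟨h1, h2, h3, h4⟩
    have hC := isCurve hX hsmooth hconn hdim
    have := hC.int
    refine ⟨fun f => ?_, fun Γ hΓ f => ?_⟩
    · by_contra hf
      rcases gm_case hC f hf with h | h | h
      · exact h1 h
      · exact h2 h
      · exact h3 h
    · by_contra hf
      obtain ⟨⟨i1, i2, i3⟩, i4⟩ := hΓ
      have : IsIntegral Γ.G.left := group_integral
      rcases av_case hC f hf with h | ⟨hp, Δ, hΔ, rfl⟩
      · exact h1 h
      · refine h4 ⟨⟨Δ.G, hsmooth, hp, hconn, hdim, 1, ?_, ?_⟩, rfl, ⟨Iso.refl _⟩⟩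
        · exact ⟨fun h => absurd h one_ne_zero, fun h => absurd h h1⟩
        · exact ⟨fun _ => ⟨Δ, hΔ, ⟨Iso.refl _⟩⟩, fun _ => rfl⟩

end fin
end St6

/-- Let `k` be an algebraically closed field of characteristic zero. A
smooth quasi-projective connected curve `X` over `k` is groupless over `k` iff `X` is not
isomorphic to `ℙ¹` (equivalently: to a genus zero smooth projective curve), to `𝔸¹`, to
`𝔸¹ ∖ {0} = 𝔾ₘ`, nor to a smooth proper connected curve of genus one over `k`.
(Quasi-projectivity is encoded as admitting an open immersion into a proper variety.) -/
theorem stmt_6 (k : Type) [Field k] [IsAlgClosed k] [CharZero k]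
    (X : OverR k) (hX : IsVarietyOver X) (hsmooth : IsSmooth X.hom)
    (hconn : ConnectedSpace X.left) (hdim : topologicalKrullDim X.left = 1)
    (hqp : ∃ (W : OverR k) (j : X ⟶ W), IsProper W.hom ∧ IsOpenImmersion j.left) :
    IsGroupless k X ↔
      (¬ Nonempty (X ≅ P1 k)) ∧ (¬ Nonempty (X ≅ A1O k)) ∧ (¬ Nonempty (X ≅ GmO k)) ∧
      (¬ ∃ D : SmoothProjectiveCurve k, D.genus = 1 ∧ Nonempty (X ≅ D.C)) := by
  exact St6.main hX hsmooth hconn hdim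

end
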